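/- arXiv:0707.2136 — 4 statements merged into one kernel-verified Lean document; each statement's English description precedes it below -/
import Mathlib

section
/- Let (y_1,…,y_d) be a reducing system of parameters of M, where d = dim_R M. Then M is a Cohen–Macaulay R-module if and only if y_d is a non zero divisor on M/(y_1,…,y_{d−1})M. -/
open IsLocalRing

/-- Krull dimension of a module: `dim_R M := dim (R ⧸ Ann_R M)`. -/
noncomputable def moduleDim (R M : Type*) [CommRing R] [AddCommGroup M] [Module R M] :
    WithBot (WithTop ℕ) :=
  ringKrullDim (R ⧸ Module.annihilator R M)

/-- Depth of a module over a local ring: supremum of lengths of regular sequences on `M`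
consisting of elements of the maximal ideal. -/
noncomputable def moduleDepth (R M : Type*) [CommRing R] [IsLocalRing R] [AddCommGroup M]
    [Module R M] : WithBot (WithTop ℕ) :=
  sSup {n : WithBot (WithTop ℕ) | ∃ rs : List R, (rs.length : WithBot (WithTop ℕ)) = n ∧
    (∀ x ∈ rs, x ∈ maximalIdeal R) ∧ RingTheory.Sequence.IsRegular M rs}

/-- `M` is a Cohen–Macaulay module over the local ring `R` iff `depth_R M = dim_R M`. -/
def IsCMModule (R M : Type*) [CommRing R] [IsLocalRing R] [AddCommGroup M] [Module R M] : Prop :=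
  moduleDepth R M = moduleDim R M

/-- `(x 0, …, x (d-1))` is a system of parameters of `M`: the `x i` lie in the maximal ideal,
`d = dim_R M`, and `M ⧸ (x 0, …, x (d-1))M` has finite length. -/
def IsSoP (R M : Type*) [CommRing R] [IsLocalRing R] [AddCommGroup M] [Module R M]
    {d : ℕ} (x : Fin d → R) : Prop :=
  (∀ i, x i ∈ maximalIdeal R) ∧ moduleDim R M = (d : ℕ) ∧
    IsFiniteLength R (M ⧸ (Ideal.span (Set.range x) • (⊤ : Submodule R M)))

/-- A system of parameters `(x 0, …, x (d-1))` of `M` is reducing if for `i = 1, …, d-1`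
(i.e. 0-based indices `i` with `i < d - 1`) the element `x i` avoids all associated primes `P`
of `M ⧸ (x 0, …, x (i-1))M` with `dim R/P = d - (i + 1)`. -/
def IsReducingSoP (R M : Type*) [CommRing R] [IsLocalRing R] [AddCommGroup M] [Module R M]
    {d : ℕ} (x : Fin d → R) : Prop :=
  IsSoP R M x ∧ ∀ i : Fin d, (i : ℕ) < d - 1 →
    ∀ P ∈ associatedPrimes R
      (M ⧸ (Ideal.span (x '' {j : Fin d | (j : ℕ) < (i : ℕ)}) • (⊤ : Submodule R M))),
      ringKrullDim (R ⧸ P) = ((d - ((i : ℕ) + 1) : ℕ) : WithBot (WithTop ℕ)) → x i ∉ P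

/-- `(x 0, …, x (r-1))` is part of a system of parameters of `M`,
i.e. it extends to a system of parameters of `M`. -/
def IsPartSoP (R M : Type*) [CommRing R] [IsLocalRing R] [AddCommGroup M] [Module R M]
    {r : ℕ} (x : Fin r → R) : Prop :=
  ∃ (d : ℕ) (hrd : r ≤ d) (y : Fin d → R), IsSoP R M y ∧ ∀ i : Fin r, y (Fin.castLE hrd i) = x i

/-- `(x 0, …, x (r-1))` is part of a reducing system of parameters of `M`,
i.e. it extends to a reducing system of parameters of `M`. -/
def IsPartReducingSoP (R M : Type*) [CommRing R] [IsLocalRing R] [AddCommGroup M] [Module R M]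
    {r : ℕ} (x : Fin r → R) : Prop :=
  ∃ (d : ℕ) (hrd : r ≤ d) (y : Fin d → R),
    IsReducingSoP R M y ∧ ∀ i : Fin r, y (Fin.castLE hrd i) = x i

section Helpers

open RingTheory.Sequence Module Pointwise

universe u v

variable {R : Type u} [CommRing R] {N : Type v} [AddCommGroup N] [Module R N]

lemma IsArtinian.supportDim_le_zero [Module.Finite R N] [IsArtinian R N] :
    supportDim R N ≤ 0 := by
  obtain ⟨s, hs⟩ := Module.Finite.fg_top (R := R) (M := N)
  let f : R →ₗ[R] (s → N) := LinearMap.pi fun m ↦ LinearMap.toSpanSingleton R N m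
  have hf : LinearMap.ker f = annihilator R N := by
    rw [← Submodule.annihilator_top, ← hs]
    ext r
    simp [f, Submodule.mem_annihilator_span, funext_iff]
  have : IsArtinian R (R ⧸ annihilator R N) := by
    rw [← hf]
    exact isArtinian_of_injective _ (LinearMap.ker_eq_bot.mp (Submodule.ker_liftQ_eq_bot' _ f rfl))
  have : IsArtinianRing (R ⧸ annihilator R N) :=
    isArtinian_of_tower R this
  rw [supportDim_eq_ringKrullDim_quotient_annihilator]
  exact Ring.krullDimLE_iff.mp inferInstance

lemma ringKrullDim_quotient_le_supportDim {p : PrimeSpectrum R} (hp : p ∈ support R N) :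
    ringKrullDim (R ⧸ p.asIdeal) ≤ supportDim R N := by
  rw [← supportDim_quotient_eq_ringKrullDim]
  refine Order.krullDim_le_of_strictMono (fun q ↦ ⟨q.1, mem_support_mono ?_ hp⟩) fun _ _ h ↦ h
  have h := annihilator_le_of_mem_support q.2
  rw [Ideal.annihilator_quotient] at h
  exact h

lemma IsAssociatedPrime.mem_support [IsNoetherianRing R] {P : Ideal R}
    (hP : IsAssociatedPrime P N) : (⟨P, hP.isPrime⟩ : PrimeSpectrum R) ∈ support R N := by
  obtain ⟨hp, x, hx⟩ := isAssociatedPrime_iff.mp hP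
  refine mem_support_iff_exists_annihilator.mpr ⟨x, ?_⟩
  intro r hr
  simpa [hx, Submodule.mem_colon_singleton, Submodule.mem_annihilator_span_singleton] using hr

variable [IsLocalRing R] [IsNoetherianRing R] [Module.Finite R N]

/-- If `x` is regular on `N ⧸ H`, then `H ⧸ xH` embeds into `N ⧸ xN`, so that they share an
associated prime when `H ≠ 0`. -/
lemma exists_mem_associatedPrimes_quotSMulTop {H : Submodule R N} (hH : H ≠ ⊥) {x : R}
    (hx : x ∈ maximalIdeal R) (hreg : IsSMulRegular (N ⧸ H) x) :
    ∃ Q ∈ associatedPrimes R (QuotSMulTop x H), Q ∈ associatedPrimes R (QuotSMulTop x N) := by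
  have : Nontrivial H := (Submodule.nontrivial_iff_ne_bot).mpr hH
  have : Nontrivial (QuotSMulTop x H) := nontrivial_quotSMulTop_of_mem_maximalIdeal H hx
  obtain ⟨Q, hQ⟩ := associatedPrimes.nonempty R (QuotSMulTop x H)
  refine ⟨Q, hQ, associatedPrimes.subset_of_injective (f := QuotSMulTop.map x H.subtype) ?_ hQ⟩
  rw [← LinearMap.ker_eq_bot, LinearMap.ker_eq_bot']
  intro m
  obtain ⟨h, rfl⟩ := Submodule.mkQ_surjective _ m
  intro hm
  have hm : (h : N) ∈ x • (⊤ : Submodule R N) := by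
    rwa [← Submodule.Quotient.mk_eq_zero]
  obtain ⟨n, -, hn⟩ := (Submodule.mem_smul_pointwise_iff_exists _ _ _).mp hm
  have hn' : n ∈ H := mem_of_isSMulRegular_quotient_of_smul_mem hreg (hn ▸ h.2)
  refine (Submodule.Quotient.mk_eq_zero _).mpr ?_
  exact (Submodule.mem_smul_pointwise_iff_exists _ _ _).mpr ⟨⟨n, hn'⟩, trivial, Subtype.ext hn⟩

/-- If `x` is a zero divisor on `N`, some associated prime of `N` containing `x` is contained in
an associated prime of `N ⧸ xN`. -/
lemma exists_le_mem_associatedPrimes_quotSMulTop_of_not_isSMulRegular {x : R}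
    (hx : x ∈ maximalIdeal R) (hreg : ¬ IsSMulRegular N x) :
    ∃ P ∈ associatedPrimes R N, ∃ Q ∈ associatedPrimes R (QuotSMulTop x N), x ∈ P ∧ P ≤ Q := by
  let H : Submodule R N := Submodule.torsion' R N (Submonoid.powers x)
  have mem_H (n : N) : n ∈ H ↔ ∃ k : ℕ, x ^ k • n = 0 := by
    simp [H, Submodule.mem_torsion'_iff, Submonoid.mem_powers_iff, Submonoid.smul_def]
  have hH : H ≠ ⊥ := by
    intro h
    refine hreg (isSMulRegular_iff_right_eq_zero_of_smul.mpr fun n hn ↦ ?_)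
    have : n ∈ H := (mem_H n).mpr ⟨1, by simpa using hn⟩
    simpa [h] using this
  have hquot : IsSMulRegular (N ⧸ H) x := by
    refine (isSMulRegular_quotient_iff_mem_of_smul_mem H x).mpr fun n hn ↦ ?_
    obtain ⟨k, hk⟩ := (mem_H _).mp hn
    exact (mem_H _).mpr ⟨k + 1, by rw [pow_succ, mul_smul, hk]⟩
  obtain ⟨Q, hQH, hQ⟩ := exists_mem_associatedPrimes_quotSMulTop hH hx hquot
  have hQp := hQ.isPrime
  have hsupp := support_subset_of_surjective (Submodule.mkQ (x • (⊤ : Submodule R H)))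
    (Submodule.mkQ_surjective _) (IsAssociatedPrime.mem_support hQH)
  obtain ⟨P, hP, hPQ⟩ := Ideal.exists_minimalPrimes_le (annihilator_le_of_mem_support hsupp)
  have hPH := associatedPrimes.minimalPrimes_annihilator_subset_associatedPrimes R H hP
  refine ⟨P, associatedPrimes.subset_of_injective H.injective_subtype hPH, Q, hQ, ?_, hPQ⟩
  obtain ⟨hPp, h, rfl⟩ := isAssociatedPrime_iff.mp hPH
  obtain ⟨k, hk⟩ := (mem_H _).mp h.2
  refine hPp.mem_of_pow_mem k ?_
  rw [Submodule.mem_colon_singleton]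
  exact Subtype.ext hk

lemma length_le_ringKrullDim_quotient_of_isWeaklyRegular {rs : List R}
    (hmem : ∀ r ∈ rs, r ∈ maximalIdeal R) (hrs : IsWeaklyRegular N rs) {P : Ideal R}
    (hP : P ∈ associatedPrimes R N) : (rs.length : WithBot ℕ∞) ≤ ringKrullDim (R ⧸ P) := by
  induction rs generalizing N P with
  | nil =>
    have := hP.isPrime
    simpa using ringKrullDim_nonneg_of_nontrivial
  | cons x rs ih =>
    obtain ⟨hx, hrs⟩ := (isWeaklyRegular_cons_iff N x rs).mp hrs
    simp only [List.mem_cons, forall_eq_or_imp] at hmem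
    let H : Submodule R N := Submodule.torsionBySet R N P
    have mem_H (n : N) : n ∈ H ↔ ∀ a ∈ P, a • n = 0 := by
      simp [H, Submodule.mem_torsionBySet_iff]
    obtain ⟨hp, n, hn⟩ := isAssociatedPrime_iff.mp hP
    have hmP (a : R) : a ∈ P ↔ a • n = 0 := by rw [hn, Submodule.mem_colon_singleton]; rfl
    have hn0 : n ≠ 0 := by
      rintro rfl
      exact hp.ne_top ((Ideal.eq_top_iff_one _).mpr ((hmP _).mpr (smul_zero _)))
    have hH : H ≠ ⊥ := fun h ↦ hn0 <| by
      have : n ∈ H := (mem_H n).mpr fun a ↦ (hmP a).mp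
      simpa [h] using this
    have hquot : IsSMulRegular (N ⧸ H) x := by
      refine (isSMulRegular_quotient_iff_mem_of_smul_mem H x).mpr fun m hm ↦ (mem_H m).mpr ?_
      intro a ha
      apply hx.right_eq_zero_of_smul
      rw [smul_comm]
      exact (mem_H _).mp hm a ha
    obtain ⟨Q, hQH, hQ⟩ := exists_mem_associatedPrimes_quotSMulTop hH hmem.1 hquot
    have hxP : x ∉ P := fun h ↦ hn0 (hx.right_eq_zero_of_smul ((hmP x).mp h))
    have hsupp := IsAssociatedPrime.mem_support hQH
    rw [support_quotSMulTop] at hsupp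
    have hxreg : IsSMulRegular (R ⧸ P) x := by
      refine (isSMulRegular_quotient_iff_mem_of_smul_mem P x).mpr fun a ha ↦ ?_
      exact (hp.mem_or_mem ha).resolve_left hxP
    have hQP : (⟨Q, hQ.isPrime⟩ : PrimeSpectrum R) ∈ support R (QuotSMulTop x (R ⧸ P)) := by
      rw [support_quotSMulTop]
      refine ⟨?_, hsupp.2⟩
      rw [mem_support_iff_of_finite, Ideal.annihilator_quotient]
      refine le_trans (fun a ha ↦ ?_) (annihilator_le_of_mem_support hsupp.1)
      exact mem_annihilator.mpr fun h ↦ Subtype.ext ((mem_H _).mp h.2 a ha)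
    rw [← supportDim_quotient_eq_ringKrullDim,
      ← supportDim_quotSMulTop_succ_eq_supportDim hxreg hmem.1, List.length_cons, Nat.cast_add,
      Nat.cast_one]
    gcongr
    exact (ih hmem.2 hrs hQ).trans (ringKrullDim_quotient_le_supportDim (p := ⟨Q, hQ.isPrime⟩) hQP)

lemma supportDim_le_supportDim_quotient_ofList_add_length {rs : List R}
    (hmem : ∀ r ∈ rs, r ∈ maximalIdeal R) :
    supportDim R N ≤ supportDim R (N ⧸ Ideal.ofList rs • (⊤ : Submodule R N)) + rs.length := by
  induction rs generalizing N with
  | nil =>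
    rw [Ideal.ofList_nil, Submodule.bot_smul]
    simpa using (supportDim_eq_of_equiv (Submodule.quotEquivOfEqBot (⊥ : Submodule R N) rfl)).ge
  | cons x rs ih =>
    simp only [List.mem_cons, forall_eq_or_imp] at hmem
    rw [supportDim_eq_of_equiv (Submodule.quotOfListConsSMulTopEquivQuotSMulTopInner N x rs),
      List.length_cons, Nat.cast_add, Nat.cast_one, ← add_assoc]
    refine (supportDim_le_supportDim_quotSMulTop_succ hmem.1).trans ?_
    gcongr
    exact ih hmem.2

lemma exists_isSMulRegular_of_maximalIdeal_notMem_associatedPrimes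
    (h : maximalIdeal R ∉ associatedPrimes R N) : ∃ z ∈ maximalIdeal R, IsSMulRegular N z := by
  by_contra! hz
  have hsub : (maximalIdeal R : Set R) ⊆ ⋃ P ∈ associatedPrimes R N, (id P : Ideal R) := by
    simp_rw [id, biUnion_associatedPrimes_eq_compl_regular]
    exact hz
  obtain ⟨P, hP, hle⟩ := (Ideal.subset_union_prime_finite (associatedPrimes.finite R N) 0 0
    fun _ hP _ _ ↦ hP.isPrime).mp hsub
  exact h ((maximalIdeal.isMaximal R).eq_of_le hP.isPrime.ne_top hle ▸ hP)

omit [Module.Finite R N] in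
lemma maximalIdeal_notMem_associatedPrimes_of_isSMulRegular {x : R} (hx : x ∈ maximalIdeal R)
    (hreg : IsSMulRegular N x) : maximalIdeal R ∉ associatedPrimes R N := by
  intro h
  have : x ∈ ⋃ P ∈ associatedPrimes R N, (P : Set R) := Set.mem_biUnion h hx
  rw [biUnion_associatedPrimes_eq_compl_regular] at this
  exact this hreg

omit [Module.Finite R N] in
lemma maximalIdeal_mem_associatedPrimes_quotSMulTop {x y : R} (hx : x ∈ maximalIdeal R)
    (hxreg : IsSMulRegular N x) (hyreg : IsSMulRegular N y)
    (h : maximalIdeal R ∈ associatedPrimes R (QuotSMulTop y N)) :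
    maximalIdeal R ∈ associatedPrimes R (QuotSMulTop x N) := by
  obtain ⟨hp, u', hu⟩ := isAssociatedPrime_iff.mp h
  obtain ⟨u, rfl⟩ := Submodule.mkQ_surjective _ u'
  have hu (a : R) : a ∈ maximalIdeal R ↔ ∃ w, y • w = a • u := by
    rw [hu, Submodule.mem_colon_singleton, ← map_smul, Submodule.mem_bot, Submodule.mkQ_apply,
      Submodule.Quotient.mk_eq_zero]
    simp [Submodule.mem_smul_pointwise_iff_exists]
  obtain ⟨v, hv⟩ := (hu x).mp hx
  refine isAssociatedPrime_iff.mpr ⟨hp, Submodule.mkQ _ v, ?_⟩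
  refine (maximalIdeal.isMaximal R).eq_of_le ?_ fun a ha ↦ ?_
  · rw [Ideal.ne_top_iff_one, Submodule.mem_colon_singleton]
    intro h1
    obtain ⟨v', rfl⟩ : ∃ v', x • v' = v := by
      simpa [Submodule.mem_smul_pointwise_iff_exists] using h1
    rw [smul_comm] at hv
    exact hp.ne_top ((Ideal.eq_top_iff_one _).mpr
      ((hu 1).mpr ⟨v', by simpa using hxreg hv⟩))
  · obtain ⟨w, hw⟩ := (hu a).mp ha
    rw [Submodule.mem_colon_singleton, ← map_smul, Submodule.mem_bot, Submodule.mkQ_apply,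
      Submodule.Quotient.mk_eq_zero]
    suffices ∃ w, x • w = a • v by simpa [Submodule.mem_smul_pointwise_iff_exists] using this
    refine ⟨w, hyreg ?_⟩
    simp only
    rw [smul_comm, hw, smul_comm y a v, hv, smul_comm]

/-- Every regular element can be completed to a regular sequence of a given length not exceeding
the length of some regular sequence. -/
lemma exists_isWeaklyRegular_cons {y : R} (hy : y ∈ maximalIdeal R) (hreg : IsSMulRegular N y)
    {n : ℕ} (h : ∃ rs : List R, rs.length = n + 1 ∧ (∀ r ∈ rs, r ∈ maximalIdeal R) ∧
      IsWeaklyRegular N rs) :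
    ∃ rs : List R, rs.length = n ∧ (∀ r ∈ rs, r ∈ maximalIdeal R) ∧
      IsWeaklyRegular N (y :: rs) := by
  induction n generalizing N y with
  | zero => exact ⟨[], rfl, by simp, (isWeaklyRegular_singleton_iff N y).mpr hreg⟩
  | succ n ih =>
    obtain ⟨rs, hlen, hmem, hrs⟩ := h
    match rs, hlen, hmem, hrs with
    | x :: x' :: rs, hlen, hmem, hrs =>
      obtain ⟨hx, hrs⟩ := (isWeaklyRegular_cons_iff N x _).mp hrs
      have hmx := hmem x (by simp)
      obtain ⟨z, hz, hzreg⟩ : ∃ z ∈ maximalIdeal R,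
          IsSMulRegular (QuotSMulTop x N × QuotSMulTop y N) z := by
        apply exists_isSMulRegular_of_maximalIdeal_notMem_associatedPrimes
        rw [associatedPrimes.prod, Set.mem_union, not_or]
        have hnot := maximalIdeal_notMem_associatedPrimes_of_isSMulRegular
          (hmem x' (by simp)) ((isWeaklyRegular_cons_iff _ x' rs).mp hrs).1
        exact ⟨hnot, fun h ↦ hnot (maximalIdeal_mem_associatedPrimes_quotSMulTop hmx hx hreg h)⟩
      have hzx : IsSMulRegular (QuotSMulTop x N) z :=
        hzreg.of_injective (LinearMap.inl R _ _) LinearMap.inl_injective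
      have hzy : IsSMulRegular (QuotSMulTop y N) z :=
        hzreg.of_injective (LinearMap.inr R _ _) LinearMap.inr_injective
      have swap {a b : R} {l : List R} (ha : a ∈ maximalIdeal R) (hb : b ∈ maximalIdeal R)
          (hl : ∀ r ∈ l, r ∈ maximalIdeal R) (h : IsWeaklyRegular N (a :: b :: l)) :
          IsWeaklyRegular N (b :: a :: l) :=
        isWeaklyRegular_of_perm_of_subset_maximalIdeal h (List.Perm.swap b a l)
          (by simp only [List.forall_mem_cons]; exact ⟨ha, hb, hl⟩)
      obtain ⟨ts, hts, htm, htr⟩ := ih hz hzx ⟨x' :: rs, by simpa using hlen,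
        fun r hr ↦ hmem r (List.mem_cons_of_mem _ hr), hrs⟩
      have hzts := (isWeaklyRegular_cons_iff N z _).mp (swap hmx hz htm (htr.cons hx))
      have hyz := ((isWeaklyRegular_cons_iff N z _).mp (swap hy hz (l := []) (by simp)
        (((isWeaklyRegular_singleton_iff _ z).mpr hzy).cons hreg))).2
      obtain ⟨us, hus, hum, hur⟩ := ih hy ((isWeaklyRegular_singleton_iff _ y).mp hyz)
        ⟨x :: ts, by simp [hts], List.forall_mem_cons.mpr ⟨hmx, htm⟩, hzts.2⟩
      exact ⟨z :: us, by simp [hus], List.forall_mem_cons.mpr ⟨hz, hum⟩,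
        swap hz hy hum (hur.cons hzts.1)⟩

lemma ringKrullDim_quotient_le_length {x : R} {rs : List R}
    (hmem : ∀ r ∈ rs, r ∈ maximalIdeal R)
    (hdim : supportDim R (N ⧸ Ideal.ofList (x :: rs) • (⊤ : Submodule R N)) ≤ 0)
    {P : Ideal R} (hP : P ∈ associatedPrimes R N) (hx : x ∈ P) :
    ringKrullDim (R ⧸ P) ≤ rs.length := by
  have hsupp : (⟨P, hP.isPrime⟩ : PrimeSpectrum R) ∈ support R (QuotSMulTop x N) := by
    rw [support_quotSMulTop]
    exact ⟨IsAssociatedPrime.mem_support hP, by simpa using hx⟩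
  rw [supportDim_eq_of_equiv (Submodule.quotOfListConsSMulTopEquivQuotSMulTopInner N x rs)]
    at hdim
  calc ringKrullDim (R ⧸ P) ≤ supportDim R (QuotSMulTop x N) :=
        ringKrullDim_quotient_le_supportDim (p := ⟨P, hP.isPrime⟩) hsupp
    _ ≤ _ := supportDim_le_supportDim_quotient_ofList_add_length hmem
    _ ≤ 0 + rs.length := by gcongr
    _ = rs.length := zero_add _

/-- On a module admitting a regular sequence of length `n`, every sequence of length `n` cutting
the dimension down to zero is regular. -/
lemma isWeaklyRegular_of_exists_isWeaklyRegular {rs : List R}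
    (hmem : ∀ r ∈ rs, r ∈ maximalIdeal R)
    (hdim : supportDim R (N ⧸ Ideal.ofList rs • (⊤ : Submodule R N)) ≤ 0)
    (h : ∃ ts : List R, ts.length = rs.length ∧ (∀ r ∈ ts, r ∈ maximalIdeal R) ∧
      IsWeaklyRegular N ts) : IsWeaklyRegular N rs := by
  induction rs generalizing N with
  | nil => exact .nil R N
  | cons x rs ih =>
    obtain ⟨hx, hmem⟩ := List.forall_mem_cons.mp hmem
    have hreg : IsSMulRegular N x := by
      by_contra hreg
      obtain ⟨P, hP, -, -, hxP, -⟩ :=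
        exists_le_mem_associatedPrimes_quotSMulTop_of_not_isSMulRegular hx hreg
      obtain ⟨ts, hlen, htm, hts⟩ := h
      have h1 := length_le_ringKrullDim_quotient_of_isWeaklyRegular htm hts hP
      have h2 := h1.trans (ringKrullDim_quotient_le_length hmem hdim hP hxP)
      rw [hlen, List.length_cons] at h2
      exact absurd (Nat.cast_le.mp h2) (by simp)
    obtain ⟨ts, hlen, htm, hts⟩ := exists_isWeaklyRegular_cons hx hreg h
    refine .cons hreg (ih hmem ?_ ⟨ts, hlen, htm, ((isWeaklyRegular_cons_iff N x ts).mp hts).2⟩)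
    rwa [← supportDim_eq_of_equiv (Submodule.quotOfListConsSMulTopEquivQuotSMulTopInner N x rs)]

/-- If each `rs[i]` avoids the associated primes of `N ⧸ (rs[0], …, rs[i - 1])N` of coheight
`rs.length - i` and `y` is regular on `N ⧸ (rs)N`, then `rs, y` is a regular sequence as soon as it
cuts the dimension down to zero. -/
lemma isWeaklyRegular_append_singleton_of_isSMulRegular {rs : List R} {y : R}
    (hmem : ∀ r ∈ rs, r ∈ maximalIdeal R) (hy : y ∈ maximalIdeal R)
    (hdim : supportDim R (N ⧸ Ideal.ofList (rs ++ [y]) • (⊤ : Submodule R N)) ≤ 0)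
    (hred : ∀ (i : ℕ) (hi : i < rs.length), ∀ P ∈ associatedPrimes R
      (N ⧸ Ideal.ofList (rs.take i) • (⊤ : Submodule R N)),
      ringKrullDim (R ⧸ P) = ((rs.length - i : ℕ) : WithBot ℕ∞) → rs[i] ∉ P)
    (hreg : IsSMulRegular (N ⧸ Ideal.ofList rs • (⊤ : Submodule R N)) y) :
    IsWeaklyRegular N (rs ++ [y]) := by
  induction rs generalizing N with
  | nil =>
    rw [Ideal.ofList_nil, Submodule.bot_smul] at hreg
    exact (isWeaklyRegular_singleton_iff N y).mpr
      (((Submodule.quotEquivOfEqBot (⊥ : Submodule R N) rfl).isSMulRegular_congr y).mp hreg)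
  | cons x rs ih =>
    obtain ⟨hx, hmem⟩ := List.forall_mem_cons.mp hmem
    have hmem' : ∀ r ∈ rs ++ [y], r ∈ maximalIdeal R :=
      List.forall_mem_append.mpr ⟨hmem, List.forall_mem_singleton.mpr hy⟩
    have hrs : IsWeaklyRegular (QuotSMulTop x N) (rs ++ [y]) := by
      refine ih hmem ?_ (fun i hi P hP hPdim ↦ ?_) ?_
      · rwa [← supportDim_eq_of_equiv
          (Submodule.quotOfListConsSMulTopEquivQuotSMulTopInner N x (rs ++ [y]))]
      · refine hred (i + 1) (by simpa using hi) P ?_ (by simpa using hPdim)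
        rw [List.take_succ_cons, LinearEquiv.AssociatedPrimes.eq
          (Submodule.quotOfListConsSMulTopEquivQuotSMulTopInner N x (rs.take i))]
        exact hP
      · exact ((Submodule.quotOfListConsSMulTopEquivQuotSMulTopInner N x rs).isSMulRegular_congr
          y).mp hreg
    refine .cons ?_ hrs
    by_contra hxreg
    obtain ⟨P, hP, Q, hQ, hxP, hPQ⟩ :=
      exists_le_mem_associatedPrimes_quotSMulTop_of_not_isSMulRegular hx hxreg
    have hle := ringKrullDim_quotient_le_length hmem' hdim hP hxP
    have hge := (length_le_ringKrullDim_quotient_of_isWeaklyRegular hmem' hrs hQ).trans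
      (ringKrullDim_le_of_surjective (Ideal.Quotient.factor hPQ)
        (Ideal.Quotient.factor_surjective hPQ))
    refine hred 0 (by simp) P ?_ (by simpa using le_antisymm hle hge) hxP
    rw [List.take_zero, Ideal.ofList_nil, Submodule.bot_smul]
    exact (LinearEquiv.AssociatedPrimes.eq
      (Submodule.quotEquivOfEqBot (⊥ : Submodule R N) rfl)).symm ▸ hP

lemma length_le_supportDim_of_isRegular {rs : List R} (hrs : IsRegular N rs) :
    (rs.length : WithBot ℕ∞) ≤ supportDim R N := by
  have := hrs.quot_ofList_smul_nontrivial ⊤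
  rw [← supportDim_add_length_eq_supportDim_of_isRegular rs hrs]
  refine le_add_of_nonneg_left ?_
  obtain ⟨p⟩ := (nonempty_support_of_nontrivial
    (R := R) (M := N ⧸ Ideal.ofList rs • (⊤ : Submodule R N))).to_subtype
  have : Nonempty (support R (N ⧸ Ideal.ofList rs • (⊤ : Submodule R N))) := ⟨p⟩
  exact Order.krullDim_nonneg

end Helpers

section Depth

open RingTheory.Sequence Module

variable {R M : Type*} [CommRing R] [IsLocalRing R] [IsNoetherianRing R]
    [AddCommGroup M] [Module R M] [Module.Finite R M] [Nontrivial M]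

lemma isCMModule_iff_exists_isWeaklyRegular {d : ℕ} (hd : moduleDim R M = d) :
    IsCMModule R M ↔ ∃ ts : List R, ts.length = d ∧ (∀ r ∈ ts, r ∈ maximalIdeal R) ∧
      IsWeaklyRegular M ts := by
  have hdim : supportDim R M = d :=
    (supportDim_eq_ringKrullDim_quotient_annihilator R M).trans hd
  rw [IsCMModule, hd, moduleDepth]
  constructor
  · intro h
    suffices ∃ ts : List R, d ≤ ts.length ∧ (∀ r ∈ ts, r ∈ maximalIdeal R) ∧
        IsWeaklyRegular M ts by
      obtain ⟨ts, hlen, hmem, hts⟩ := this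
      refine ⟨ts.take d, by simpa using hlen, fun r hr ↦ hmem r (List.mem_of_mem_take hr), ?_⟩
      rw [← List.take_append_drop d ts, isWeaklyRegular_append_iff] at hts
      exact hts.1
    cases d with
    | zero => exact ⟨[], le_rfl, by simp, .nil R M⟩
    | succ n =>
      have hlt : ((n : ℕ) : WithBot ℕ∞) < ((n + 1 : ℕ) : WithBot ℕ∞) :=
        Nat.cast_lt.mpr n.lt_succ_self
      obtain ⟨_, ⟨ts, rfl, hmem, hts⟩, hn⟩ := lt_sSup_iff.mp (hlt.trans_eq h.symm)
      exact ⟨ts, Nat.cast_lt.mp hn, hmem, hts.toIsWeaklyRegular⟩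
  · rintro ⟨ts, hlen, hmem, hts⟩
    apply le_antisymm
    · refine sSup_le ?_
      rintro _ ⟨rs, rfl, -, hrs⟩
      exact (length_le_supportDim_of_isRegular hrs).trans_eq hdim
    · exact le_sSup ⟨ts, congrArg _ hlen, hmem, .of_isWeaklyRegular_of_mem_maximalIdeal M hmem hts⟩

end Depth

lemma ofList_take_ofFn {R : Type*} [CommRing R] {n i : ℕ} (y : Fin (n + 1) → R) (hi : i ≤ n) :
    Ideal.ofList ((List.ofFn fun j : Fin n ↦ y j.castSucc).take i) =
      Ideal.span (y '' {j | (j : ℕ) < i}) := by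
  refine congrArg Ideal.span (Set.ext fun r ↦ ?_)
  simp only [Set.mem_ofPred_eq, List.mem_take_iff_getElem, Set.mem_image, List.getElem_ofFn,
    List.length_ofFn]
  constructor
  · rintro ⟨j, hj, rfl⟩
    exact ⟨_, by simpa using (lt_min_iff.mp hj).1, rfl⟩
  · rintro ⟨j, hj, rfl⟩
    exact ⟨j, lt_min hj (hj.trans_le hi), rfl⟩

theorem stmt0 (R M : Type*) [CommRing R] [IsLocalRing R] [IsNoetherianRing R]
    [AddCommGroup M] [Module R M] [Module.Finite R M] [Nontrivial M]
    {d : ℕ} (hd : 0 < d) (y : Fin d → R) (hy : IsReducingSoP R M y) :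
    IsCMModule R M ↔
      IsSMulRegular
        (M ⧸ (Ideal.span (y '' {j : Fin d | (j : ℕ) < d - 1}) • (⊤ : Submodule R M)))
        (y ⟨d - 1, Nat.sub_lt hd Nat.one_pos⟩) := by
  obtain ⟨n, rfl⟩ := Nat.exists_eq_succ_of_ne_zero hd.ne'
  obtain ⟨⟨hmem, hdim, hfin⟩, hred⟩ := hy
  rw [isCMModule_iff_exists_isWeaklyRegular hdim]
  let rs : List R := List.ofFn fun j : Fin n ↦ y j.castSucc
  have hlen : rs.length = n := List.length_ofFn
  have hrs : rs ++ [y (Fin.last n)] = List.ofFn y := (List.ofFn_succ_last ..).symm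
  have hspan : Ideal.span (y '' {j | (j : ℕ) < n}) = Ideal.ofList rs := by
    rw [← ofList_take_ofFn y le_rfl, List.take_of_length_le hlen.le]
  have hrsmem : ∀ r ∈ rs, r ∈ maximalIdeal R := by
    simpa only [rs, List.forall_mem_ofFn_iff] using fun j : Fin n ↦ hmem j.castSucc
  have hmem' : ∀ r ∈ rs ++ [y (Fin.last n)], r ∈ maximalIdeal R := by
    simpa only [hrs, List.forall_mem_ofFn_iff] using hmem
  have hdim0 : Module.supportDim R
      (M ⧸ Ideal.ofList (rs ++ [y (Fin.last n)]) • (⊤ : Submodule R M)) ≤ 0 := by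
    have hrange : Ideal.ofList (rs ++ [y (Fin.last n)]) = Ideal.span (Set.range y) := by
      rw [hrs]
      exact congrArg Ideal.span (Set.ext fun r ↦ List.mem_ofFn)
    rw [hrange]
    have := (isFiniteLength_iff_isNoetherian_isArtinian.mp hfin).2
    exact IsArtinian.supportDim_le_zero
  change _ ↔ IsSMulRegular (M ⧸ (Ideal.span (y '' {j | (j : ℕ) < n}) • (⊤ : Submodule R M)))
    (y (Fin.last n))
  rw [hspan]
  constructor
  · rintro ⟨ts, hts, h⟩
    have := isWeaklyRegular_of_exists_isWeaklyRegular hmem' hdim0 ⟨ts, by simp [hts, hlen], h⟩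
    rw [RingTheory.Sequence.isWeaklyRegular_append_iff,
      RingTheory.Sequence.isWeaklyRegular_singleton_iff] at this
    exact this.2
  · intro hreg
    refine ⟨_, by simp [hlen], hmem',
      isWeaklyRegular_append_singleton_of_isSMulRegular hrsmem (hmem _) hdim0 ?_ hreg⟩
    intro i hi P hP hPdim
    rw [hlen] at hi hPdim
    rw [ofList_take_ofFn y hi.le] at hP
    have := hred (Fin.castSucc ⟨i, hi⟩) hi P hP
      (hPdim.trans (congrArg Nat.cast (Nat.succ_sub_succ n i).symm))
    simpa [rs] using this
end

section
/- Let (x_1,…,x_r) be part of a system of parameters of M with 0 ≤ r < d = dim_R M. Then (x_1,…,x_r) is part of a reducing system of parameters of M if and only if for every prime P ∈ Supp M ∩ V(x_1,…,x_r) with dim R/P = d − r, the localization M_P is an r-dimensional Cohen–Macaulay module over R_P. -/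
open IsLocalRing

open RingTheory.Sequence Pointwise

namespace ReducingSoP

section Local

variable {R M : Type*} [CommRing R] [IsNoetherianRing R] [AddCommGroup M] [Module R M]

/-- An element outside all associated primes of `M` is regular on `M`. -/
lemma isSMulRegular_of_forall_notMem {x : R} (h : ∀ P ∈ associatedPrimes R M, x ∉ P) :
    IsSMulRegular M x := by
  by_contra hx
  have : x ∈ ({r : R | IsSMulRegular M r}ᶜ : Set R) := hx
  rw [← biUnion_associatedPrimes_eq_compl_regular] at this
  simp only [Set.mem_iUnion, SetLike.mem_coe, exists_prop] at this
  obtain ⟨P, hP, hxP⟩ := this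
  exact h P hP hxP

lemma notMem_of_isSMulRegular {x : R} (h : IsSMulRegular M x) {P : Ideal R}
    (hP : P ∈ associatedPrimes R M) : x ∉ P := by
  intro hx
  have : x ∈ ({r : R | IsSMulRegular M r}ᶜ : Set R) := by
    rw [← biUnion_associatedPrimes_eq_compl_regular]
    exact Set.mem_biUnion hP hx
  exact this h

/-- An associated prime is the exact annihilator of some element. -/
lemma exists_forall_smul_eq_zero_iff {P : Ideal R} (hP : P ∈ associatedPrimes R M) :
    ∃ m : M, ∀ a : R, a ∈ P ↔ a • m = 0 := by
  obtain ⟨-, m, rfl⟩ := isAssociatedPrime_iff.mp hP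
  exact ⟨m, fun a ↦ by simp [Submodule.mem_colon_singleton]⟩

lemma mem_support_of_mem_associatedPrimes {P : Ideal R} (hP : P ∈ associatedPrimes R M) :
    (⟨P, hP.1⟩ : PrimeSpectrum R) ∈ Module.support R M := by
  obtain ⟨m, hm⟩ := exists_forall_smul_eq_zero_iff hP
  rw [Module.mem_support_iff']
  refine ⟨m, fun r hr h ↦ hr ((hm r).mpr h)⟩

/-- A nonzero element killed by an ideal `I` yields an associated prime containing `I`. -/
lemma exists_associatedPrime_ge {I : Ideal R} {m : M} (hm : m ≠ 0) (h : ∀ a ∈ I, a • m = 0) :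
    ∃ P ∈ associatedPrimes R M, I ≤ P := by
  obtain ⟨P, hP, hle⟩ := exists_le_isAssociatedPrime_of_isNoetherianRing R m hm
  exact ⟨P, hP, fun a ha ↦ hle (by simp [Submodule.mem_colon_singleton, h a ha])⟩

/-- Every prime of the support contains an associated prime. -/
lemma exists_associatedPrime_le [Module.Finite R M] {P : PrimeSpectrum R}
    (hP : P ∈ Module.support R M) : ∃ Q ∈ associatedPrimes R M, Q ≤ P.asIdeal := by
  obtain ⟨Q, hQ, hle⟩ := Ideal.exists_minimalPrimes_le (Module.mem_support_iff_of_finite.mp hP)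
  exact ⟨Q, Module.associatedPrimes.minimalPrimes_annihilator_subset_associatedPrimes R M hQ, hle⟩

variable [IsLocalRing R] [Module.Finite R M]

/-- An associated prime of `M` specializes to an associated prime of `M ⧸ xM` containing `x`,
if `x` is regular on `M`. -/
lemma exists_associatedPrime_quotSMulTop {x : R} (hx : x ∈ maximalIdeal R)
    (hreg : IsSMulRegular M x) {P : Ideal R} (hP : P ∈ associatedPrimes R M) :
    ∃ Q ∈ associatedPrimes R (QuotSMulTop x M), P ≤ Q ∧ x ∈ Q := by
  let N : Submodule R M := Submodule.torsionBySet R M P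
  have hN : ∀ m : M, m ∈ N ↔ ∀ a ∈ P, a • m = 0 := fun m ↦ by
    simp [N, Submodule.mem_torsionBySet_iff]
  by_cases hle : N ≤ x • (⊤ : Submodule R M)
  · exfalso
    have hNx : N ≤ Ideal.span {x} • N := by
      intro n hn
      obtain ⟨m, -, rfl⟩ := (Submodule.mem_smul_pointwise_iff_exists _ _ _).mp (hle hn)
      refine Submodule.smul_mem_smul (Ideal.mem_span_singleton_self x) ((hN m).mpr fun a ha ↦ ?_)
      apply hreg
      simp only [smul_zero]
      rw [smul_comm]
      exact (hN _).mp hn a ha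
    have hbot : N = ⊥ := Submodule.eq_bot_of_le_smul_of_le_jacobson_bot _ N
      (IsNoetherian.noetherian N) hNx (by
        rw [IsLocalRing.jacobson_eq_maximalIdeal _ bot_ne_top]
        simpa [Ideal.span_le] using hx)
    obtain ⟨m, hm⟩ := exists_forall_smul_eq_zero_iff hP
    have hmN : m ∈ N := (hN m).mpr fun a ha ↦ (hm a).mp ha
    rw [hbot, Submodule.mem_bot] at hmN
    exact hP.1.ne_top ((Ideal.eq_top_iff_one P).mpr ((hm 1).mpr (by simp [hmN])))
  · obtain ⟨n, hn, hnx⟩ := SetLike.not_le_iff_exists.mp hle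
    obtain ⟨Q, hQ, hle'⟩ := exists_associatedPrime_ge (I := P ⊔ Ideal.span {x})
      (m := (Submodule.Quotient.mk n : QuotSMulTop x M))
      (by simpa [Submodule.Quotient.mk_eq_zero] using hnx) (by
        intro a ha
        obtain ⟨b, hb, c, hc, rfl⟩ := Submodule.mem_sup.mp ha
        obtain ⟨c, rfl⟩ := Ideal.mem_span_singleton'.mp hc
        rw [← Submodule.Quotient.mk_smul, Submodule.Quotient.mk_eq_zero, add_smul,
          (hN n).mp hn b hb, zero_add, mul_comm, mul_smul]
        exact Submodule.smul_mem_pointwise_smul _ _ _ trivial)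
    exact ⟨Q, hQ, le_sup_left.trans hle',
      hle' (Ideal.mem_sup_right (Ideal.mem_span_singleton_self x))⟩

omit [IsNoetherianRing R] [IsLocalRing R] in
lemma succ_le_ringKrullDim_quotient {P Q : Ideal R} (hP : P.IsPrime) (hQ : Q.IsPrime)
    (hlt : P < Q) {n : ℕ} (h : (n : WithBot ℕ∞) ≤ ringKrullDim (R ⧸ Q)) :
    ((n + 1 : ℕ) : WithBot ℕ∞) ≤ ringKrullDim (R ⧸ P) := by
  rw [ringKrullDim_quotient] at h ⊢
  obtain ⟨l, hl⟩ := Order.le_krullDim_iff.mp h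
  let l' : LTSeries (PrimeSpectrum.zeroLocus (P : Set R)) :=
    l.map (fun p ↦ ⟨p.1, hlt.le.trans p.2⟩) (fun _ _ h ↦ h)
  have hlt' : (⟨⟨P, hP⟩, le_refl P⟩ : PrimeSpectrum.zeroLocus (P : Set R)) < l'.head :=
    lt_of_lt_of_le (b := (⟨⟨Q, hQ⟩, hlt.le⟩ : PrimeSpectrum.zeroLocus (P : Set R)))
    hlt l.head.2
  exact Order.le_krullDim_iff.mpr ⟨l'.cons _ hlt', by
    rw [RelSeries.cons_length]; exact congrArg (· + 1) hl⟩

omit [IsNoetherianRing R] [IsLocalRing R] in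
lemma zero_le_ringKrullDim_quotient {P : Ideal R} (hP : P.IsPrime) :
    ((0 : ℕ) : WithBot ℕ∞) ≤ ringKrullDim (R ⧸ P) := by
  have := Ideal.Quotient.nontrivial_iff.mpr hP.ne_top
  exact_mod_cast ringKrullDim_nonneg_of_nontrivial

/-- The length of a regular sequence on `M` is at most `dim R ⧸ P` for each associated prime. -/
lemma length_le_ringKrullDim_quotient (rs : List R) (hrs : ∀ x ∈ rs, x ∈ maximalIdeal R)
    (hreg : IsWeaklyRegular M rs) {P : Ideal R} (hP : P ∈ associatedPrimes R M) :
    (rs.length : WithBot ℕ∞) ≤ ringKrullDim (R ⧸ P) := by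
  induction rs generalizing M P with
  | nil => exact zero_le_ringKrullDim_quotient hP.1
  | cons x rs ih =>
    rw [isWeaklyRegular_cons_iff] at hreg
    simp only [List.mem_cons, forall_eq_or_imp] at hrs
    obtain ⟨Q, hQ, hle, hxQ⟩ := exists_associatedPrime_quotSMulTop hrs.1 hreg.1 hP
    refine succ_le_ringKrullDim_quotient hP.1 hQ.1 (lt_of_le_of_ne hle ?_) (ih hrs.2 hreg.2 hQ)
    rintro rfl
    exact notMem_of_isSMulRegular hreg.1 hP hxQ

omit [Module.Finite R M] in
/-- The maximal ideal is associated to `M ⧸ xM` only if it is associated to `M ⧸ yM`, for regular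
elements `x` and `y`. -/
lemma maximalIdeal_mem_associatedPrimes_quotSMulTop {x y : R} (hx : IsSMulRegular M x)
    (hy : IsSMulRegular M y) (hym : y ∈ maximalIdeal R)
    (h : maximalIdeal R ∈ associatedPrimes R (QuotSMulTop x M)) :
    maximalIdeal R ∈ associatedPrimes R (QuotSMulTop y M) := by
  obtain ⟨u, hu⟩ := exists_forall_smul_eq_zero_iff h
  obtain ⟨u, rfl⟩ := Submodule.Quotient.mk_surjective _ u
  have key : ∀ a : R, a ∈ maximalIdeal R ↔ ∃ w : M, x • w = a • u := fun a ↦ by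
    rw [hu a, ← Submodule.Quotient.mk_smul, Submodule.Quotient.mk_eq_zero,
      Submodule.mem_smul_pointwise_iff_exists]
    simp
  obtain ⟨v, hv⟩ := (key y).mp hym
  have hne : (Submodule.Quotient.mk v : QuotSMulTop y M) ≠ 0 := by
    intro h0
    rw [Submodule.Quotient.mk_eq_zero, Submodule.mem_smul_pointwise_iff_exists] at h0
    obtain ⟨w, -, rfl⟩ := h0
    have : (1 : R) ∈ maximalIdeal R := (key 1).mpr ⟨w, by
      apply hy
      simp only
      rw [smul_comm, hv, one_smul]⟩
    exact (Ideal.ne_top_iff_one _).mp (maximalIdeal.isMaximal R).ne_top this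
  obtain ⟨P, hP, hle⟩ := exists_associatedPrime_ge (I := maximalIdeal R) hne (by
    intro a ha
    obtain ⟨w, hw⟩ := (key a).mp ha
    rw [← Submodule.Quotient.mk_smul, Submodule.Quotient.mk_eq_zero,
      Submodule.mem_smul_pointwise_iff_exists]
    refine ⟨w, trivial, ?_⟩
    apply hx
    simp only
    rw [smul_comm, hw, smul_comm x a v, hv, smul_comm])
  rwa [(maximalIdeal.isMaximal R).eq_of_le hP.1.ne_top hle]

omit [IsNoetherianRing R] in
/-- Prime avoidance for the maximal ideal and a finite set of primes different from it. -/
lemma exists_mem_maximalIdeal_forall_notMem {s : Set (Ideal R)} (hs : s.Finite)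
    (h : ∀ P ∈ s, P.IsPrime ∧ P ≠ maximalIdeal R) :
    ∃ z ∈ maximalIdeal R, ∀ P ∈ s, z ∉ P := by
  by_contra! hcon
  have hsub : (maximalIdeal R : Set R) ⊆
      ⋃ P ∈ (↑hs.toFinset : Set (Ideal R)), (id P : Ideal R) := by
    intro z hz
    obtain ⟨P, hP, hzP⟩ := hcon z hz
    exact Set.mem_biUnion (by simpa using hP) hzP
  obtain ⟨P, hP, hle⟩ := (Ideal.subset_union_prime ⊤ ⊤ (by
    intro P hP _ _
    exact (h P (by simpa using hP)).1)).mp hsub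
  have hP' := h P (by simpa using hP)
  exact hP'.2 ((maximalIdeal.isMaximal R).eq_of_le hP'.1.ne_top hle).symm

lemma exists_isRegular_quotSMulTop (n : ℕ) {x : R} (hxm : x ∈ maximalIdeal R)
    (hx : IsSMulRegular M x) {rs : List R} (hlen : rs.length = n + 1)
    (hrs : ∀ y ∈ rs, y ∈ maximalIdeal R) (hreg : IsWeaklyRegular M rs) :
    ∃ ys : List R, ys.length = n ∧ (∀ y ∈ ys, y ∈ maximalIdeal R) ∧
      IsWeaklyRegular (QuotSMulTop x M) ys := by
  induction n generalizing M x rs with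
  | zero => exact ⟨[], rfl, by simp, IsWeaklyRegular.nil R _⟩
  | succ n ih =>
    obtain _ | ⟨y, _ | ⟨y', ys⟩⟩ := rs
    · simp at hlen
    · simp at hlen
    simp only [List.mem_cons, forall_eq_or_imp] at hrs
    obtain ⟨hy, hreg'⟩ := (isWeaklyRegular_cons_iff _ _ _).mp hreg
    have hmy : maximalIdeal R ∉ associatedPrimes R (QuotSMulTop y M) := fun h ↦
      notMem_of_isSMulRegular ((isWeaklyRegular_cons_iff _ _ _).mp hreg').1 h hrs.2.1
    have hmx : maximalIdeal R ∉ associatedPrimes R (QuotSMulTop x M) := fun h ↦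
      hmy (maximalIdeal_mem_associatedPrimes_quotSMulTop hx hy hrs.1 h)
    obtain ⟨z, hz, hzs⟩ := exists_mem_maximalIdeal_forall_notMem
      ((associatedPrimes.finite R (QuotSMulTop x M)).union
        (associatedPrimes.finite R (QuotSMulTop y M))) (by
        rintro P (hP | hP)
        · exact ⟨hP.1, fun h ↦ hmx (h ▸ hP)⟩
        · exact ⟨hP.1, fun h ↦ hmy (h ▸ hP)⟩)
    have hzx : IsSMulRegular (QuotSMulTop x M) z :=
      isSMulRegular_of_forall_notMem fun P hP ↦ hzs P (Or.inl hP)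
    have hzy : IsSMulRegular (QuotSMulTop y M) z :=
      isSMulRegular_of_forall_notMem fun P hP ↦ hzs P (Or.inr hP)
    obtain ⟨ws, hws, hwm, hwreg⟩ := ih hz hzy (rs := y' :: ys) (by simpa using hlen)
      (by simpa using hrs.2) hreg'
    have h1 : IsWeaklyRegular M (y :: z :: ws) :=
      .cons hy (.cons hzy hwreg)
    have h2 : IsWeaklyRegular M (z :: y :: ws) :=
      IsLocalRing.isWeaklyRegular_of_perm_of_subset_maximalIdeal h1 (List.Perm.swap _ _ _)
        (by simpa using ⟨hrs.1, hz, hwm⟩)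
    have h3 : IsWeaklyRegular M [z, x] :=
      IsLocalRing.isWeaklyRegular_of_perm_of_subset_maximalIdeal
        (IsWeaklyRegular.cons hx (.cons hzx (.nil _ _))) (List.Perm.swap _ _ _)
        (by simpa using ⟨hxm, hz⟩)
    obtain ⟨hz', hx'⟩ := (isWeaklyRegular_cons_iff _ _ _).mp h3
    obtain ⟨vs, hvs, hvm, hvreg⟩ := ih hxm ((isWeaklyRegular_cons_iff _ _ _).mp hx').1
      (rs := y :: ws) (by simpa using hws) (by simpa using ⟨hrs.1, hwm⟩)
      ((isWeaklyRegular_cons_iff _ _ _).mp h2).2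
    have h4 : IsWeaklyRegular M (x :: z :: vs) :=
      IsLocalRing.isWeaklyRegular_of_perm_of_subset_maximalIdeal
        (IsWeaklyRegular.cons hz' (.cons ((isWeaklyRegular_cons_iff _ _ _).mp hx').1 hvreg))
        (List.Perm.swap _ _ _) (by simpa using ⟨hz, hxm, hvm⟩)
    exact ⟨z :: vs, by simp [hvs], by simpa using ⟨hz, hvm⟩,
      ((isWeaklyRegular_cons_iff _ _ _).mp h4).2⟩

lemma supportDim_le_supportDim_quotient_add_length (rs : List R)
    (hrs : ∀ x ∈ rs, x ∈ maximalIdeal R) :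
    Module.supportDim R M ≤
      Module.supportDim R (M ⧸ (Ideal.ofList rs • ⊤ : Submodule R M)) + rs.length := by
  induction rs generalizing M with
  | nil =>
    rw [Ideal.ofList_nil, Submodule.bot_smul]
    simpa using (Module.supportDim_eq_of_equiv (Submodule.quotEquivOfEqBot ⊥ rfl)).ge
  | cons x rs ih =>
    simp only [List.mem_cons, forall_eq_or_imp] at hrs
    rw [Module.supportDim_eq_of_equiv (Submodule.quotOfListConsSMulTopEquivQuotSMulTopInner M x _)]
    refine (Module.supportDim_le_supportDim_quotSMulTop_succ hrs.1).trans ?_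
    refine (add_le_add_left (ih (M := QuotSMulTop x M) hrs.2) 1).trans ?_
    simp [add_assoc]

omit [IsNoetherianRing R] [IsLocalRing R] [Module.Finite R M] in
lemma ringKrullDim_quotient_le_supportDim {P : PrimeSpectrum R} (hP : P ∈ Module.support R M) :
    ringKrullDim (R ⧸ P.asIdeal) ≤ Module.supportDim R M := by
  rw [ringKrullDim_quotient]
  exact Order.krullDim_le_of_strictMono
    (fun p ↦ (⟨p.1, Module.mem_support_mono p.2 hP⟩ : Module.support R M)) fun _ _ h ↦ h

/-- If `M` admits a regular sequence of length `n` and `x₁, …, xₙ` generate an ideal of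
definition of `M`, then `x₁, …, xₙ` is a regular sequence. -/
lemma isWeaklyRegular_of_supportDim_le_zero {xs ys : List R} (hlen : xs.length = ys.length)
    (hxs : ∀ x ∈ xs, x ∈ maximalIdeal R) (hys : ∀ y ∈ ys, y ∈ maximalIdeal R)
    (hreg : IsWeaklyRegular M ys)
    (hdim : Module.supportDim R (M ⧸ (Ideal.ofList xs • ⊤ : Submodule R M)) ≤ 0) :
    IsWeaklyRegular M xs := by
  induction xs generalizing M ys with
  | nil => exact .nil R M
  | cons x xs ih =>
    simp only [List.mem_cons, forall_eq_or_imp] at hxs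
    rw [Module.supportDim_eq_of_equiv
      (Submodule.quotOfListConsSMulTopEquivQuotSMulTopInner M x _)] at hdim
    have hx : IsSMulRegular M x := isSMulRegular_of_forall_notMem fun P hP hxP ↦ by
      have h1 := length_le_ringKrullDim_quotient ys hys hreg hP
      have hP' : (⟨P, hP.1⟩ : PrimeSpectrum R) ∈ Module.support R (QuotSMulTop x M) := by
        rw [Module.support_quotSMulTop]
        exact ⟨mem_support_of_mem_associatedPrimes hP, by simpa using hxP⟩
      have h2 := ringKrullDim_quotient_le_supportDim hP'
      have h3 := supportDim_le_supportDim_quotient_add_length (M := QuotSMulTop x M) xs hxs.2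
      have h4 := (h1.trans h2).trans (h3.trans (add_le_add_left hdim _))
      rw [zero_add, ← hlen, List.length_cons] at h4
      have : xs.length + 1 ≤ xs.length := Nat.cast_le.mp h4
      omega
    obtain ⟨zs, hzs, hzm, hzreg⟩ := exists_isRegular_quotSMulTop xs.length hxs.1 hx
      (by simpa using hlen.symm) hys hreg
    exact .cons hx (ih hzs.symm hxs.2 hzm hzreg hdim)

/-- If `x` is a zero divisor on `M`, then `M ⧸ xM` has an associated prime containing an
associated prime of `M` which contains `x`. -/
lemma exists_associatedPrime_quotSMulTop_of_not_isSMulRegular {x : R}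
    (hxm : x ∈ maximalIdeal R) (hx : ¬ IsSMulRegular M x) :
    ∃ Q ∈ associatedPrimes R (QuotSMulTop x M), ∃ P ∈ associatedPrimes R M, x ∈ P ∧ P ≤ Q := by
  let N : Submodule R M := Submodule.torsion' R M (Submonoid.powers x)
  have hN : ∀ m : M, m ∈ N ↔ ∃ n : ℕ, x ^ n • m = 0 := fun m ↦ by
    simp only [N, Submodule.mem_torsion'_iff]
    constructor
    · rintro ⟨⟨_, n, rfl⟩, h⟩
      exact ⟨n, h⟩
    · rintro ⟨n, h⟩
      exact ⟨⟨x ^ n, n, rfl⟩, h⟩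
  by_cases hle : N ≤ x • (⊤ : Submodule R M)
  · exfalso
    have hNx : N ≤ Ideal.span {x} • N := by
      intro n hn
      obtain ⟨m, -, rfl⟩ := (Submodule.mem_smul_pointwise_iff_exists _ _ _).mp (hle hn)
      refine Submodule.smul_mem_smul (Ideal.mem_span_singleton_self x) ?_
      obtain ⟨k, hk⟩ := (hN _).mp hn
      exact (hN m).mpr ⟨k + 1, by rwa [pow_succ, mul_smul]⟩
    have hbot : N = ⊥ := Submodule.eq_bot_of_le_smul_of_le_jacobson_bot _ N
      (IsNoetherian.noetherian N) hNx (by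
        rw [IsLocalRing.jacobson_eq_maximalIdeal _ bot_ne_top]
        simpa [Ideal.span_le] using hxm)
    refine hx ((isSMulRegular_iff_right_eq_zero_of_smul).mpr fun m hm ↦ ?_)
    have : m ∈ N := (hN m).mpr ⟨1, by simpa using hm⟩
    rwa [hbot, Submodule.mem_bot] at this
  · obtain ⟨n, hn, hnx⟩ := SetLike.not_le_iff_exists.mp hle
    let f : N →ₗ[R] QuotSMulTop x M := (Submodule.mkQ _).comp N.subtype
    let L := LinearMap.range f
    have hL : Nontrivial L := ⟨⟨⟨f ⟨n, hn⟩, ⟨n, hn⟩, rfl⟩, 0, fun h ↦ hnx (by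
      have := congrArg Subtype.val h
      simpa [f, Submodule.Quotient.mk_eq_zero] using this)⟩⟩
    obtain ⟨Q, hQ⟩ := associatedPrimes.nonempty R L
    have hQN : (⟨Q, hQ.1⟩ : PrimeSpectrum R) ∈ Module.support R N :=
      Module.support_subset_of_surjective f.rangeRestrict f.surjective_rangeRestrict
        (mem_support_of_mem_associatedPrimes hQ)
    obtain ⟨P, hP, hPQ⟩ := exists_associatedPrime_le hQN
    refine ⟨Q, associatedPrimes.subset_of_injective L.injective_subtype hQ, P,
      associatedPrimes.subset_of_injective N.injective_subtype hP, ?_, hPQ⟩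
    obtain ⟨⟨m, hmN⟩, hm⟩ := exists_forall_smul_eq_zero_iff hP
    obtain ⟨k, hk⟩ := (hN m).mp hmN
    exact hP.1.mem_of_pow_mem k ((hm _).mpr (Subtype.ext hk))

lemma isWeaklyRegular_of_forall_associatedPrimes {xs : List R}
    (hxs : ∀ x ∈ xs, x ∈ maximalIdeal R)
    (h : ∀ (i : ℕ) (hi : i < xs.length),
      ∀ P ∈ associatedPrimes R (M ⧸ (Ideal.ofList (xs.take i) • ⊤ : Submodule R M)),
        xs[i] ∈ P → ¬ ((xs.length - (i + 1) : ℕ) : WithBot ℕ∞) ≤ ringKrullDim (R ⧸ P)) :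
    IsWeaklyRegular M xs := by
  induction xs generalizing M with
  | nil => exact .nil R M
  | cons x xs ih =>
    simp only [List.mem_cons, forall_eq_or_imp] at hxs
    have hreg : IsWeaklyRegular (QuotSMulTop x M) xs := ih hxs.2 fun i hi P hP hxP ↦ by
      have := h (i + 1) (by simpa using hi) P
        (by
          rw [List.take_succ_cons, LinearEquiv.AssociatedPrimes.eq
            (Submodule.quotOfListConsSMulTopEquivQuotSMulTopInner M x (xs.take i))]
          exact hP) (by simpa using hxP)
      simpa using this
    refine .cons (not_not.mp fun hx ↦ ?_) hreg
    obtain ⟨Q, hQ, P, hP, hxP, hPQ⟩ :=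
      exists_associatedPrime_quotSMulTop_of_not_isSMulRegular hxs.1 hx
    have h1 := length_le_ringKrullDim_quotient xs hxs.2 hreg hQ
    have h2 : ringKrullDim (R ⧸ Q) ≤ ringKrullDim (R ⧸ P) :=
      ringKrullDim_le_of_surjective (Ideal.Quotient.factor hPQ)
        (Ideal.Quotient.factor_surjective hPQ)
    have e : M ≃ₗ[R] (M ⧸ (Ideal.ofList ((x :: xs).take 0) • ⊤ : Submodule R M)) :=
      (Submodule.quotEquivOfEqBot _ (by simp)).symm
    exact h 0 (by simp) P (by rwa [← LinearEquiv.AssociatedPrimes.eq e]) hxP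
      (by simpa using h1.trans h2)

omit [IsLocalRing R] in
/-- A finite module of dimension at most zero has finite length. -/
lemma isFiniteLength_of_supportDim_le_zero (h : Module.supportDim R M ≤ 0) :
    IsFiniteLength R M := by
  rw [isFiniteLength_iff_isNoetherian_isArtinian]
  refine ⟨inferInstance, ?_⟩
  rw [Module.supportDim_eq_ringKrullDim_quotient_annihilator] at h
  have : Ring.KrullDimLE 0 (R ⧸ Module.annihilator R M) :=
    Ring.krullDimLE_iff.mpr (by simpa using h)
  have : IsArtinianRing (R ⧸ Module.annihilator R M) :=
    isArtinianRing_iff_krullDimLE_zero.mpr inferInstance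
  let := Module.IsTorsionBySet.module (Module.isTorsionBySet_annihilator R M)
  have : IsScalarTower R (R ⧸ Module.annihilator R M) M :=
    Module.IsTorsionBySet.isScalarTower (Module.isTorsionBySet_annihilator R M)
  have : Module.Finite (R ⧸ Module.annihilator R M) M := .of_restrictScalars_finite R _ M
  exact isArtinian_of_surjective_algebraMap
    (R := R ⧸ Module.annihilator R M) Ideal.Quotient.mk_surjective

lemma supportDim_le_zero_of_isFiniteLength (h : IsFiniteLength R M) :
    Module.supportDim R M ≤ 0 := by
  have : IsArtinian R M := (isFiniteLength_iff_isNoetherian_isArtinian.mp h).2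
  have key (P : PrimeSpectrum R) (hP : P ∈ Module.support R M) :
      P.asIdeal = maximalIdeal R := by
    obtain ⟨Q, hQ, hle⟩ := exists_associatedPrime_le hP
    have := hQ.1
    obtain ⟨-, f, hf⟩ := (isAssociatedPrime_iff_exists_injective_linearMap Q M).mp hQ
    have : IsArtinian R (R ⧸ Q) := isArtinian_of_injective f hf
    have : IsArtinianRing (R ⧸ Q) := isArtinian_of_tower R this
    have hmax : Q.IsMaximal :=
      Ideal.Quotient.maximal_of_isField _ (IsArtinianRing.isField_of_isDomain _)
    rw [← hmax.eq_of_le P.2.ne_top hle]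
    exact IsLocalRing.eq_maximalIdeal hmax
  have : Subsingleton (Module.support R M) := ⟨fun P Q ↦
    Subtype.ext (PrimeSpectrum.ext ((key P.1 P.2).trans (key Q.1 Q.2).symm))⟩
  exact Order.krullDim_nonpos_of_subsingleton

/-- If `y₁, …, yₙ` generate an ideal of definition of `M`, then
`dim M ⧸ (y₁, …, yₖ)M ≤ n - k`. -/
lemma supportDim_quotient_take_le {ys : List R} (hys : ∀ y ∈ ys, y ∈ maximalIdeal R)
    (h : Module.supportDim R (M ⧸ (Ideal.ofList ys • ⊤ : Submodule R M)) ≤ 0) (k : ℕ) :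
    Module.supportDim R (M ⧸ (Ideal.ofList (ys.take k) • ⊤ : Submodule R M)) ≤
      ((ys.length - k : ℕ) : WithBot ℕ∞) := by
  induction ys generalizing M k with
  | nil => rw [List.take_nil]; simpa using h
  | cons y ys ih =>
    cases k with
    | zero =>
      rw [List.take_zero, Ideal.ofList_nil, Submodule.bot_smul,
        Module.supportDim_eq_of_equiv (Submodule.quotEquivOfEqBot ⊥ rfl)]
      refine (supportDim_le_supportDim_quotient_add_length (y :: ys) hys).trans ?_
      exact (add_le_add_left h _).trans (by simp)
    | succ k =>
      simp only [List.mem_cons, forall_eq_or_imp] at hys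
      rw [Module.supportDim_eq_of_equiv
        (Submodule.quotOfListConsSMulTopEquivQuotSMulTopInner M y ys)] at h
      rw [List.take_succ_cons, Module.supportDim_eq_of_equiv
        (Submodule.quotOfListConsSMulTopEquivQuotSMulTopInner M y (ys.take k))]
      simpa using ih hys.2 h k

omit [IsNoetherianRing R] [IsLocalRing R] in
lemma mem_support_quotient_ofList {l : List R} {P : PrimeSpectrum R} :
    P ∈ Module.support R (M ⧸ (Ideal.ofList l • ⊤ : Submodule R M)) ↔
      P ∈ Module.support R M ∧ ∀ a ∈ l, a ∈ P.asIdeal := by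
  rw [Module.support_quotient, Set.mem_inter_iff, PrimeSpectrum.mem_zeroLocus,
    SetLike.coe_subset_coe,
    Ideal.ofList, Ideal.span_le]
  rfl

omit [IsNoetherianRing R] [IsLocalRing R] [Module.Finite R M] in
lemma ringKrullDim_quotient_eq_coheight (P : PrimeSpectrum R) :
    ringKrullDim (R ⧸ P.asIdeal) = (Order.coheight P : WithBot ℕ∞) := by
  rw [ringKrullDim_quotient, Order.coheight_eq_krullDim_Ici]
  rfl

omit [IsNoetherianRing R] [IsLocalRing R] [Module.Finite R M] in
lemma exists_mem_support_le_ringKrullDim {n : ℕ}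
    (h : (n : WithBot ℕ∞) ≤ Module.supportDim R M) :
    ∃ P ∈ Module.support R M, (n : WithBot ℕ∞) ≤ ringKrullDim (R ⧸ P.asIdeal) := by
  obtain ⟨l, rfl⟩ := Order.le_krullDim_iff.mp h
  refine ⟨l.head.1, l.head.2, ?_⟩
  rw [ringKrullDim_quotient_eq_coheight]
  exact WithBot.coe_le_coe.mpr
    (Order.length_le_coheight_head (p := l.map Subtype.val fun _ _ h ↦ h))

/-- The isomorphism `M ⧸ (rs, ws)M ≃ (M ⧸ (rs)M) ⧸ (ws)(M ⧸ (rs)M)`. -/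
noncomputable def quotientOfListAppendEquiv (rs ws : List R) :
    (M ⧸ (Ideal.ofList (rs ++ ws) • ⊤ : Submodule R M)) ≃ₗ[R]
      (M ⧸ (Ideal.ofList rs • ⊤ : Submodule R M)) ⧸
        (Ideal.ofList ws • ⊤ : Submodule R (M ⧸ (Ideal.ofList rs • ⊤ : Submodule R M))) :=
  (Submodule.quotientQuotientEquivQuotient (Ideal.ofList rs • ⊤) (Ideal.ofList (rs ++ ws) • ⊤)
    (Submodule.smul_mono_left (by simp))).symm ≪≫ₗ
  Submodule.quotEquivOfEq _ _ (by
    have h : (Ideal.ofList rs • ⊤ :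
        Submodule R (M ⧸ (Ideal.ofList rs • ⊤ : Submodule R M))) = ⊥ := by
      have := Submodule.map_smul'' (Ideal.ofList rs) (⊤ : Submodule R M)
        (Ideal.ofList rs • ⊤ : Submodule R M).mkQ
      rw [Submodule.mkQ_map_self, Submodule.map_top, Submodule.range_mkQ] at this
      exact this.symm
    rw [Submodule.map_smul'', Submodule.map_top, Submodule.range_mkQ, Ideal.ofList_append,
      Submodule.sup_smul, h, bot_sup_eq])

/-- Any finite module of dimension at most `n` admits elements `w₁, …, wₙ` generating an ideal of
definition such that `wᵢ` avoids the nonmaximal associated primes of `M ⧸ (w₁, …, wᵢ₋₁)M`. -/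
lemma exists_list_of_supportDim_le {n : ℕ}
    (h : Module.supportDim R M ≤ (n : WithBot ℕ∞)) :
    ∃ ws : List R, ws.length = n ∧ (∀ w ∈ ws, w ∈ maximalIdeal R) ∧
      Module.supportDim R (M ⧸ (Ideal.ofList ws • ⊤ : Submodule R M)) ≤ 0 ∧
      ∀ (i : ℕ) (hi : i < ws.length),
        ∀ P ∈ associatedPrimes R (M ⧸ (Ideal.ofList (ws.take i) • ⊤ : Submodule R M)),
          P ≠ maximalIdeal R → ws[i] ∉ P := by
  induction n generalizing M with
  | zero =>
    refine ⟨[], rfl, by simp, ?_, by simp⟩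
    rw [Ideal.ofList_nil, Submodule.bot_smul,
        Module.supportDim_eq_of_equiv (Submodule.quotEquivOfEqBot ⊥ rfl)]
    simpa using h
  | succ n ih =>
    obtain ⟨z, hz, hzs⟩ := exists_mem_maximalIdeal_forall_notMem
      (s := {P | P ∈ associatedPrimes R M ∧ P ≠ maximalIdeal R})
      ((associatedPrimes.finite R M).subset fun P hP ↦ hP.1) fun P hP ↦ ⟨hP.1.1, hP.2⟩
    have hdim : Module.supportDim R (QuotSMulTop z M) ≤ (n : WithBot ℕ∞) := by
      by_contra hcon
      have hcon' : ((n + 1 : ℕ) : WithBot ℕ∞) ≤ Module.supportDim R (QuotSMulTop z M) := by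
        rw [Nat.cast_add_one]
        exact ENat.WithBot.add_one_le_iff.mpr (not_le.mp hcon)
      obtain ⟨Q, hQ, hQn⟩ := exists_mem_support_le_ringKrullDim hcon'
      rw [Module.support_quotSMulTop] at hQ
      obtain ⟨P, hP, hle⟩ := exists_associatedPrime_le hQ.1
      have hPm : P ≠ maximalIdeal R := by
        rintro rfl
        have : Q.asIdeal = maximalIdeal R :=
          ((maximalIdeal.isMaximal R).eq_of_le Q.2.ne_top hle).symm
        rw [this, ringKrullDim_eq_zero_of_isField
          ((Ideal.Quotient.maximal_ideal_iff_isField_quotient _).mp inferInstance)] at hQn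
        have := Nat.cast_le (α := WithBot ℕ∞) (n := 0).mp hQn
        omega
      have hlt : P < Q.asIdeal := lt_of_le_of_ne hle fun h ↦
        hzs P ⟨hP, hPm⟩ (h ▸ by simpa using hQ.2)
      have h1 := (succ_le_ringKrullDim_quotient hP.1 Q.2 hlt hQn).trans
        ((ringKrullDim_quotient_le_supportDim (mem_support_of_mem_associatedPrimes hP)).trans h)
      have := Nat.cast_le.mp h1
      omega
    obtain ⟨ws, hlen, hws, hw0, hw⟩ := ih hdim
    refine ⟨z :: ws, by simp [hlen], by simpa using ⟨hz, hws⟩, ?_, ?_⟩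
    · rwa [Module.supportDim_eq_of_equiv
        (Submodule.quotOfListConsSMulTopEquivQuotSMulTopInner M z ws)]
    · rintro (_ | i) hi P hP hPm
      · refine hzs P ⟨?_, hPm⟩
        rwa [LinearEquiv.AssociatedPrimes.eq (Submodule.quotEquivOfEqBot _ (by simp))] at hP
      · rw [List.take_succ_cons, LinearEquiv.AssociatedPrimes.eq
          (Submodule.quotOfListConsSMulTopEquivQuotSMulTopInner M z (ws.take i))] at hP
        exact hw i (by simpa using hi) P hP hPm

omit [IsNoetherianRing R] [IsLocalRing R] in
lemma moduleDim_eq_supportDim : moduleDim R M = Module.supportDim R M :=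
  (Module.supportDim_eq_ringKrullDim_quotient_annihilator R M).symm

lemma length_le_supportDim [Nontrivial M] {rs : List R} (hreg : IsRegular M rs) :
    (rs.length : WithBot ℕ∞) ≤ Module.supportDim R M := by
  rw [← Module.supportDim_add_length_eq_supportDim_of_isRegular rs hreg]
  have : Nontrivial (M ⧸ (Ideal.ofList rs • ⊤ : Submodule R M)) :=
    Submodule.Quotient.nontrivial_iff.mpr hreg.top_ne_smul.symm
  have h0 : (0 : WithBot ℕ∞) ≤ Module.supportDim R (M ⧸ (Ideal.ofList rs • ⊤ : Submodule R M)) :=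
    Order.krullDim_nonneg_iff.mpr Module.nonempty_support_of_nontrivial.to_subtype
  simpa using add_le_add_left h0 (rs.length : WithBot ℕ∞)

/-- If `x₁, …, xᵣ` generate an ideal of definition of `M`, then `M` is Cohen–Macaulay of
dimension `r` if and only if `x₁, …, xᵣ` is a regular sequence on `M`. -/
lemma isCMModule_iff_isWeaklyRegular [Nontrivial M] {xs : List R}
    (hxs : ∀ x ∈ xs, x ∈ maximalIdeal R)
    (hdim : Module.supportDim R (M ⧸ (Ideal.ofList xs • ⊤ : Submodule R M)) ≤ 0) :
    (moduleDim R M = (xs.length : WithBot ℕ∞) ∧ IsCMModule R M) ↔ IsWeaklyRegular M xs := by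
  constructor
  · rintro ⟨h1, h2⟩
    rw [IsCMModule, h1, moduleDepth] at h2
    obtain hr | ⟨r, hr⟩ : xs.length = 0 ∨ ∃ r, xs.length = r + 1 := by
      cases xs <;> simp
    · rw [List.length_eq_zero_iff.mp hr]
      exact .nil R M
    have hlt : (r : WithBot ℕ∞) < sSup {n : WithBot (WithTop ℕ) | ∃ rs : List R,
        (rs.length : WithBot (WithTop ℕ)) = n ∧
        (∀ x ∈ rs, x ∈ maximalIdeal R) ∧ RingTheory.Sequence.IsRegular M rs} := by
      rw [h2, hr]
      exact Nat.cast_lt.mpr r.lt_succ_self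
    obtain ⟨_, ⟨rs, rfl, hrs, hreg⟩, hlt'⟩ := lt_sSup_iff.mp hlt
    have hle : r < rs.length := Nat.cast_lt (α := WithBot ℕ∞).mp hlt'
    have hreg' := hreg.toIsWeaklyRegular
    rw [← List.take_append_drop xs.length rs, isWeaklyRegular_append_iff] at hreg'
    refine isWeaklyRegular_of_supportDim_le_zero (ys := rs.take xs.length) ?_ hxs
      (fun y hy ↦ hrs y (List.mem_of_mem_take hy)) hreg'.1 hdim
    rw [List.length_take]
    omega
  · intro h
    have hreg : IsRegular M xs :=
      (IsLocalRing.isRegular_iff_isWeaklyRegular_of_subset_maximalIdeal hxs).mpr h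
    have hdim' : Module.supportDim R M ≤ (xs.length : WithBot ℕ∞) :=
      (supportDim_le_supportDim_quotient_add_length xs hxs).trans
        ((add_le_add_left hdim _).trans (by simp))
    have heq : moduleDim R M = (xs.length : WithBot ℕ∞) :=
      moduleDim_eq_supportDim.trans (le_antisymm hdim' (length_le_supportDim hreg))
    refine ⟨heq, ?_⟩
    rw [IsCMModule, moduleDepth, heq]
    refine le_antisymm (sSup_le ?_) (le_sSup ⟨xs, rfl, hxs, hreg⟩)
    rintro _ ⟨rs, rfl, -, hreg'⟩
    exact (length_le_supportDim hreg').trans hdim'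

end Local

section Localization

variable {R M A N : Type*} [CommRing R] [AddCommGroup M] [Module R M]
  (p : Ideal R) [p.IsPrime] [CommRing A] [Algebra R A] [IsLocalization.AtPrime A p]
  [AddCommGroup N] [Module R N] [Module A N] [IsScalarTower R A N]
  (f : M →ₗ[R] N) [IsLocalizedModule p.primeCompl f]

include p f

lemma localized_ofList_smul_top (l : List R) :
    (Ideal.ofList l • ⊤ : Submodule R M).localized' A p.primeCompl f =
      Ideal.ofList (l.map (algebraMap R A)) • ⊤ := by
  rw [Submodule.localized'_smul, Ideal.localized'_eq_map, Submodule.localized'_top,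
    Ideal.map_ofList]

lemma comap_mem_associatedPrimes_quotient_ofList [IsNoetherianRing R] {l : List R}
    {Q : Ideal A} (hQ : Q ∈ associatedPrimes A
      (N ⧸ (Ideal.ofList (l.map (algebraMap R A)) • ⊤ : Submodule A N))) :
    Q.comap (algebraMap R A) ∈
      associatedPrimes R (M ⧸ (Ideal.ofList l • ⊤ : Submodule R M)) := by
  open Module.associatedPrimes in
  rw [← localized_ofList_smul_top p f] at hQ
  exact comap_mem_associatedPrimes_of_mem_associatedPrimes_of_isLocalizedModule_of_fg
    p.primeCompl (Submodule.toLocalizedQuotient' A p.primeCompl f _)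
    Q hQ ((isNoetherianRing_iff_ideal_fg R).mp inferInstance _)

lemma exists_smul_eq_zero_of_isSMulRegular {l : List R} {a : R}
    (ha : IsSMulRegular (N ⧸ (Ideal.ofList (l.map (algebraMap R A)) • ⊤ : Submodule A N))
      (algebraMap R A a))
    {u : M ⧸ (Ideal.ofList l • ⊤ : Submodule R M)} (hu : a • u = 0) :
    ∃ s ∉ p, s • u = 0 := by
  rw [← localized_ofList_smul_top p f] at ha
  let g := Submodule.toLocalizedQuotient' A p.primeCompl f (Ideal.ofList l • ⊤ : Submodule R M)
  have h : g u = 0 := by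
    apply ha
    simp only [smul_zero]
    rw [algebraMap_smul, ← map_smul, hu, map_zero]
  obtain ⟨s, hs⟩ := (IsLocalizedModule.eq_zero_iff p.primeCompl g).mp h
  exact ⟨s, s.2, hs⟩

omit f

/-- If `Q` is a prime of `R_p`, then `dim R_p ⧸ Q + dim R ⧸ p ≤ dim R ⧸ (Q ∩ R)`. -/
lemma add_le_ringKrullDim_quotient_comap {Q : Ideal A} (hQ : Q.IsPrime)
    {a b : ℕ} (ha : (a : WithBot ℕ∞) ≤ ringKrullDim (A ⧸ Q))
    (hb : (b : WithBot ℕ∞) ≤ ringKrullDim (R ⧸ p)) :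
    ((a + b : ℕ) : WithBot ℕ∞) ≤ ringKrullDim (R ⧸ Q.comap (algebraMap R A)) := by
  let Q' : PrimeSpectrum A := ⟨Q, hQ⟩
  let p' : PrimeSpectrum R := ⟨p, inferInstance⟩
  let c := PrimeSpectrum.comap (algebraMap R A)
  have hc : StrictMono c := Monotone.strictMono_of_injective (fun _ _ h ↦ Ideal.comap_mono h)
    (PrimeSpectrum.localization_comap_injective _ p.primeCompl)
  change _ ≤ ringKrullDim (R ⧸ (c Q').asIdeal)
  change _ ≤ ringKrullDim (_ ⧸ Q'.asIdeal) at ha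
  change _ ≤ ringKrullDim (_ ⧸ p'.asIdeal) at hb
  rw [ringKrullDim_quotient_eq_coheight] at ha hb ⊢
  obtain ⟨l, hl, rfl⟩ := Order.exists_series_of_le_coheight Q' (WithBot.coe_le_coe.mp ha)
  let l' := l.map c hc
  have hle : l'.last ≤ p' := by
    intro a ha
    by_contra hap
    exact l.last.2.ne_top (Ideal.eq_top_of_isUnit_mem _ ha
      (IsLocalization.map_units A (⟨a, hap⟩ : p.primeCompl)))
  obtain ⟨m, hm, rfl⟩ := Order.exists_series_of_le_coheight l'.last
    ((WithBot.coe_le_coe.mp hb).trans (Order.coheight_anti hle))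
  have := Order.length_le_coheight_head (p := RelSeries.smash l' m hm.symm)
  refine (WithBot.coe_le_coe.mpr this).trans' ?_ |>.trans_eq ?_
  · simp [l']
  · simp [l', hl]

end Localization

section Main

variable {R M : Type*} [CommRing R] [IsNoetherianRing R] [IsLocalRing R] [AddCommGroup M]
  [Module R M] [Module.Finite R M]
  {ys : List R} (hys : ∀ y ∈ ys, y ∈ maximalIdeal R)
  (h0 : Module.supportDim R (M ⧸ (Ideal.ofList ys • ⊤ : Submodule R M)) ≤ 0)

include hys h0

lemma ringKrullDim_quotient_le {k : ℕ} {P : Ideal R} {hP : P.IsPrime}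
    (hPM : ⟨P, hP⟩ ∈ Module.support R M) (hk : ∀ y ∈ ys.take k, y ∈ P) :
    ringKrullDim (R ⧸ P) ≤ ((ys.length - k : ℕ) : WithBot ℕ∞) :=
  (ringKrullDim_quotient_le_supportDim (mem_support_quotient_ofList.mpr ⟨hPM, hk⟩)).trans
    (supportDim_quotient_take_le hys h0 k)

section

variable {A N : Type*} [CommRing A] [IsNoetherianRing A] [IsLocalRing A] [Algebra R A]
  [AddCommGroup N] [Module R N] [Module A N] [IsScalarTower R A N] [Module.Finite A N]
  (p : Ideal R) [p.IsPrime] [IsLocalization.AtPrime A p]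
  (f : M →ₗ[R] N) [IsLocalizedModule p.primeCompl f]

include f

omit [IsLocalRing A] in
/-- The localization at a prime of maximal dimension containing `y₁, …, yᵣ` has `y₁, …, yᵣ` as
generators of an ideal of definition. -/
lemma supportDim_localization_le_zero {r : ℕ}
    (hdim : ringKrullDim (R ⧸ p) = ((ys.length - r : ℕ) : WithBot ℕ∞)) :
    Module.supportDim A
      (N ⧸ (Ideal.ofList ((ys.take r).map (algebraMap R A)) • ⊤ : Submodule A N)) ≤ 0 := by
  by_contra hcon
  obtain ⟨Q', hQ', hQ1⟩ := exists_mem_support_le_ringKrullDim (n := 1) (by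
    simpa using ENat.WithBot.add_one_le_iff (n := 0).mpr (not_le.mp hcon))
  obtain ⟨Q, hQ, hle⟩ := exists_associatedPrime_le hQ'
  have hQ2 : ((1 : ℕ) : WithBot ℕ∞) ≤ ringKrullDim (A ⧸ Q) :=
    hQ1.trans (ringKrullDim_le_of_surjective (Ideal.Quotient.factor hle)
      (Ideal.Quotient.factor_surjective hle))
  have hQc := comap_mem_associatedPrimes_quotient_ofList p f hQ
  have hQs := mem_support_quotient_ofList.mp (mem_support_of_mem_associatedPrimes hQc)
  have h1 := (add_le_ringKrullDim_quotient_comap p hQ.1 hQ2 hdim.ge).trans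
    (ringKrullDim_quotient_le hys h0 hQs.1 hQs.2)
  have := Nat.cast_le.mp h1
  omega

lemma isWeaklyRegular_localization {r : ℕ} (hr : r < ys.length)
    (hred : ∀ (i : ℕ) (hi : i < ys.length), i < ys.length - 1 →
      ∀ P ∈ associatedPrimes R (M ⧸ (Ideal.ofList (ys.take i) • ⊤ : Submodule R M)),
        ringKrullDim (R ⧸ P) = ((ys.length - (i + 1) : ℕ) : WithBot ℕ∞) → ys[i] ∉ P)
    (hp : ∀ y ∈ ys.take r, y ∈ p)
    (hdim : ringKrullDim (R ⧸ p) = ((ys.length - r : ℕ) : WithBot ℕ∞)) :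
    IsWeaklyRegular N ((ys.take r).map (algebraMap R A)) := by
  refine isWeaklyRegular_of_forall_associatedPrimes ?_ ?_
  · intro x hx
    obtain ⟨y, hy, rfl⟩ := List.mem_map.mp hx
    exact (IsLocalization.AtPrime.to_map_mem_maximal_iff A p y).mpr (hp y hy)
  · intro i hi Q hQ hxQ hle
    have hi' : i < r := by
      simp only [List.length_map, List.length_take] at hi
      omega
    simp only [List.length_map, List.length_take, min_eq_left hr.le] at hle
    rw [List.getElem_map, List.getElem_take] at hxQ
    rw [← List.map_take, List.take_take, min_eq_left hi'.le] at hQ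
    have hQc := comap_mem_associatedPrimes_quotient_ofList p f hQ
    have hQs := mem_support_quotient_ofList.mp (mem_support_of_mem_associatedPrimes hQc)
    have h1 : ringKrullDim (R ⧸ Q.comap (algebraMap R A)) ≤
        ((ys.length - (i + 1) : ℕ) : WithBot ℕ∞) :=
      ringKrullDim_quotient_le hys h0 hQs.1 (by
        rw [List.take_succ_eq_append_getElem (hi'.trans hr)]
        simp only [List.mem_append, List.mem_singleton]
        rintro y (hy | rfl)
        exacts [hQs.2 y hy, hxQ])
    have h2 := add_le_ringKrullDim_quotient_comap p hQ.1 hle hdim.ge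
    rw [show r - (i + 1) + (ys.length - r) = ys.length - (i + 1) by omega] at h2
    exact hred i (hi'.trans hr) (by omega) _ hQc (le_antisymm h1 h2) hxQ

end

lemma notMem_of_isWeaklyRegular_localization {r : ℕ} (hr : r < ys.length)
    (hreg : ∀ p : PrimeSpectrum R, p ∈ Module.support R M → (∀ y ∈ ys.take r, y ∈ p.asIdeal) →
      ringKrullDim (R ⧸ p.asIdeal) = ((ys.length - r : ℕ) : WithBot ℕ∞) →
      IsWeaklyRegular (LocalizedModule p.asIdeal.primeCompl M)
        ((ys.take r).map (algebraMap R (Localization.AtPrime p.asIdeal))))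
    {i : ℕ} (hi : i < r) {P : Ideal R}
    (hP : P ∈ associatedPrimes R (M ⧸ (Ideal.ofList (ys.take i) • ⊤ : Submodule R M)))
    (hdim : ringKrullDim (R ⧸ P) = ((ys.length - (i + 1) : ℕ) : WithBot ℕ∞)) :
    ys[i] ∉ P := by
  intro hiP
  have hsplit : ys.take r = ys.take i ++ ys[i] :: (ys.take r).drop (i + 1) := by
    conv_lhs => rw [← List.take_append_drop i (ys.take r)]
    rw [List.take_take, min_eq_left hi.le, List.drop_eq_getElem_cons (by simp; omega),
      List.getElem_take]
  have hlen : ((ys.take r).drop (i + 1)).length = r - (i + 1) := by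
    simp [hr.le]
  have hls : ∀ y ∈ (ys.take r).drop (i + 1), y ∈ maximalIdeal R := fun y hy ↦
    hys y (List.mem_of_mem_take (List.mem_of_mem_drop hy))
  have h1 := supportDim_le_supportDim_quotient_add_length (M := R ⧸ P) _ hls
  rw [Module.supportDim_quotient_eq_ringKrullDim, hdim, hlen,
    show ys.length - (i + 1) = ys.length - r + (r - (i + 1)) by omega, Nat.cast_add,
    ENat.WithBot.add_le_add_natCast_right_iff] at h1
  obtain ⟨Q, hQ, hQdim⟩ := exists_mem_support_le_ringKrullDim h1
  obtain ⟨hQP, hQl⟩ := mem_support_quotient_ofList.mp hQ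
  rw [Module.support_eq_zeroLocus, Ideal.annihilator_quotient] at hQP
  have hPQ : P ≤ Q.asIdeal := hQP
  obtain ⟨hQM, hQi⟩ := mem_support_quotient_ofList.mp
    (Module.mem_support_mono (p := ⟨P, hP.1⟩) hPQ (mem_support_of_mem_associatedPrimes hP))
  have hQr : ∀ y ∈ ys.take r, y ∈ Q.asIdeal := by
    rw [hsplit]
    simp only [List.mem_append, List.mem_cons]
    rintro y (hy | rfl | hy)
    exacts [hQi y hy, hPQ hiP, hQl y hy]
  have hregQ := (hreg Q hQM hQr (le_antisymm (ringKrullDim_quotient_le hys h0 hQM hQr) hQdim)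
    ).regular_mod_prev i (by simp; omega)
  rw [List.getElem_map, List.getElem_take, ← List.map_take, List.take_take,
    min_eq_left hi.le] at hregQ
  obtain ⟨u, hu⟩ := exists_forall_smul_eq_zero_iff hP
  obtain ⟨s, hsQ, hsu⟩ := exists_smul_eq_zero_of_isSMulRegular Q.asIdeal
    (LocalizedModule.mkLinearMap Q.asIdeal.primeCompl M) hregQ ((hu _).mp hiP)
  exact hsQ (hPQ ((hu s).mpr hsu))

lemma isCMModule_localization_iff {r : ℕ} (hr : r ≤ ys.length) (p : PrimeSpectrum R)
    (hpM : p ∈ Module.support R M) (hp : ∀ y ∈ ys.take r, y ∈ p.asIdeal)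
    (hdim : ringKrullDim (R ⧸ p.asIdeal) = ((ys.length - r : ℕ) : WithBot ℕ∞)) :
    (moduleDim (Localization.AtPrime p.asIdeal) (LocalizedModule p.asIdeal.primeCompl M)
          = (r : WithBot ℕ∞) ∧
        IsCMModule (Localization.AtPrime p.asIdeal) (LocalizedModule p.asIdeal.primeCompl M)) ↔
      IsWeaklyRegular (LocalizedModule p.asIdeal.primeCompl M)
        ((ys.take r).map (algebraMap R (Localization.AtPrime p.asIdeal))) := by
  have : Nontrivial (LocalizedModule p.asIdeal.primeCompl M) := Module.mem_support_iff.mp hpM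
  rw [← isCMModule_iff_isWeaklyRegular, List.length_map, List.length_take, min_eq_left hr]
  · intro a ha
    obtain ⟨y, hy, rfl⟩ := List.mem_map.mp ha
    exact (IsLocalization.AtPrime.to_map_mem_maximal_iff _ p.asIdeal y).mpr (hp y hy)
  · exact supportDim_localization_le_zero hys h0 p.asIdeal
      (LocalizedModule.mkLinearMap p.asIdeal.primeCompl M) hdim

/-- The first `r` elements of `ys` extend to a list `L` of the same length as `ys` which generates
an ideal of definition and such that `Lᵢ` avoids the nonmaximal associated primes of
`M ⧸ (L₁, …, Lᵢ₋₁)M` for `i > r`. -/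
lemma exists_list_take_eq {r : ℕ} (hr : r ≤ ys.length) :
    ∃ L : List R, L.length = ys.length ∧ L.take r = ys.take r ∧ (∀ y ∈ L, y ∈ maximalIdeal R) ∧
      Module.supportDim R (M ⧸ (Ideal.ofList L • ⊤ : Submodule R M)) ≤ 0 ∧
      ∀ (i : ℕ) (hi : i < L.length), r ≤ i →
        ∀ P ∈ associatedPrimes R (M ⧸ (Ideal.ofList (L.take i) • ⊤ : Submodule R M)),
          P ≠ maximalIdeal R → L[i] ∉ P := by
  obtain ⟨ws, hlen, hws, hw0, hw⟩ :=
    exists_list_of_supportDim_le (supportDim_quotient_take_le hys h0 r)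
  have hrlen : (ys.take r).length = r := by simpa using hr
  refine ⟨ys.take r ++ ws, by simp; omega, by rw [List.take_left' hrlen], ?_, ?_, ?_⟩
  · simp only [List.mem_append]
    rintro y (hy | hy)
    exacts [hys y (List.mem_of_mem_take hy), hws y hy]
  · rwa [Module.supportDim_eq_of_equiv (quotientOfListAppendEquiv (ys.take r) ws)]
  · intro i hi hri P hP hPm
    rw [List.take_append, List.take_of_length_le (by omega), hrlen,
      LinearEquiv.AssociatedPrimes.eq (quotientOfListAppendEquiv _ _)] at hP
    rw [List.getElem_append_right (by omega)]
    simp only [hrlen]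
    exact hw (i - r) (by simp at hi; omega) P hP hPm

end Main

section Lists

variable {R M : Type*} [CommRing R] [IsNoetherianRing R] [IsLocalRing R] [AddCommGroup M]
  [Module R M] [Module.Finite R M] {d : ℕ} (y : Fin d → R)

omit [IsNoetherianRing R] [IsLocalRing R] in
lemma ofList_ofFn : Ideal.ofList (List.ofFn y) = Ideal.span (Set.range y) := by
  rw [Ideal.ofList]
  congr 1
  ext a
  simp [List.mem_ofFn]

omit [IsNoetherianRing R] [IsLocalRing R] in
lemma ofList_take_ofFn (i : ℕ) :
    Ideal.ofList ((List.ofFn y).take i) = Ideal.span (y '' {j : Fin d | (j : ℕ) < i}) := by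
  rw [Ideal.ofList]
  congr 1
  ext a
  simp only [List.mem_take_iff_getElem, List.length_ofFn, List.getElem_ofFn, Set.mem_ofPred_eq,
    Set.mem_image, lt_min_iff]
  constructor
  · rintro ⟨j, hj, rfl⟩
    exact ⟨⟨j, hj.2⟩, hj.1, rfl⟩
  · rintro ⟨j, hj, rfl⟩
    exact ⟨j, ⟨hj, j.2⟩, rfl⟩

lemma isSoP_iff : IsSoP R M y ↔ (∀ a ∈ List.ofFn y, a ∈ maximalIdeal R) ∧
    moduleDim R M = (d : WithBot ℕ∞) ∧
    Module.supportDim R (M ⧸ (Ideal.ofList (List.ofFn y) • ⊤ : Submodule R M)) ≤ 0 := by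
  rw [IsSoP, ofList_ofFn, List.forall_mem_ofFn_iff]
  refine and_congr_right' (and_congr_right' ⟨supportDim_le_zero_of_isFiniteLength,
    isFiniteLength_of_supportDim_le_zero⟩)

omit [IsNoetherianRing R] [Module.Finite R M] in
lemma isReducingSoP_iff {l : List R} (hl : List.ofFn y = l) :
    IsReducingSoP R M y ↔ IsSoP R M y ∧
      ∀ (i : ℕ) (hi : i < l.length), i < l.length - 1 →
        ∀ P ∈ associatedPrimes R (M ⧸ (Ideal.ofList (l.take i) • ⊤ : Submodule R M)),
          ringKrullDim (R ⧸ P) = ((l.length - (i + 1) : ℕ) : WithBot ℕ∞) → l[i] ∉ P := by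
  subst hl
  simp only [IsReducingSoP, List.length_ofFn, List.getElem_ofFn, Fin.forall_iff]
  refine and_congr_right' (forall_congr' fun i ↦ forall_congr' fun hi ↦ forall_congr' fun _ ↦ ?_)
  rw [ofList_take_ofFn]
  rfl

end Lists

end ReducingSoP

open ReducingSoP

theorem stmt1 (R M : Type*) [CommRing R] [IsLocalRing R] [IsNoetherianRing R]
    [AddCommGroup M] [Module R M] [Module.Finite R M] [Nontrivial M]
    {d r : ℕ} (hd : moduleDim R M = (d : ℕ)) (hr : r < d)
    (x : Fin r → R) (hx : IsPartSoP R M x) :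
    IsPartReducingSoP R M x ↔
      ∀ P : PrimeSpectrum R, P ∈ Module.support R M → (∀ i, x i ∈ P.asIdeal) →
        ringKrullDim (R ⧸ P.asIdeal) = ((d - r : ℕ) : WithBot (WithTop ℕ)) →
        moduleDim (Localization.AtPrime P.asIdeal) (LocalizedModule P.asIdeal.primeCompl M)
            = (r : ℕ) ∧
          IsCMModule (Localization.AtPrime P.asIdeal)
            (LocalizedModule P.asIdeal.primeCompl M) := by
  obtain ⟨d', hrd, y, hy, hyx⟩ := hx
  obtain rfl : d' = d := Nat.cast_injective (R := WithBot (WithTop ℕ)) (hy.2.1.symm.trans hd)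
  obtain ⟨hys, -, h0⟩ := (isSoP_iff y).mp hy
  have htake : ∀ z : Fin d' → R, (∀ i : Fin r, z (Fin.castLE hrd i) = x i) →
      (List.ofFn z).take r = List.ofFn x := fun z hz ↦
    List.ext_getElem (by simpa using hrd) fun i _ hi ↦ by
      rw [List.getElem_take, List.getElem_ofFn, List.getElem_ofFn]
      exact hz ⟨i, by simpa using hi⟩
  have hmem : ∀ P : PrimeSpectrum R, (∀ a ∈ (List.ofFn y).take r, a ∈ P.asIdeal) ↔
      ∀ i, x i ∈ P.asIdeal := fun P ↦ by rw [htake y hyx, List.forall_mem_ofFn_iff]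
  have hlen : (List.ofFn y).length = d' := List.length_ofFn
  have hCM : ∀ P : PrimeSpectrum R, P ∈ Module.support R M → (∀ i, x i ∈ P.asIdeal) →
      ringKrullDim (R ⧸ P.asIdeal) = ((d' - r : ℕ) : WithBot (WithTop ℕ)) → _ :=
    fun P hPM hP hdim ↦ isCMModule_localization_iff hys h0 (hlen.symm ▸ hrd) P hPM
      ((hmem P).mpr hP) (hlen.symm ▸ hdim)
  refine Iff.trans ?_ (forall_congr' fun P ↦ forall_congr' fun hPM ↦ forall_congr' fun hP ↦
    forall_congr' fun hdim ↦ (hCM P hPM hP hdim).symm)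
  rw [htake y hyx]
  constructor
  · rintro ⟨d'', hrd', z, hz, hzx⟩ P hPM hP hdim
    obtain rfl : d'' = d' :=
      Nat.cast_injective (R := WithBot (WithTop ℕ)) (hz.1.2.1.symm.trans hd)
    obtain ⟨hzs, -, hz0⟩ := (isSoP_iff z).mp hz.1
    have hzlen : (List.ofFn z).length = d'' := List.length_ofFn
    rw [← htake z hzx]
    refine isWeaklyRegular_localization hzs hz0 P.asIdeal
      (LocalizedModule.mkLinearMap P.asIdeal.primeCompl M) (hzlen.symm ▸ hr)
      ((isReducingSoP_iff z rfl).mp hz).2 ?_ (hzlen.symm ▸ hdim)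
    rwa [htake z hzx, List.forall_mem_ofFn_iff]
  · intro hreg
    obtain ⟨L, hL, hLr, hLm, hL0, hLred⟩ := exists_list_take_eq hys h0 (r := r) (hlen.symm ▸ hrd)
    obtain rfl : L.length = d' := hL.trans hlen
    have hLx := hLr.trans (htake y hyx)
    have hofFn : List.ofFn (fun i : Fin L.length ↦ L[i]) = L := List.ofFn_getElem
    refine ⟨L.length, hrd, fun i ↦ L[i], (isReducingSoP_iff _ hofFn).mpr
      ⟨(isSoP_iff _).mpr ⟨by rwa [hofFn], hd, by rwa [hofFn]⟩, ?_⟩, fun i ↦ ?_⟩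
    · intro i hi hi' P hP hdim
      obtain hir | hir := lt_or_ge i r
      · refine notMem_of_isWeaklyRegular_localization hLm hL0 hr ?_ hir hP hdim
        rw [hLx]
        intro P hPM hP
        exact hreg P hPM (List.forall_mem_ofFn_iff.mp hP)
      · refine hLred i hi hir P hP ?_
        rintro rfl
        rw [ringKrullDim_eq_zero_of_isField
          ((Ideal.Quotient.maximal_ideal_iff_isField_quotient _).mp inferInstance)] at hdim
        have := Nat.cast_injective (R := WithBot ℕ∞) (a₁ := 0) hdim
        omega
    · have h : (L.take r)[(i : ℕ)]'(by simp; omega) = (List.ofFn x)[(i : ℕ)]'(by simp) := by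
        simp only [hLx]
      simpa using h
end

section
/- Let (x_1,…,x_r) be part of a system of parameters of M with 0 ≤ r < d = dim_R M. If there exists a sequence (y_1,…,y_r) that is part of a reducing system of parameters of M with (y_1,…,y_r)M = (x_1,…,x_r)M, then (x_1,…,x_r) is itself part of a reducing system of parameters of M. -/
open IsLocalRing

section LocalRing

open RingTheory.Sequence
open scoped Pointwise

variable {A : Type*} [CommRing A] {N : Type*} [AddCommGroup N] [Module A N]

theorem exists_associatedPrime_quotSMulTop_of_colon_le [IsLocalRing A] [IsNoetherianRing A]
    [Module.Finite A N] {a : A} (ha : a ∈ maximalIdeal A) (K : Submodule A N) (hK : K ≠ ⊥)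
    (hcolon : ∀ m : N, a • m ∈ K → m ∈ K) :
    ∃ p : PrimeSpectrum A, p.asIdeal ∈ associatedPrimes A (QuotSMulTop a N) ∧
      Module.annihilator A K ≤ p.asIdeal ∧ a ∈ p.asIdeal := by
  have : Nontrivial K := (Submodule.nontrivial_iff_ne_bot).2 hK
  have : Nontrivial (QuotSMulTop a K) := nontrivial_quotSMulTop_of_mem_maximalIdeal K ha
  obtain ⟨P, hP⟩ := associatedPrimes.nonempty A (QuotSMulTop a K)
  have hinj : Function.Injective (QuotSMulTop.map a K.subtype) := by
    rw [← LinearMap.ker_eq_bot, Submodule.eq_bot_iff]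
    intro z hz
    obtain ⟨k, rfl⟩ := Submodule.mkQ_surjective _ z
    have hk : (k : N) ∈ a • (⊤ : Submodule A N) := by
      have h0 : QuotSMulTop.map a K.subtype (Submodule.Quotient.mk k) = 0 := hz
      rw [QuotSMulTop.map_apply_mk] at h0
      simpa using h0
    obtain ⟨m, -, hm⟩ := hk
    have hm' : a • m = k := hm
    have hmK : m ∈ K := hcolon m (hm' ▸ k.2)
    refine (Submodule.Quotient.mk_eq_zero _).2 ⟨⟨m, hmK⟩, trivial, Subtype.ext hm'⟩
  have hann : Module.annihilator A (QuotSMulTop a K) ≤ P := by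
    simpa only [Submodule.annihilator_top] using IsAssociatedPrime.annihilator_le hP
  refine ⟨⟨P, hP.isPrime⟩, associatedPrimes.subset_of_injective hinj hP, ?_, ?_⟩
  · exact (LinearMap.annihilator_le_of_surjective _ (Submodule.mkQ_surjective _)).trans hann
  · apply hann
    rw [Module.mem_annihilator]
    intro z
    obtain ⟨k, rfl⟩ := Submodule.mkQ_surjective _ z
    rw [← map_smul]
    exact (Submodule.Quotient.mk_eq_zero _).2 ⟨k, trivial, rfl⟩

theorem isSMulRegular_iff_forall_associatedPrimes [IsNoetherianRing A] {a : A} :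
    IsSMulRegular N a ↔ ∀ p : PrimeSpectrum A, p.asIdeal ∈ associatedPrimes A N →
      a ∉ p.asIdeal := by
  have h := biUnion_associatedPrimes_eq_compl_regular (R := A) N
  have h' : a ∈ (⋃ p ∈ associatedPrimes A N, (p : Set A)) ↔ ¬ IsSMulRegular N a := by
    rw [h]; rfl
  rw [← not_iff_not, ← h']
  simp only [Set.mem_iUnion, not_forall, not_not, exists_prop]
  exact ⟨fun ⟨P, hP, haP⟩ ↦ ⟨⟨P, hP.isPrime⟩, hP, haP⟩, fun ⟨p, hp, hap⟩ ↦ ⟨_, hp, hap⟩⟩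

/-- The associated primes of a module carrying a regular sequence of length `n` lie at distance
at least `n` from the maximal ideal, as measured by any strictly antitone function. -/
theorem add_length_le_of_isWeaklyRegular [IsLocalRing A] [IsNoetherianRing A] [Module.Finite A N]
    {δ : PrimeSpectrum A → ℕ∞} (hδ : ∀ p q, p < q → δ q + 1 ≤ δ p) {c : ℕ∞}
    (hc : c ≤ δ (closedPoint A)) {l : List A} (hl : ∀ a ∈ l, a ∈ maximalIdeal A)
    (hreg : IsWeaklyRegular N l) (p : PrimeSpectrum A)
    (hp : p.asIdeal ∈ associatedPrimes A N) : c + l.length ≤ δ p := by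
  induction l generalizing N p with
  | nil =>
    rcases eq_or_lt_of_le (show p ≤ closedPoint A from le_maximalIdeal p.2.ne_top) with h | h
    · simpa [h] using hc
    · simpa using hc.trans (le_self_add.trans (hδ _ _ h))
  | cons a l ih =>
    rw [isWeaklyRegular_cons_iff] at hreg
    have hap := isSMulRegular_iff_forall_associatedPrimes.1 hreg.1 p hp
    let K : Submodule A N := Submodule.torsionBySet A N p.asIdeal
    have hK : K ≠ ⊥ := by
      obtain ⟨-, k, hk⟩ := isAssociatedPrime_iff.1 hp
      refine (Submodule.ne_bot_iff _).2 ⟨k, ?_, ?_⟩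
      · rw [Submodule.mem_torsionBySet_iff]
        rintro ⟨b, hb⟩
        have hb' : b ∈ p.asIdeal := hb
        rw [hk, Submodule.mem_colon_singleton] at hb'
        simpa using hb'
      · rintro rfl
        apply p.2.ne_top
        rw [hk]
        ext; simp
    obtain ⟨q, hq, hKq, haq⟩ := exists_associatedPrime_quotSMulTop_of_colon_le (hl a (by simp)) K hK
      (by
        intro m hm
        rw [Submodule.mem_torsionBySet_iff] at hm ⊢
        intro b
        apply hreg.1
        change a • (b : A) • m = a • (0 : N)
        rw [smul_comm, smul_zero]
        exact hm b)
    have hpq : p < q := by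
      refine lt_of_le_of_ne ?_ (fun h ↦ hap (h ▸ haq))
      refine fun b hb ↦ hKq ?_
      rw [Module.mem_annihilator]
      intro k
      exact Subtype.ext ((Submodule.mem_torsionBySet_iff _ _).1 k.2 ⟨b, hb⟩)
    calc c + (a :: l).length = (c + l.length) + 1 := by push_cast [List.length_cons]; ring
      _ ≤ δ q + 1 := by gcongr; exact ih (fun b hb ↦ hl b (by simp [hb])) hreg.2 q hq
      _ ≤ δ p := hδ _ _ hpq

/-- A sequence `l` avoiding, at each step, the associated primes of large `δ` is regular. -/
theorem isWeaklyRegular_of_forall_associatedPrimes [IsLocalRing A] [IsNoetherianRing A]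
    [Module.Finite A N]
    {δ : PrimeSpectrum A → ℕ∞} (hδ : ∀ p q, p < q → δ q + 1 ≤ δ p) {c : ℕ∞}
    (hc : c ≤ δ (closedPoint A)) {l : List A} (hl : ∀ a ∈ l, a ∈ maximalIdeal A)
    (h : ∀ l₁ a l₂, l = l₁ ++ a :: l₂ → ∀ p : PrimeSpectrum A,
      p.asIdeal ∈ associatedPrimes A (N ⧸ (Ideal.ofList l₁ • ⊤ : Submodule A N)) →
        c + l₂.length ≤ δ p → a ∉ p.asIdeal) :
    IsWeaklyRegular N l := by
  induction l generalizing N with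
  | nil => exact IsWeaklyRegular.nil A N
  | cons a l ih =>
    have hl' : ∀ b ∈ l, b ∈ maximalIdeal A := fun b hb ↦ hl b (by simp [hb])
    have hreg : IsWeaklyRegular (QuotSMulTop a N) l := by
      refine ih hl' fun l₁ b l₂ hl₁ p hp ↦ h (a :: l₁) b l₂ (by simp [hl₁]) p ?_
      rwa [LinearEquiv.AssociatedPrimes.eq
        (Submodule.quotOfListConsSMulTopEquivQuotSMulTopInner N a l₁)]
    rw [isWeaklyRegular_cons_iff]
    refine ⟨?_, hreg⟩
    let K : Submodule A N := Submodule.torsion' A N (Submonoid.powers a)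
    by_cases hK : K = ⊥
    · intro x y hxy
      rw [← sub_eq_zero]
      have : x - y ∈ K := (Submodule.mem_torsion'_iff _ _).2
        ⟨⟨a, Submonoid.mem_powers a⟩, by
          change a • (x - y) = 0
          rw [smul_sub, sub_eq_zero]; exact hxy⟩
      simpa [hK] using this
    obtain ⟨q, hq, hKq, haq⟩ := exists_associatedPrime_quotSMulTop_of_colon_le (hl a (by simp)) K hK
      (by
        rintro m hm
        obtain ⟨⟨_, n, rfl⟩, hn⟩ := (Submodule.mem_torsion'_iff _ _).1 hm
        refine (Submodule.mem_torsion'_iff _ _).2 ⟨⟨a ^ (n + 1), n + 1, rfl⟩, ?_⟩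
        change a ^ (n + 1) • m = 0
        rw [pow_succ, mul_smul]; exact hn)
    obtain ⟨P, hP, hPq⟩ := Ideal.exists_minimalPrimes_le hKq
    have hPK := Module.associatedPrimes.minimalPrimes_annihilator_subset_associatedPrimes A K hP
    let p : PrimeSpectrum A := ⟨P, hP.1.1⟩
    have hap : a ∈ P := by
      obtain ⟨-, k, hk⟩ := isAssociatedPrime_iff.1 hPK
      obtain ⟨⟨_, n, rfl⟩, hn⟩ := (Submodule.mem_torsion'_iff _ _).1 k.2
      refine hP.1.1.mem_of_pow_mem n ?_
      rw [hk, Submodule.mem_colon_singleton]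
      exact Subtype.ext hn
    have hqδ := add_length_le_of_isWeaklyRegular hδ hc hl' hreg q hq
    have hpδ : δ q ≤ δ p := by
      rcases eq_or_lt_of_le (show p ≤ q from hPq) with h | h
      · rw [h]
      · exact le_self_add.trans (hδ _ _ h)
    refine absurd hap (h [] a l rfl p ?_ (hqδ.trans hpδ))
    have hbot : (Ideal.ofList ([] : List A) • ⊤ : Submodule A N) = ⊥ := by simp
    rw [LinearEquiv.AssociatedPrimes.eq (Submodule.quotEquivOfEqBot _ hbot)]
    exact associatedPrimes.subset_of_injective K.injective_subtype hPK

end LocalRing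

section Depth

open RingTheory.Sequence CategoryTheory Abelian Limits
open scoped Pointwise

universe u v

variable {A : Type u} [CommRing A] [IsLocalRing A] [IsNoetherianRing A] [Small.{v} A]

theorem exists_isRegular_quotSMulTop {N : Type v} [AddCommGroup N] [Module A N]
    [Module.Finite A N] [Nontrivial N] {a : A} (ha : a ∈ maximalIdeal A) (hreg : IsSMulRegular N a)
    {l : List A} (hl : ∀ b ∈ l, b ∈ maximalIdeal A) (hlreg : IsWeaklyRegular N l)
    {n : ℕ} (hn : n + 1 = l.length) :
    ∃ l' : List A, l'.length = n ∧ (∀ b ∈ l', b ∈ maximalIdeal A) ∧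
      IsRegular (QuotSMulTop a N) l' := by
  have key : ∀ (L : Type v) [AddCommGroup L] [Module A L] [Module.Finite A L] [Nontrivial L],
      (maximalIdeal A) • (⊤ : Submodule A (ModuleCat.of A L)) < ⊤ := fun L _ _ _ _ ↦
    (Submodule.top_ne_ideal_smul_of_le_jacobson_annihilator
      (maximalIdeal_le_jacobson _)).symm.lt_top
  have : Nontrivial (QuotSMulTop a N) := nontrivial_quotSMulTop_of_mem_maximalIdeal N ha
  have tfae := ModuleCat.exists_isRegular_tfae (maximalIdeal A) (n + 1) (ModuleCat.of A N) (key N)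
  have h1 := (tfae.out 3 1 rfl rfl).1
    ⟨l, hn.symm, hl, .of_isWeaklyRegular_of_mem_maximalIdeal N hl hlreg⟩
  refine ((ModuleCat.exists_isRegular_tfae (maximalIdeal A) n
    (ModuleCat.of A (QuotSMulTop a N)) (key _)).out 1 3 rfl rfl).1 fun i hi ↦ ?_
  have zero1 := AddCommGrpCat.isZero_of_iff_subsingleton.mpr (h1 i (by omega))
  have zero2 := AddCommGrpCat.isZero_of_iff_subsingleton.mpr (h1 (i + 1) (by omega))
  have hreg' : IsSMulRegular (ModuleCat.of A N) a := hreg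
  exact AddCommGrpCat.subsingleton_of_isZero <| ShortComplex.Exact.isZero_of_both_zeros
    ((Ext.covariant_sequence_exact₃' _ hreg'.smulShortComplex_shortExact) i (i + 1) rfl)
    (zero1.eq_zero_of_src _) (zero2.eq_zero_of_tgt _)

/-- If `N` has a regular sequence as long as `l` and each element of `l` avoids all primes of
large `δ` associated to the successive quotients, then `l` is regular. -/
theorem isWeaklyRegular_of_isWeaklyRegular_of_length_eq {N : Type v} [AddCommGroup N] [Module A N]
    [Module.Finite A N] [Nontrivial N]
    {δ : PrimeSpectrum A → ℕ∞} (hδ : ∀ p q, p < q → δ q + 1 ≤ δ p) {c : ℕ}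
    (hc : c ≤ δ (closedPoint A)) {k l : List A} (hk : ∀ a ∈ k, a ∈ maximalIdeal A)
    (hkreg : IsWeaklyRegular N k) (hkl : k.length = l.length)
    (hl : ∀ a ∈ l, a ∈ maximalIdeal A)
    (h : ∀ l₁ a l₂, l = l₁ ++ a :: l₂ → ∀ p : PrimeSpectrum A,
      p.asIdeal ∈ associatedPrimes A (N ⧸ (Ideal.ofList l₁ • ⊤ : Submodule A N)) →
        a ∈ p.asIdeal → δ p ≤ (c + l₂.length : ℕ)) :
    IsWeaklyRegular N l := by
  induction l generalizing N k with
  | nil => exact IsWeaklyRegular.nil A N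
  | cons a l ih =>
    have ha := hl a (by simp)
    have hreg : IsSMulRegular N a := by
      rw [isSMulRegular_iff_forall_associatedPrimes]
      intro p hp hap
      have h1 := add_length_le_of_isWeaklyRegular hδ hc hk hkreg p hp
      have hbot : (Ideal.ofList ([] : List A) • ⊤ : Submodule A N) = ⊥ := by simp
      have h2 := h [] a l rfl p
        (by rwa [LinearEquiv.AssociatedPrimes.eq (Submodule.quotEquivOfEqBot _ hbot)]) hap
      have h3 := h1.trans h2
      rw [hkl, List.length_cons] at h3
      norm_cast at h3
      omega
    rw [isWeaklyRegular_cons_iff]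
    refine ⟨hreg, ?_⟩
    have : Nontrivial (QuotSMulTop a N) := nontrivial_quotSMulTop_of_mem_maximalIdeal N ha
    obtain ⟨k', hk'l, hk', hk'reg⟩ := exists_isRegular_quotSMulTop ha hreg hk hkreg
      (n := l.length) (by simp [hkl])
    refine ih hk' hk'reg.1 hk'l (fun b hb ↦ hl b (by simp [hb])) fun l₁ b l₂ hl₁ p hp ↦
      h (a :: l₁) b l₂ (by simp [hl₁]) p ?_
    rwa [LinearEquiv.AssociatedPrimes.eq
        (Submodule.quotOfListConsSMulTopEquivQuotSMulTopInner N a l₁)]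

end Depth

section Dimension

variable {R : Type*} [CommRing R]

theorem ringKrullDim_quotient_asIdeal (p : PrimeSpectrum R) :
    ringKrullDim (R ⧸ p.asIdeal) = (Order.coheight p : ℕ∞) := by
  rw [ringKrullDim_quotient, Order.coheight_eq_krullDim_Ici]
  rfl

theorem exists_ringKrullDim_le_coheight_add_card [IsLocalRing R] [IsNoetherianRing R]
    (s : Finset R) (hs : ∀ a ∈ s, a ∈ maximalIdeal R) :
    ∃ q : PrimeSpectrum R, (∀ a ∈ s, a ∈ q.asIdeal) ∧
      ringKrullDim R ≤ (Order.coheight q + s.card : ℕ∞) := by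
  have hs' : (s : Set R) ⊆ Ring.jacobson R := by
    rw [ringJacobson_eq_maximalIdeal]
    exact hs
  have hdim := ringKrullDim_le_ringKrullDim_quotient_add_card s hs'
  set I : Ideal R := Ideal.span (s : Set R)
  have : Nontrivial (R ⧸ I) := Ideal.Quotient.nontrivial_iff.2 <|
    ne_top_of_le_ne_top (maximalIdeal.isMaximal R).ne_top (Ideal.span_le.2 hs)
  have : IsLocalRing (R ⧸ I) := .of_surjective' _ Ideal.Quotient.mk_surjective
  have hn : ringKrullDim (R ⧸ I) = _ := Order.krullDim_eq_length_of_finiteDimensionalOrder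
  obtain ⟨l, hl⟩ := Order.le_krullDim_iff.1 (hn.symm.trans (ringKrullDim_quotient I)).le
  let l' := l.map _ (Subtype.strictMono_coe _)
  refine ⟨l'.head, fun a ha ↦ l.head.2 (Ideal.subset_span ha), hdim.trans ?_⟩
  have h1 : (l.length : ℕ∞) ≤ Order.coheight l'.head := Order.length_le_coheight le_rfl
  rw [hn, ← hl]
  exact_mod_cast add_le_add_left h1 (s.card : ℕ∞)

/-- Adding `n` elements of the maximal ideal to a prime `p` drops the dimension by at most `n`. -/
theorem exists_le_coheight_le_add_card [IsLocalRing R] [IsNoetherianRing R] (p : PrimeSpectrum R)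
    (s : Finset R) (hs : ∀ a ∈ s, a ∈ maximalIdeal R) :
    ∃ q : PrimeSpectrum R, p ≤ q ∧ (∀ a ∈ s, a ∈ q.asIdeal) ∧
      Order.coheight p ≤ Order.coheight q + s.card := by
  classical
  let f := Ideal.Quotient.mk p.asIdeal
  have hf : Function.Surjective f := Ideal.Quotient.mk_surjective
  have : IsLocalRing (R ⧸ p.asIdeal) := .of_surjective' f hf
  obtain ⟨q, hq, hdim⟩ := exists_ringKrullDim_le_coheight_add_card (s.image f) (by
    intro b hb
    obtain ⟨a, ha, rfl⟩ := Finset.mem_image.1 hb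
    rw [← map_maximalIdeal_of_surjective f hf]
    exact Ideal.mem_map_of_mem f (hs a ha))
  rw [ringKrullDim_quotient_asIdeal, WithBot.coe_le_coe] at hdim
  have hmono : StrictMono (PrimeSpectrum.comap f) :=
    (Monotone.strictMono_of_injective (fun _ _ h ↦ Ideal.comap_mono h)
      (PrimeSpectrum.comap_injective_of_surjective f hf))
  refine ⟨PrimeSpectrum.comap f q, fun a ha ↦ ?_, fun a ha ↦ hq _ (Finset.mem_image_of_mem f ha),
    hdim.trans (add_le_add (Order.coheight_le_coheight_apply_of_strictMono _ hmono q)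
      (Nat.cast_le.2 Finset.card_image_le))⟩
  have : f a = 0 := Ideal.Quotient.eq_zero_iff_mem.2 ha
  change f a ∈ q.asIdeal
  rw [this]
  exact zero_mem _

variable {M : Type*} [AddCommGroup M] [Module R M]

theorem eq_closedPoint_of_mem_support_of_isFiniteLength [IsLocalRing R]
    (h : IsFiniteLength R M) {p : PrimeSpectrum R} (hp : p ∈ Module.support R M) :
    p = closedPoint R := by
  induction h with
  | of_subsingleton => simp [Module.support_eq_empty] at hp
  | @of_simple_quotient M _ _ N hN _ ih =>
    rw [Module.support_of_exact (LinearMap.exact_subtype_mkQ N) N.injective_subtype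
      N.mkQ_surjective] at hp
    rcases hp with hp | hp
    · exact ih hp
    · obtain ⟨I, hI, ⟨e⟩⟩ := isSimpleModule_iff_quot_maximal.1 hN
      rw [e.support_eq, Module.support_eq_zeroLocus, Ideal.annihilator_quotient] at hp
      rw [eq_maximalIdeal hI] at hp
      exact le_antisymm (le_maximalIdeal p.2.ne_top) hp

/-- If `x` is a system of parameters of `M`, then `M ⧸ (x 0, …, x (i-1))M` has dimension at most
`d - i`. -/
theorem IsSoP.coheight_le_sub [IsLocalRing R] [IsNoetherianRing R] [Module.Finite R M]
    {d : ℕ} {x : Fin d → R} (hx : IsSoP R M x) {i : ℕ} {p : PrimeSpectrum R}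
    (hp : p ∈ Module.support R M) (hxp : ∀ j : Fin d, (j : ℕ) < i → x j ∈ p.asIdeal) :
    Order.coheight p ≤ (d - i : ℕ) := by
  classical
  let s : Finset R := (Finset.univ.filter fun j : Fin d ↦ i ≤ j).image x
  obtain ⟨q, hpq, hsq, hq⟩ := exists_le_coheight_le_add_card p s (by
    intro a ha
    obtain ⟨j, -, rfl⟩ := Finset.mem_image.1 ha
    exact hx.1 j)
  have hqM : q = closedPoint R := by
    refine eq_closedPoint_of_mem_support_of_isFiniteLength hx.2.2 ?_
    rw [Module.support_quotient]
    refine ⟨Module.mem_support_mono hpq hp, ?_⟩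
    rw [PrimeSpectrum.zeroLocus_span]
    rintro _ ⟨j, rfl⟩
    rcases lt_or_ge (j : ℕ) i with h | h
    · exact hpq (hxp j h)
    · exact hsq _ (Finset.mem_image_of_mem _ (by simpa using h))
  have hq0 : Order.coheight q = 0 := by
    rw [Order.coheight_eq_zero, hqM]
    exact fun P _ ↦ le_maximalIdeal P.2.ne_top
  rw [hq0, zero_add] at hq
  refine hq.trans (Nat.cast_le.2 (Finset.card_image_le.trans ?_))
  have h := Finset.card_le_card_of_injOn (s := Finset.univ.filter fun j : Fin d ↦ i ≤ j)
    (t := Finset.Ico i d) (fun j ↦ (j : ℕ)) (by intro j hj; simpa using hj)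
    Fin.val_injective.injOn
  simpa using h

theorem mem_support_and_le_of_mem_associatedPrimes [Module.Finite R M] {I : Ideal R}
    {p : PrimeSpectrum R} (hp : p.asIdeal ∈ associatedPrimes R (M ⧸ (I • ⊤ : Submodule R M))) :
    p ∈ Module.support R M ∧ I ≤ p.asIdeal := by
  have h : p ∈ Module.support R (M ⧸ (I • ⊤ : Submodule R M)) := by
    rw [Module.mem_support_iff_of_finite, ← Submodule.annihilator_top]
    exact IsAssociatedPrime.annihilator_le hp
  rwa [Module.support_quotient] at h

theorem IsSoP.coheight_le_of_mem_associatedPrimes [IsLocalRing R] [IsNoetherianRing R]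
    [Module.Finite R M] {d : ℕ} {x : Fin d → R} (hx : IsSoP R M x) (i : Fin d)
    {p : PrimeSpectrum R} (hp : p.asIdeal ∈ associatedPrimes R
      (M ⧸ (Ideal.span (x '' {j : Fin d | (j : ℕ) < i}) • ⊤ : Submodule R M)))
    (hi : x i ∈ p.asIdeal) : Order.coheight p ≤ (d - (i + 1) : ℕ) := by
  obtain ⟨hpM, hIp⟩ := mem_support_and_le_of_mem_associatedPrimes hp
  refine hx.coheight_le_sub hpM fun j hj ↦ ?_
  rcases Nat.lt_succ_iff_lt_or_eq.1 hj with h | h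
  · exact hIp (Ideal.subset_span ⟨j, h, rfl⟩)
  · rwa [Fin.ext h]

theorem IsReducingSoP.notMem_of_le_coheight [IsLocalRing R] [IsNoetherianRing R]
    [Module.Finite R M] {d : ℕ} {x : Fin d → R} (hx : IsReducingSoP R M x) {i : Fin d}
    (hid : (i : ℕ) < d - 1) {p : PrimeSpectrum R} (hp : p.asIdeal ∈ associatedPrimes R
      (M ⧸ (Ideal.span (x '' {j : Fin d | (j : ℕ) < i}) • ⊤ : Submodule R M)))
    (hpd : (d - (i + 1) : ℕ) ≤ Order.coheight p) : x i ∉ p.asIdeal := by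
  intro hi
  refine hx.2 i hid _ hp ?_ hi
  rw [ringKrullDim_quotient_asIdeal,
    le_antisymm (hx.1.coheight_le_of_mem_associatedPrimes i hp hi) hpd]
  rfl

end Dimension

section Localization

variable {R : Type*} [CommRing R] [IsNoetherianRing R] {M : Type*} [AddCommGroup M] [Module R M]

theorem mem_associatedPrimes_localizedModule_quotient_iff (q : Ideal R) [q.IsPrime] (I : Ideal R)
    (p : Ideal (Localization.AtPrime q)) :
    p ∈ associatedPrimes (Localization.AtPrime q) (LocalizedModule q.primeCompl M ⧸
        (I.map (algebraMap R (Localization.AtPrime q)) • ⊤ :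
          Submodule (Localization.AtPrime q) (LocalizedModule q.primeCompl M))) ↔
      p.comap (algebraMap R (Localization.AtPrime q)) ∈
        associatedPrimes R (M ⧸ (I • ⊤ : Submodule R M)) := by
  let e : LocalizedModule q.primeCompl (M ⧸ (I • ⊤ : Submodule R M)) ≃ₗ[Localization.AtPrime q] _ :=
    (localizedQuotientEquiv _ _).symm ≪≫ₗ
      Submodule.quotEquivOfEq _ _ (by rw [Submodule.localized,
        Submodule.localized'_smul, Ideal.localized'_eq_map, Submodule.localized'_top])
  rw [← LinearEquiv.AssociatedPrimes.eq e,
    ← Module.associatedPrimes.preimage_comap_associatedPrimes_eq_associatedPrimes_of_isLocalizedModule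
      q.primeCompl (Localization.AtPrime q)
      (LocalizedModule.mkLinearMap q.primeCompl (M ⧸ (I • ⊤ : Submodule R M)))]
  rfl

end Localization

section List

variable {R : Type*} [CommSemiring R]

theorem List.exists_of_ofFn_eq_append_cons {n : ℕ} {x : Fin n → R} {l₁ l₂ : List R} {a : R}
    (h : List.ofFn x = l₁ ++ a :: l₂) :
    ∃ i : Fin n, a = x i ∧ i + l₂.length + 1 = n ∧
      Ideal.ofList l₁ = Ideal.span (x '' {j | (j : ℕ) < i}) := by
  have hn : l₁.length + l₂.length + 1 = n := by
    have := congrArg List.length h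
    simp at this; omega
  refine ⟨⟨l₁.length, by omega⟩, ?_, hn, congrArg Ideal.span (Set.ext fun b ↦ ?_)⟩
  · have : (List.ofFn x)[l₁.length]'(by simp; omega) = a := by simp [h]
    simpa using this.symm
  · have h1 : l₁ = (List.ofFn x).take l₁.length := by simp [h]
    have h2 : b ∈ l₁ ↔ b ∈ (List.ofFn x).take l₁.length := by rw [← h1]
    change b ∈ l₁ ↔ _
    rw [h2, List.mem_take_iff_getElem]
    constructor
    · rintro ⟨j, hj, rfl⟩
      exact ⟨⟨j, by omega⟩, by simp; omega, by simp⟩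
    · rintro ⟨j, hj, rfl⟩
      exact ⟨j, by simp at hj ⊢; omega, by simp⟩

end List

section SystemOfParameters

theorem Fin.image_comp_castLE {α : Type*} {r d : ℕ} (hrd : r ≤ d) (x : Fin d → α)
    {i : ℕ} (hi : i ≤ r) :
    (x ∘ Fin.castLE hrd) '' {j | (j : ℕ) < i} = x '' {j | (j : ℕ) < i} := by
  rw [Set.image_comp]
  congr 1
  ext j
  exact ⟨by rintro ⟨k, hk, rfl⟩; exact hk, fun hj ↦ ⟨⟨j, lt_of_lt_of_le hj hi⟩, hj, rfl⟩⟩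

theorem Fin.range_comp_castLE {α : Type*} {r d : ℕ} (hrd : r ≤ d) (x : Fin d → α) :
    Set.range (x ∘ Fin.castLE hrd) = x '' {j | (j : ℕ) < r} := by
  rw [← Fin.image_comp_castLE hrd x le_rfl, ← Set.image_univ]
  congr 1
  ext j
  simp

variable {R : Type*} [CommRing R]

theorem coheight_comap_localization_add_one_le (q : Ideal R) [q.IsPrime]
    (p p' : PrimeSpectrum (Localization.AtPrime q)) (h : p < p') :
    Order.coheight (PrimeSpectrum.comap (algebraMap R _) p') + 1 ≤
      Order.coheight (PrimeSpectrum.comap (algebraMap R _) p) :=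
  Order.coheight_add_one_le <| Monotone.strictMono_of_injective
    (f := PrimeSpectrum.comap (algebraMap R (Localization.AtPrime q)))
    (fun _ _ h ↦ Ideal.comap_mono h)
    (PrimeSpectrum.localization_comap_injective _ q.primeCompl) h

theorem comap_closedPoint_localization (q : PrimeSpectrum R) :
    PrimeSpectrum.comap (algebraMap R (Localization.AtPrime q.asIdeal)) (closedPoint _) = q :=
  PrimeSpectrum.ext Localization.AtPrime.under_maximalIdeal

theorem mem_maximalIdeal_of_mem_map_ofFn {n : ℕ} {x : Fin n → R} {q : Ideal R} [q.IsPrime]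
    (hx : ∀ j, x j ∈ q) :
    ∀ a ∈ (List.ofFn x).map (algebraMap R (Localization.AtPrime q)), a ∈ maximalIdeal _ := by
  intro a ha
  obtain ⟨_, hb, rfl⟩ := List.mem_map.1 ha
  obtain ⟨j, rfl⟩ := (List.mem_ofFn' _ _).1 hb
  exact (IsLocalization.AtPrime.to_map_mem_maximal_iff _ q _).2 (hx j)

variable {M : Type*} [AddCommGroup M] [Module R M]

/-- Describes the terms of the localised sequence of the first `r` members of `x`, together with
the primes associated to the corresponding quotients. -/
theorem exists_of_map_ofFn_eq_append_cons [IsNoetherianRing R] {r d : ℕ} (hrd : r ≤ d)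
    (x : Fin d → R)
    {q : Ideal R} [q.IsPrime] {l₁ l₂ : List (Localization.AtPrime q)} {a : Localization.AtPrime q}
    (h : (List.ofFn (x ∘ Fin.castLE hrd)).map (algebraMap R (Localization.AtPrime q)) =
      l₁ ++ a :: l₂) :
    ∃ i : Fin d, i + l₂.length + 1 = r ∧ a = algebraMap R _ (x i) ∧
      ∀ p : PrimeSpectrum (Localization.AtPrime q),
        p.asIdeal ∈ associatedPrimes _ (LocalizedModule q.primeCompl M ⧸ (Ideal.ofList l₁ • ⊤ :
          Submodule (Localization.AtPrime q) (LocalizedModule q.primeCompl M))) ↔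
        (PrimeSpectrum.comap (algebraMap R _) p).asIdeal ∈ associatedPrimes R
          (M ⧸ (Ideal.span (x '' {j | (j : ℕ) < i}) • ⊤ : Submodule R M)) := by
  obtain ⟨m₁, m, hm, rfl, hm'⟩ := List.map_eq_append_iff.1 h
  obtain ⟨b, m₂, rfl, rfl, rfl⟩ := List.map_eq_cons_iff.1 hm'
  obtain ⟨i, rfl, hi, hI⟩ := List.exists_of_ofFn_eq_append_cons hm
  rw [Fin.image_comp_castLE hrd x i.2.le] at hI
  refine ⟨Fin.castLE hrd i, by simpa using hi, rfl, fun p ↦ ?_⟩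
  rw [← Ideal.map_ofList, mem_associatedPrimes_localizedModule_quotient_iff, hI]
  rfl

variable [IsLocalRing R]

theorem IsSoP.of_span_smul_top_eq {d : ℕ} {x y : Fin d → R} (hy : IsSoP R M y)
    (hx : ∀ i, x i ∈ maximalIdeal R)
    (h : Ideal.span (Set.range y) • (⊤ : Submodule R M) =
      Ideal.span (Set.range x) • (⊤ : Submodule R M)) : IsSoP R M x :=
  ⟨hx, hy.2.1, h ▸ hy.2.2⟩

variable [IsNoetherianRing R]

theorem IsReducingSoP.isWeaklyRegular_localization [Module.Finite R M] {d r : ℕ} {y : Fin d → R}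
    (hy : IsReducingSoP R M y) (hr : r < d) {q : PrimeSpectrum R}
    (hq : (d - r : ℕ) ≤ Order.coheight q) (hyq : ∀ j, (y ∘ Fin.castLE hr.le) j ∈ q.asIdeal) :
    RingTheory.Sequence.IsWeaklyRegular (LocalizedModule q.asIdeal.primeCompl M)
      ((List.ofFn (y ∘ Fin.castLE hr.le)).map (algebraMap R (Localization.AtPrime q.asIdeal))) := by
  refine isWeaklyRegular_of_forall_associatedPrimes (c := (d - r : ℕ))
    (coheight_comap_localization_add_one_le q.asIdeal)
    (by rwa [comap_closedPoint_localization]) (mem_maximalIdeal_of_mem_map_ofFn hyq)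
    fun l₁ a l₂ h p hp hpd ↦ ?_
  obtain ⟨i, hi, rfl, hass⟩ := exists_of_map_ofFn_eq_append_cons (M := M) hr.le y h
  refine hy.notMem_of_le_coheight (by omega) ((hass p).1 hp) ?_
  convert hpd using 1
  norm_cast
  omega

theorem IsSoP.isWeaklyRegular_localization [Module.Finite R M] {d r : ℕ} {x y : Fin d → R}
    (hx : IsSoP R M x) (hy : IsReducingSoP R M y) (hr : r < d) {q : PrimeSpectrum R}
    (hqM : q ∈ Module.support R M)
    (hq : (d - r : ℕ) ≤ Order.coheight q) (hxq : ∀ j, (x ∘ Fin.castLE hr.le) j ∈ q.asIdeal)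
    (hyq : ∀ j, (y ∘ Fin.castLE hr.le) j ∈ q.asIdeal) :
    RingTheory.Sequence.IsWeaklyRegular (LocalizedModule q.asIdeal.primeCompl M)
      ((List.ofFn (x ∘ Fin.castLE hr.le)).map (algebraMap R (Localization.AtPrime q.asIdeal))) := by
  have : Nontrivial (LocalizedModule q.asIdeal.primeCompl M) := Module.mem_support_iff.1 hqM
  refine isWeaklyRegular_of_isWeaklyRegular_of_length_eq
    (coheight_comap_localization_add_one_le q.asIdeal) (c := d - r)
    (by rwa [comap_closedPoint_localization]) (mem_maximalIdeal_of_mem_map_ofFn hyq)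
    (hy.isWeaklyRegular_localization hr hq hyq) (by simp)
    (mem_maximalIdeal_of_mem_map_ofFn hxq) fun l₁ a l₂ h p hp ha ↦ ?_
  obtain ⟨i, hi, rfl, hass⟩ := exists_of_map_ofFn_eq_append_cons (M := M) hr.le x h
  refine (hx.coheight_le_of_mem_associatedPrimes i ((hass p).1 hp) ha).trans
    (Nat.cast_le.2 ?_)
  omega

theorem IsSoP.notMem_of_mem_associatedPrimes [Module.Finite R M] {d r : ℕ} {x y : Fin d → R}
    (hx : IsSoP R M x) (hy : IsReducingSoP R M y) (hr : r < d)
    (hxy : Ideal.span (Set.range (y ∘ Fin.castLE hr.le)) • (⊤ : Submodule R M) =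
      Ideal.span (Set.range (x ∘ Fin.castLE hr.le)) • (⊤ : Submodule R M))
    {i : Fin d} (hi : (i : ℕ) < r) {p : PrimeSpectrum R} (hp : p.asIdeal ∈ associatedPrimes R
      (M ⧸ (Ideal.span (x '' {j : Fin d | (j : ℕ) < i}) • ⊤ : Submodule R M)))
    (hpd : (d - (i + 1) : ℕ) ≤ Order.coheight p) : x i ∉ p.asIdeal := by
  classical
  intro hip
  obtain ⟨hpM, hIp⟩ := mem_support_and_le_of_mem_associatedPrimes hp
  obtain ⟨q, hpq, hsq, hq⟩ := exists_le_coheight_le_add_card p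
    ((Finset.Ioo i ⟨r, hr⟩).image x) (by
      intro a ha
      obtain ⟨j, -, rfl⟩ := Finset.mem_image.1 ha
      exact hx.1 j)
  have hqM := Module.mem_support_mono hpq hpM
  have hxq : ∀ j, (x ∘ Fin.castLE hr.le) j ∈ q.asIdeal := by
    intro j
    rcases lt_trichotomy (j : ℕ) i with h | h | h
    · exact hpq (hIp (Ideal.subset_span ⟨_, h, rfl⟩))
    · have : Fin.castLE hr.le j = i := Fin.ext h
      simpa [this] using hpq hip
    · exact hsq _ (Finset.mem_image_of_mem _ (Finset.mem_Ioo.2 ⟨h, j.2⟩))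
  have hyq : ∀ j, (y ∘ Fin.castLE hr.le) j ∈ q.asIdeal := by
    have h : q ∈ Module.support R
        (M ⧸ (Ideal.span (Set.range (y ∘ Fin.castLE hr.le)) • ⊤ : Submodule R M)) := by
      rw [hxy, Module.support_quotient]
      refine ⟨hqM, Ideal.span_le.2 ?_⟩
      rintro _ ⟨j, rfl⟩
      exact hxq j
    rw [Module.support_quotient] at h
    exact fun j ↦ h.2 (Ideal.subset_span ⟨j, rfl⟩)
  have hqd : (d - r : ℕ) ≤ Order.coheight q := by
    have h1 : ((Finset.Ioo i ⟨r, hr⟩).image x).card ≤ r - i - 1 :=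
      Finset.card_image_le.trans (by simp)
    have h2 : ((d - r : ℕ) : ℕ∞) + (r - i - 1 : ℕ) ≤ Order.coheight q + (r - i - 1 : ℕ) := by
      refine le_trans (le_of_eq ?_) (hpd.trans (hq.trans (by gcongr)))
      norm_cast
      omega
    exact (ENat.add_le_add_iff_right (ENat.natCast_ne_top _)).1 h2
  have hreg := hx.isWeaklyRegular_localization hy hr hqM hqd hxq hyq
  let l := (List.ofFn (x ∘ Fin.castLE hr.le)).map (algebraMap R (Localization.AtPrime q.asIdeal))
  have hil : (i : ℕ) < l.length := by simpa [l] using hi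
  have hl : l = l.take i ++ l[(i : ℕ)] :: l.drop (i + 1) := by simp
  obtain ⟨i', hi', hai, hass⟩ := exists_of_map_ofFn_eq_append_cons (M := M) hr.le x hl
  have hii : i' = i := by
    apply Fin.ext
    simp [l] at hi'
    omega
  subst hii
  have hcomap : (p.asIdeal.map (algebraMap R (Localization.AtPrime q.asIdeal))).comap
      (algebraMap R _) = p.asIdeal := Ideal.under_map_of_isLocalizationAtPrime q.asIdeal hpq
  have hprime : (p.asIdeal.map (algebraMap R (Localization.AtPrime q.asIdeal))).IsPrime :=
    Ideal.isPrime_map_of_isLocalizationAtPrime q.asIdeal hpq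
  refine isSMulRegular_iff_forall_associatedPrimes.1 (hreg.regular_mod_prev i' hil) ⟨_, hprime⟩
    ((hass ⟨_, hprime⟩).2 ?_) ?_
  · change Ideal.comap _ _ ∈ _
    rwa [hcomap]
  · change l[(i' : ℕ)] ∈ _
    rw [hai]
    exact Ideal.mem_map_of_mem _ hip

theorem IsSoP.isReducingSoP_of_eq [Module.Finite R M] {d r : ℕ} {x y w : Fin d → R}
    (hx : IsSoP R M x) (hy : IsReducingSoP R M y) (hr : r < d)
    (hxy : Ideal.span (Set.range (y ∘ Fin.castLE hr.le)) • (⊤ : Submodule R M) =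
      Ideal.span (Set.range (x ∘ Fin.castLE hr.le)) • (⊤ : Submodule R M))
    (hwx : ∀ i : Fin d, (i : ℕ) < r → w i = x i) (hwy : ∀ i : Fin d, r ≤ i → w i = y i) :
    IsReducingSoP R M w := by
  have himage : ∀ i ≤ r, w '' {j | (j : ℕ) < i} = x '' {j | (j : ℕ) < i} := fun i hi ↦
    Set.image_congr fun j hj ↦ hwx j (lt_of_lt_of_le hj hi)
  have hspan : ∀ i, r ≤ i → Ideal.span (y '' {j | (j : ℕ) < i}) • (⊤ : Submodule R M) =
      Ideal.span (w '' {j | (j : ℕ) < i}) • (⊤ : Submodule R M) := by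
    intro i hi
    have hset : {j : Fin d | (j : ℕ) < i} =
        {j : Fin d | (j : ℕ) < r} ∪ {j : Fin d | r ≤ j ∧ (j : ℕ) < i} := by
      ext j
      simp only [Set.mem_ofPred_eq, Set.mem_union]
      omega
    have hwy' : w '' {j | r ≤ j ∧ (j : ℕ) < i} = y '' {j | r ≤ j ∧ (j : ℕ) < i} :=
      Set.image_congr fun j hj ↦ hwy j hj.1
    rw [Fin.range_comp_castLE, Fin.range_comp_castLE] at hxy
    rw [hset, Set.image_union, Set.image_union, Ideal.span_union, Ideal.span_union,
      Submodule.sup_smul, Submodule.sup_smul, himage r le_rfl, hwy', hxy]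
  have huniv : {j : Fin d | (j : ℕ) < d} = Set.univ := Set.eq_univ_of_forall fun j ↦ j.2
  refine ⟨hy.1.of_span_smul_top_eq (fun i ↦ ?_) ?_, fun i hid P hP hPd ↦ ?_⟩
  · rcases lt_or_ge (i : ℕ) r with hi | hi
    · exact hwx i hi ▸ hx.1 i
    · exact hwy i hi ▸ hy.1.1 i
  · simpa only [huniv, Set.image_univ] using hspan d hr.le
  · rcases lt_or_ge (i : ℕ) r with hi | hi
    · rw [himage i hi.le] at hP
      rw [hwx i hi]
      refine hx.notMem_of_mem_associatedPrimes hy hr hxy hi (p := ⟨P, hP.isPrime⟩) hP ?_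
      have h := ringKrullDim_quotient_asIdeal ⟨P, hP.isPrime⟩
      rw [hPd] at h
      exact (WithBot.coe_injective h).le
    · rw [← hspan i hi] at hP
      rw [hwy i hi]
      exact hy.2 i hid P hP hPd

end SystemOfParameters

theorem stmt2 (R M : Type*) [CommRing R] [IsLocalRing R] [IsNoetherianRing R]
    [AddCommGroup M] [Module R M] [Module.Finite R M] [Nontrivial M]
    {d r : ℕ} (hd : moduleDim R M = (d : ℕ)) (hr : r < d)
    (x y : Fin r → R) (hx : IsPartSoP R M x) (hy : IsPartReducingSoP R M y)
    (hxy : Ideal.span (Set.range y) • (⊤ : Submodule R M)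
        = Ideal.span (Set.range x) • (⊤ : Submodule R M)) :
    IsPartReducingSoP R M x := by
  obtain ⟨d₁, hrd₁, X, hX, hXx⟩ := hx
  obtain ⟨d₂, hrd₂, Y, hY, hYy⟩ := hy
  obtain rfl : d = d₁ := by exact_mod_cast hd.symm.trans hX.2.1
  obtain rfl : d = d₂ := by exact_mod_cast hd.symm.trans hY.1.2.1
  obtain rfl : X ∘ Fin.castLE hr.le = x := funext hXx
  obtain rfl : Y ∘ Fin.castLE hr.le = y := funext hYy
  refine ⟨d, hr.le, fun i ↦ if (i : ℕ) < r then X i else Y i,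
    hX.isReducingSoP_of_eq hY hr hxy (fun i hi ↦ if_pos hi) (fun i hi ↦ if_neg hi.not_gt),
    fun i ↦ ?_⟩
  simp
end

section
/- Let (x_1,…,x_r) be part of a system of parameters of M with 0 ≤ r < d = dim_R M. If there exists a sequence (y_1,…,y_r) that is part of a reducing system of parameters of M with Supp M ∩ V(x_1,…,x_r) ⊆ V(y_1,…,y_r), then (x_1,…,x_r) is part of a reducing system of parameters of M. -/
open IsLocalRing

/-- An element `a` is regular on `M` at `P` if it is a nonzerodivisor on the localization of `M`
at `P`. -/
def IsRegularElemAt {R : Type*} [CommRing R] (P : Ideal R) (a : R)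
    (M : Type*) [AddCommGroup M] [Module R M] : Prop :=
  ∀ m : M, a • m = 0 → ∃ s ∉ P, s • m = 0

/-- A list is regular on `M` at `P` if it is a weakly regular sequence on the localization of `M`
at `P`. -/
def IsRegularSeqAt {R : Type*} [CommRing R] (P : Ideal R) :
    List R → ∀ (M : Type*) [AddCommGroup M] [Module R M], Prop
  | [], _, _, _ => True
  | a :: l, M, _, _ => IsRegularElemAt P a M ∧ IsRegularSeqAt P l (QuotSMulTop a M)

section Regular

open scoped Pointwise

variable {R : Type*} [CommRing R] {P Q : Ideal R} {a b : R} {l l' : List R} {M N : Type*}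
  [AddCommGroup M] [Module R M] [AddCommGroup N] [Module R N]

theorem IsRegularElemAt.congr (e : M ≃ₗ[R] N) (h : IsRegularElemAt P a M) :
    IsRegularElemAt P a N := fun n hn => by
  obtain ⟨s, hs, hsn⟩ := h (e.symm n) (by rw [← map_smul, hn, map_zero])
  exact ⟨s, hs, by rwa [← map_smul, map_eq_zero_iff _ e.symm.injective] at hsn⟩

theorem IsRegularSeqAt.congr {R : Type*} [CommRing R] {P : Ideal R} {l : List R} {M N : Type*}
    [AddCommGroup M] [Module R M] [AddCommGroup N] [Module R N] (e : M ≃ₗ[R] N)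
    (h : IsRegularSeqAt P l M) : IsRegularSeqAt P l N := by
  induction l generalizing M N with
  | nil => trivial
  | cons a l ih => exact ⟨h.1.congr e, ih (QuotSMulTop.congr a e) h.2⟩

theorem IsRegularSeqAt.of_append_left (h : IsRegularSeqAt P (l ++ l') M) :
    IsRegularSeqAt P l M := by
  induction l generalizing M with
  | nil => trivial
  | cons a l ih => exact ⟨h.1, ih h.2⟩

theorem isRegularSeqAt_append_singleton_iff :
    IsRegularSeqAt P (l ++ [a]) M ↔ IsRegularSeqAt P l M ∧
      IsRegularElemAt P a (M ⧸ (Ideal.ofList l • ⊤ : Submodule R M)) := by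
  induction l generalizing M with
  | nil =>
    have e : (M ⧸ (Ideal.ofList ([] : List R) • ⊤ : Submodule R M)) ≃ₗ[R] M :=
      Submodule.quotEquivOfEqBot _ (by rw [Ideal.ofList_nil, Submodule.bot_smul])
    exact ⟨fun h => ⟨trivial, h.1.congr e.symm⟩, fun h => ⟨h.2.congr e, trivial⟩⟩
  | cons b l ih =>
    have e := Submodule.quotOfListConsSMulTopEquivQuotSMulTopInner M b l
    change _ ∧ IsRegularSeqAt P (l ++ [a]) _ ↔ (_ ∧ IsRegularSeqAt P l _) ∧ _
    rw [ih]
    exact ⟨fun h => ⟨⟨h.1, h.2.1⟩, h.2.2.congr e.symm⟩, fun h => ⟨h.1.1, h.1.2, h.2.congr e⟩⟩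

theorem Ideal.IsPrime.exists_notMem_forall_smul_mem (hP : P.IsPrime) {I : Ideal R} (hI : I.FG)
    (W : Submodule R M) (n : M) (h : ∀ q ∈ I, ∃ t ∉ P, t • q • n ∈ W) :
    ∃ t ∉ P, ∀ q ∈ I, t • q • n ∈ W := by
  classical
  obtain ⟨S, rfl⟩ := hI
  have h' : ∀ q : S, ∃ t ∉ P, t • (q : R) • n ∈ W := fun q => h q (Ideal.subset_span q.2)
  choose t ht htW using h'
  refine ⟨∏ q, t q, fun hmem => ?_, fun q hq => ?_⟩
  · obtain ⟨q, -, hq⟩ := hP.prod_mem_iff.1 hmem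
    exact ht q hq
  · have hle : Ideal.span (S : Set R) ≤
        W.comap ((∏ q, t q) • (LinearMap.toSpanSingleton R M n)) := by
      refine Ideal.span_le.2 fun q hq => ?_
      change (∏ q, t q) • q • n ∈ W
      rw [← Finset.prod_erase_mul _ _ (Finset.mem_univ ⟨q, hq⟩), mul_smul]
      exact W.smul_mem _ (htW ⟨q, hq⟩)
    exact hle hq

/-- If the sequence `a, b` is regular on `M` at `P`, then `a` is regular on `M ⧸ b M` at `P`. -/
theorem IsRegularElemAt.quotSMulTop_swap (hP : P.IsPrime)
    (hab : IsRegularElemAt P b (QuotSMulTop a M)) (ha : IsRegularElemAt P a M) :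
    IsRegularElemAt P a (QuotSMulTop b M) := by
  intro m
  obtain ⟨m, rfl⟩ := Submodule.Quotient.mk_surjective _ m
  intro hm
  rw [← Submodule.Quotient.mk_smul, Submodule.Quotient.mk_eq_zero,
    Submodule.mem_smul_pointwise_iff_exists] at hm
  obtain ⟨n, -, hn⟩ := hm
  obtain ⟨s, hs, hsn⟩ := hab (Submodule.Quotient.mk n) (by
    rw [← Submodule.Quotient.mk_smul, Submodule.Quotient.mk_eq_zero, hn]
    exact Submodule.smul_mem_pointwise_smul _ _ _ trivial)
  rw [← Submodule.Quotient.mk_smul, Submodule.Quotient.mk_eq_zero,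
    Submodule.mem_smul_pointwise_iff_exists] at hsn
  obtain ⟨n', -, hn'⟩ := hsn
  obtain ⟨t, ht, htn⟩ := ha (s • m - b • n') (by
    rw [smul_sub, smul_comm a s, ← hn, smul_comm a b, hn', smul_comm s b, sub_self])
  refine ⟨t * s, hP.mul_notMem ht hs, ?_⟩
  rw [← Submodule.Quotient.mk_smul, Submodule.Quotient.mk_eq_zero]
  rw [smul_sub, sub_eq_zero, smul_smul, smul_comm t b] at htn
  rw [htn]
  exact Submodule.smul_mem_pointwise_smul _ _ _ trivial

/-- `(M ⧸ a M) ⧸ b (M ⧸ a M)` does not depend on the order of `a` and `b`. -/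
noncomputable def QuotSMulTop.swap (a b : R) (M : Type*) [AddCommGroup M] [Module R M] :
    QuotSMulTop b (QuotSMulTop a M) ≃ₗ[R] QuotSMulTop a (QuotSMulTop b M) :=
  (Submodule.quotEquivOfEq _ _ (by
      rw [Submodule.map_pointwise_smul, Submodule.map_top, Submodule.range_mkQ])) ≪≫ₗ
    Submodule.quotientQuotientEquivQuotientSup (a • ⊤) (b • ⊤) ≪≫ₗ
    Submodule.quotEquivOfEq _ _ (sup_comm _ _) ≪≫ₗ
    (Submodule.quotientQuotientEquivQuotientSup (b • ⊤) (a • ⊤)).symm ≪≫ₗ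
    (Submodule.quotEquivOfEq _ _ (by
      rw [Submodule.map_pointwise_smul, Submodule.map_top, Submodule.range_mkQ]))

theorem exists_mem_forall_notMem_of_finite {S : Set (Ideal R)} (hS : S.Finite)
    (hSp : ∀ Q ∈ S, Q.IsPrime) : ∃ z ∈ P, ∀ Q ∈ S, Q ≤ P → Q ≠ P → z ∉ Q := by
  by_contra! h
  have hfin : {Q | Q ∈ S ∧ Q ≤ P ∧ Q ≠ P}.Finite := hS.subset fun Q hQ => hQ.1
  obtain ⟨Q, hQ, hle⟩ := (Ideal.subset_union_prime_finite hfin (f := id) (I := P) 0 0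
    fun Q hQ _ _ => hSp Q hQ.1).1 fun z hz => by
      obtain ⟨Q, hQ, hQP, hne, hzQ⟩ := h z hz
      exact Set.mem_biUnion (x := Q) ⟨hQ, hQP, hne⟩ hzQ
  exact hQ.2.2 (hQ.2.1.antisymm hle)

theorem mem_support_quotient_ofList_iff [Module.Finite R M] {p : PrimeSpectrum R} :
    p ∈ Module.support R (M ⧸ (Ideal.ofList l • ⊤ : Submodule R M)) ↔
      p ∈ Module.support R M ∧ ∀ a ∈ l, a ∈ p.asIdeal := by
  rw [Module.support_quotient, PrimeSpectrum.zeroLocus_span]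
  rfl

variable [IsNoetherianRing R]

theorem exists_mem_associatedPrimes_le (hP : P.IsPrime) (m : M)
    (h : ∀ s ∉ P, s • m ≠ 0) :
    ∃ Q ∈ associatedPrimes R M, (∀ s, s • m = 0 → s ∈ Q) ∧ Q ≤ P := by
  have hle : Module.annihilator R (R ∙ m) ≤ P := fun s hs => by
    by_contra hsP
    exact h s hsP ((Submodule.mem_annihilator_span_singleton m s).1 hs)
  obtain ⟨Q, hQ, hQP⟩ := Ideal.exists_minimalPrimes_le hle
  refine ⟨Q, associatedPrimes.subset_of_injective (R ∙ m).injective_subtype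
    (Module.associatedPrimes.minimalPrimes_annihilator_subset_associatedPrimes R _ hQ),
    fun s hs => hQ.1.2 ((Submodule.mem_annihilator_span_singleton m s).2 hs), hQP⟩

theorem isRegularElemAt_iff (hP : P.IsPrime) :
    IsRegularElemAt P a M ↔ ∀ Q ∈ associatedPrimes R M, Q ≤ P → a ∉ Q := by
  constructor
  · intro h Q hQ hQP ha
    obtain ⟨-, x, rfl⟩ := isAssociatedPrime_iff.1 hQ
    obtain ⟨s, hs, hsx⟩ := h x (by simpa [Submodule.mem_colon_singleton] using ha)
    exact hs (hQP (by simpa [Submodule.mem_colon_singleton] using hsx))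
  · intro h m hm
    by_contra! hc
    obtain ⟨Q, hQ, hmQ, hQP⟩ := exists_mem_associatedPrimes_le hP m hc
    exact h Q hQ hQP (hmQ a hm)

theorem exists_smul_eq_zero_of_mem_associatedPrimes (hQ : Q ∈ associatedPrimes R M) :
    ∃ x : M, ∀ s, s • x = 0 ↔ s ∈ Q := by
  obtain ⟨-, x, rfl⟩ := isAssociatedPrime_iff.1 hQ
  exact ⟨x, fun s => by simp [Submodule.mem_colon_singleton]⟩

theorem mem_support_of_mem_associatedPrimes (hQ : Q ∈ associatedPrimes R M) :
    (⟨Q, hQ.1⟩ : PrimeSpectrum R) ∈ Module.support R M := by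
  obtain ⟨x, hx⟩ := exists_smul_eq_zero_of_mem_associatedPrimes hQ
  exact Module.mem_support_iff'.2 ⟨x, fun r hr h0 => hr ((hx r).1 h0)⟩

theorem mem_of_mem_associatedPrimes_quotSMulTop
    (hQ : Q ∈ associatedPrimes R (QuotSMulTop a M)) : a ∈ Q := by
  obtain ⟨x, hx⟩ := exists_smul_eq_zero_of_mem_associatedPrimes hQ
  exact (hx a).1 (Module.mem_annihilator.1 (QuotSMulTop.mem_annihilator M a) x)

theorem exists_mem_associatedPrimes_quotSMulTop_s3 [Module.Finite R M] (hP : P.IsPrime) (haP : a ∈ P)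
    (ha : IsRegularElemAt P a M) (hQ : Q ∈ associatedPrimes R M) (hQP : Q ≤ P) :
    ∃ Q' ∈ associatedPrimes R (QuotSMulTop a M), Q ≤ Q' ∧ Q' ≤ P := by
  obtain ⟨x, hx⟩ := exists_smul_eq_zero_of_mem_associatedPrimes hQ
  let W : Submodule R M := Submodule.torsionBySet R M Q
  have hW : ∀ m : M, m ∈ W ↔ ∀ q ∈ Q, q • m = 0 := fun m => by
    simp [W, Submodule.mem_torsionBySet_iff]
  have hsupp : (⟨P, hP⟩ : PrimeSpectrum R) ∈ Module.support R (QuotSMulTop a W) := by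
    rw [Module.support_quotSMulTop]
    refine ⟨Module.mem_support_iff'.2 ⟨⟨x, (hW x).2 fun q hq => (hx q).2 hq⟩, ?_⟩, by simpa⟩
    intro r hr h0
    exact hr (hQP ((hx r).1 (congrArg Subtype.val h0)))
  obtain ⟨w, hw⟩ := Module.mem_support_iff'.1 hsupp
  obtain ⟨w, rfl⟩ := Submodule.Quotient.mk_surjective _ w
  obtain ⟨Q', hQ', hwQ', hQ'P⟩ := exists_mem_associatedPrimes_le (M := QuotSMulTop a M) hP
    (Submodule.Quotient.mk w.1) (fun s hs h0 => by
      rw [← Submodule.Quotient.mk_smul, Submodule.Quotient.mk_eq_zero,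
        Submodule.mem_smul_pointwise_iff_exists] at h0
      obtain ⟨n, -, hn⟩ := h0
      obtain ⟨t, ht, htn⟩ := hP.exists_notMem_forall_smul_mem (IsNoetherian.noetherian Q)
        (⊥ : Submodule R M) n (fun q hq => by
          simp only [Submodule.mem_bot]
          refine ha _ ?_
          rw [smul_comm, hn, smul_comm, (hW _).1 w.2 q hq, smul_zero])
      refine hw (t * s) (hP.mul_notMem ht hs) ?_
      rw [← Submodule.Quotient.mk_smul, Submodule.Quotient.mk_eq_zero,
        Submodule.mem_smul_pointwise_iff_exists]
      refine ⟨⟨t • n, (hW _).2 fun q hq => ?_⟩, trivial, Subtype.ext ?_⟩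
      · rw [smul_comm]
        simpa using htn q hq
      · change a • t • n = (t * s) • w.1
        rw [smul_comm, hn, smul_smul])
  refine ⟨Q', hQ', fun q hq => hwQ' q ?_, hQ'P⟩
  rw [← Submodule.Quotient.mk_smul, (hW _).1 w.2 q hq, Submodule.Quotient.mk_zero]

theorem mem_associatedPrimes_quotSMulTop_of_minimal [Module.Finite R M]
    (hQ : Q ∈ associatedPrimes R M) (haQ : a ∈ Q)
    (hmin : ∀ Q' ∈ associatedPrimes R M, a ∈ Q' → Q' ≤ Q → Q ≤ Q') :
    Q ∈ associatedPrimes R (QuotSMulTop a M) := by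
  obtain ⟨x, hx⟩ := exists_smul_eq_zero_of_mem_associatedPrimes hQ
  let K : Submodule R M := Submodule.torsion' R M (Submonoid.powers a)
  have hK : ∀ m : M, m ∈ K ↔ ∃ n : ℕ, a ^ n • m = 0 := fun m => by
    refine Iff.trans (Submodule.mem_torsion'_iff _ _) ⟨?_, ?_⟩
    · rintro ⟨⟨_, n, rfl⟩, h⟩
      exact ⟨n, h⟩
    · rintro ⟨n, h⟩
      exact ⟨⟨_, n, rfl⟩, h⟩
  have hsupp : (⟨Q, hQ.1⟩ : PrimeSpectrum R) ∈ Module.support R (QuotSMulTop a K) := by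
    rw [Module.support_quotSMulTop]
    refine ⟨Module.mem_support_iff'.2
      ⟨⟨x, (hK x).2 ⟨1, by rw [pow_one]; exact (hx a).2 haQ⟩⟩, ?_⟩, by simpa⟩
    intro r hr h0
    exact hr ((hx r).1 (congrArg Subtype.val h0))
  obtain ⟨w, hw⟩ := Module.mem_support_iff'.1 hsupp
  obtain ⟨Q', hQ', hwQ', hQ'Q⟩ := exists_mem_associatedPrimes_le hQ.1 w hw
  have hQ's : (⟨Q', hQ'.1⟩ : PrimeSpectrum R) ∈ Module.support R K := by
    obtain ⟨y, hy⟩ := exists_smul_eq_zero_of_mem_associatedPrimes hQ'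
    have : (⟨Q', hQ'.1⟩ : PrimeSpectrum R) ∈ Module.support R (QuotSMulTop a K) :=
      Module.mem_support_iff'.2 ⟨y, fun r hr h0 => hr ((hy r).1 h0)⟩
    rw [Module.support_quotSMulTop] at this
    exact this.1
  obtain ⟨k, hk⟩ := Module.mem_support_iff'.1 hQ's
  obtain ⟨Q₁, hQ₁, hkQ₁, hQ₁Q'⟩ := exists_mem_associatedPrimes_le hQ'.1 k hk
  have haQ₁ : a ∈ Q₁ := by
    obtain ⟨n, hn⟩ := (hK _).1 k.2
    exact hQ₁.1.mem_of_pow_mem n (hkQ₁ _ (Subtype.ext hn))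
  have hQQ₁ := hmin Q₁ (associatedPrimes.subset_of_injective K.injective_subtype hQ₁) haQ₁
    (hQ₁Q'.trans hQ'Q)
  obtain rfl : Q' = Q := hQ'Q.antisymm (hQQ₁.trans hQ₁Q')
  refine associatedPrimes.subset_of_injective (f := QuotSMulTop.map a K.subtype) ?_ hQ'
  rw [injective_iff_map_eq_zero]
  intro k hk
  obtain ⟨k, rfl⟩ := Submodule.Quotient.mk_surjective _ k
  have hk' : (Submodule.Quotient.mk k.1 : QuotSMulTop a M) = 0 := hk
  rw [Submodule.Quotient.mk_eq_zero, Submodule.mem_smul_pointwise_iff_exists] at hk' ⊢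
  obtain ⟨m, -, hm⟩ := hk'
  obtain ⟨n, hn⟩ := (hK _).1 k.2
  refine ⟨⟨m, (hK _).2 ⟨n + 1, ?_⟩⟩, trivial, Subtype.ext hm⟩
  rw [pow_succ, mul_smul, hm, hn]

theorem IsRegularSeqAt.exists_mem_associatedPrimes [Module.Finite R M] (hP : P.IsPrime)
    (hlP : ∀ a ∈ l, a ∈ P) (hl : IsRegularSeqAt P l M) (hQ : Q ∈ associatedPrimes R M)
    (hQP : Q ≤ P) :
    ∃ Q' ∈ associatedPrimes R (M ⧸ (Ideal.ofList l • ⊤ : Submodule R M)), Q ≤ Q' ∧ Q' ≤ P := by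
  induction l generalizing M Q with
  | nil =>
    refine ⟨Q, ?_, le_rfl, hQP⟩
    rwa [LinearEquiv.AssociatedPrimes.eq (Submodule.quotEquivOfEqBot _
      (by rw [Ideal.ofList_nil, Submodule.bot_smul]))]
  | cons a l ih =>
    obtain ⟨Q₁, hQ₁, hQQ₁, hQ₁P⟩ :=
      exists_mem_associatedPrimes_quotSMulTop_s3 hP (hlP a (by simp)) hl.1 hQ hQP
    obtain ⟨Q₂, hQ₂, hQ₁₂, hQ₂P⟩ := ih (fun b hb => hlP b (by simp [hb])) hl.2 hQ₁ hQ₁P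
    refine ⟨Q₂, ?_, hQQ₁.trans hQ₁₂, hQ₂P⟩
    rwa [LinearEquiv.AssociatedPrimes.eq
      (Submodule.quotOfListConsSMulTopEquivQuotSMulTopInner M a l)]

/-- Regularity of a sequence at `P` can be tested at the associated primes below `P` of the quotient
by that sequence. -/
theorem isRegularSeqAt_of_forall_associatedPrimes [Module.Finite R M] (hP : P.IsPrime)
    (hlP : ∀ a ∈ l, a ∈ P)
    (h : ∀ Q ∈ associatedPrimes R (M ⧸ (Ideal.ofList l • ⊤ : Submodule R M)), Q ≤ P →
      IsRegularSeqAt Q l M) : IsRegularSeqAt P l M := by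
  induction l generalizing M with
  | nil => trivial
  | cons a l ih =>
    have hlP' : ∀ b ∈ l, b ∈ P := fun b hb => hlP b (by simp [hb])
    rw [LinearEquiv.AssociatedPrimes.eq
      (Submodule.quotOfListConsSMulTopEquivQuotSMulTopInner M a l)] at h
    have hl := ih hlP' fun Q hQ hQP => (h Q hQ hQP).2
    refine ⟨(isRegularElemAt_iff hP).2 fun Q hQ hQP haQ => ?_, hl⟩
    have hfin : {Q | Q ∈ associatedPrimes R M ∧ Q ≤ P ∧ a ∈ Q}.Finite :=
      (associatedPrimes.finite R M).subset fun Q hQ => hQ.1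
    obtain ⟨Q₀, hQ₀⟩ := hfin.exists_minimal ⟨Q, hQ, hQP, haQ⟩
    have hQ₀' := mem_associatedPrimes_quotSMulTop_of_minimal hQ₀.1.1 hQ₀.1.2.2
      fun Q' hQ' haQ' hle => hQ₀.2 ⟨hQ', hle.trans hQ₀.1.2.1, haQ'⟩ hle
    obtain ⟨Q', hQ', hle, hQ'P⟩ := hl.exists_mem_associatedPrimes hP hlP' hQ₀' hQ₀.1.2.1
    have hQ'p : Q'.IsPrime := hQ'.1
    exact (isRegularElemAt_iff hQ'p).1 (h Q' hQ' hQ'P).1 Q₀ hQ₀.1.1 hle hQ₀.1.2.2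

theorem mem_associatedPrimes_iff_exists (hP : P.IsPrime) :
    P ∈ associatedPrimes R M ↔ ∃ m : M, (∀ p ∈ P, p • m = 0) ∧ ∀ s ∉ P, s • m ≠ 0 := by
  constructor
  · intro h
    obtain ⟨x, hx⟩ := exists_smul_eq_zero_of_mem_associatedPrimes h
    exact ⟨x, fun p hp => (hx p).2 hp, fun s hs h0 => hs ((hx s).1 h0)⟩
  · rintro ⟨m, hm, hs⟩
    obtain ⟨Q, hQ, hmQ, hQP⟩ := exists_mem_associatedPrimes_le hP m hs
    rwa [hQP.antisymm fun p hp => hmQ p (hm p hp)] at hQ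

theorem mem_associatedPrimes_quotSMulTop_of_isRegularElemAt (hP : P.IsPrime)
    (ha : IsRegularElemAt P a M) (hb : IsRegularElemAt P b M) (hbP : b ∈ P)
    (h : P ∈ associatedPrimes R (QuotSMulTop a M)) :
    P ∈ associatedPrimes R (QuotSMulTop b M) := by
  obtain ⟨n, hPn, hn⟩ := (mem_associatedPrimes_iff_exists hP).1 h
  obtain ⟨n, rfl⟩ := Submodule.Quotient.mk_surjective _ n
  simp only [← Submodule.Quotient.mk_smul, Submodule.Quotient.mk_eq_zero, ne_eq,
    Submodule.mem_smul_pointwise_iff_exists, Submodule.mem_top, true_and] at hPn hn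
  obtain ⟨n', hn'⟩ := hPn b hbP
  obtain ⟨t, ht, htP⟩ := hP.exists_notMem_forall_smul_mem (IsNoetherian.noetherian P)
    (b • (⊤ : Submodule R M)) n' (fun p hp => by
      obtain ⟨u, hu⟩ := hPn p hp
      obtain ⟨t, ht, htu⟩ := ha (p • n' - b • u) (by
        rw [smul_sub, smul_comm a p, hn', smul_comm a b, hu, smul_comm b p, sub_self])
      refine ⟨t, ht, ?_⟩
      rw [smul_sub, sub_eq_zero, smul_comm t b] at htu
      rw [htu]
      exact Submodule.smul_mem_pointwise_smul _ _ _ trivial)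
  refine (mem_associatedPrimes_iff_exists hP).2 ⟨Submodule.Quotient.mk (t • n'), ?_, ?_⟩
  · intro p hp
    rw [← Submodule.Quotient.mk_smul, Submodule.Quotient.mk_eq_zero, smul_comm]
    exact htP p hp
  · intro s hs h0
    rw [← Submodule.Quotient.mk_smul, Submodule.Quotient.mk_eq_zero,
      Submodule.mem_smul_pointwise_iff_exists] at h0
    obtain ⟨v, -, hv⟩ := h0
    obtain ⟨r, hr, hr0⟩ := hb (s • t • n - a • v) (by
      rw [smul_sub, smul_comm b a, hv, smul_comm a s, smul_comm a t, hn', smul_comm b s,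
        smul_comm b t, sub_self])
    refine hn (r * (s * t)) (hP.mul_notMem hr (hP.mul_notMem hs ht)) ⟨r • v, ?_⟩
    rw [smul_sub, sub_eq_zero] at hr0
    rw [smul_comm, ← hr0, mul_smul, mul_smul]

/-- Cutting by an element regular at `P` drops the depth at `P` by at most one. -/
theorem exists_isRegularSeqAt_quotSMulTop [Module.Finite R M] (hP : P.IsPrime) (n : ℕ)
    (haP : a ∈ P) (ha : IsRegularElemAt P a M)
    (h : ∃ l : List R, l.length = n + 1 ∧ (∀ b ∈ l, b ∈ P) ∧ IsRegularSeqAt P l M) :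
    ∃ l : List R, l.length = n ∧ (∀ b ∈ l, b ∈ P) ∧ IsRegularSeqAt P l (QuotSMulTop a M) := by
  induction n generalizing M a with
  | zero => exact ⟨[], rfl, by simp, trivial⟩
  | succ n ih =>
    obtain ⟨_ | ⟨y, _ | ⟨y', l⟩⟩, hlen, hlP, hl⟩ := h
    · simp at hlen
    · simp at hlen
    have hyP : y ∈ P := hlP y (by simp)
    have hy : IsRegularElemAt P y M := hl.1
    have hPy : P ∉ associatedPrimes R (QuotSMulTop y M) := fun hmem =>
      (isRegularElemAt_iff hP).1 hl.2.1 P hmem le_rfl (hlP y' (by simp))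
    have hPa : P ∉ associatedPrimes R (QuotSMulTop a M) := fun hmem =>
      hPy (mem_associatedPrimes_quotSMulTop_of_isRegularElemAt hP ha hy hyP hmem)
    have hPM : P ∉ associatedPrimes R M := fun hmem =>
      (isRegularElemAt_iff hP).1 ha P hmem le_rfl haP
    obtain ⟨z, hzP, hz⟩ := exists_mem_forall_notMem_of_finite
      (((associatedPrimes.finite R M).union (associatedPrimes.finite R (QuotSMulTop a M))).union
        (associatedPrimes.finite R (QuotSMulTop y M)))
      (by rintro Q ((hQ | hQ) | hQ) <;> exact hQ.1)
    have hzM : IsRegularElemAt P z M := (isRegularElemAt_iff hP).2 fun Q hQ hle =>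
      hz Q (.inl (.inl hQ)) hle fun h => hPM (h ▸ hQ)
    have hza : IsRegularElemAt P z (QuotSMulTop a M) := (isRegularElemAt_iff hP).2 fun Q hQ hle =>
      hz Q (.inl (.inr hQ)) hle fun h => hPa (h ▸ hQ)
    have hzy : IsRegularElemAt P z (QuotSMulTop y M) := (isRegularElemAt_iff hP).2 fun Q hQ hle =>
      hz Q (.inr hQ) hle fun h => hPy (h ▸ hQ)
    obtain ⟨l₁, hlen₁, hl₁P, hl₁⟩ := ih hzP hzy
      ⟨y' :: l, by simpa using hlen, fun b hb => hlP b (List.mem_cons_of_mem _ hb), hl.2⟩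
    obtain ⟨l₂, hlen₂, hl₂P, hl₂⟩ := ih haP (IsRegularElemAt.quotSMulTop_swap hP hza ha)
      ⟨y :: l₁, by simpa using hlen₁, by simpa [hyP] using hl₁P,
        IsRegularElemAt.quotSMulTop_swap hP hzy hy, hl₁.congr (QuotSMulTop.swap y z M)⟩
    exact ⟨z :: l₂, by simpa using hlen₂, by simpa [hzP] using hl₂P, hza,
      hl₂.congr (QuotSMulTop.swap z a M)⟩

end Regular

section QuotDim

variable {R : Type*} [CommRing R] {P Q : Ideal R} {a : R}

/-- The dimension of `R ⧸ P` as a natural number. -/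
noncomputable def Ideal.quotDim (P : Ideal R) : ℕ := ((ringKrullDim (R ⧸ P)).unbotD 0).toNat

theorem PrimeSpectrum.ringKrullDim_quotient_eq_coheight (p : PrimeSpectrum R) :
    ringKrullDim (R ⧸ p.asIdeal) = Order.coheight p := by
  rw [ringKrullDim_quotient, Order.coheight_eq_krullDim_Ici]
  rfl

variable [IsLocalRing R] [IsNoetherianRing R]

theorem PrimeSpectrum.coheight_eq_quotDim (p : PrimeSpectrum R) :
    Order.coheight p = p.asIdeal.quotDim := by
  rw [Ideal.quotDim, p.ringKrullDim_quotient_eq_coheight, WithBot.unbotD_coe,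
    ENat.natCast_toNat (Order.coheight_lt_top p).ne]

theorem Ideal.IsPrime.ringKrullDim_quotient_eq_quotDim (hP : P.IsPrime) :
    ringKrullDim (R ⧸ P) = (P.quotDim : ℕ) := by
  rw [PrimeSpectrum.ringKrullDim_quotient_eq_coheight ⟨P, hP⟩, PrimeSpectrum.coheight_eq_quotDim]
  rfl

theorem Ideal.IsPrime.quotDim_lt (hP : P.IsPrime) (hQ : Q.IsPrime) (h : P < Q) :
    Q.quotDim < P.quotDim := by
  have := Order.coheight_strictAnti (x := (⟨Q, hQ⟩ : PrimeSpectrum R)) (y := ⟨P, hP⟩) h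
    (Order.coheight_lt_top _)
  simpa [PrimeSpectrum.coheight_eq_quotDim] using this

theorem IsLocalRing.quotDim_maximalIdeal : (maximalIdeal R).quotDim = 0 := by
  have h := (maximalIdeal.isMaximal R).isPrime.ringKrullDim_quotient_eq_quotDim
  rw [ringKrullDim_eq_zero_of_isField
    ((Ideal.Quotient.maximal_ideal_iff_isField_quotient _).1 inferInstance)] at h
  exact_mod_cast h.symm

theorem Ideal.IsPrime.exists_ge_quotDim_le_succ (hP : P.IsPrime) (ha : a ∈ maximalIdeal R) :
    ∃ P' : Ideal R, P'.IsPrime ∧ P ≤ P' ∧ a ∈ P' ∧ P.quotDim ≤ P'.quotDim + 1 := by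
  rcases h : P.quotDim with _ | n
  · exact ⟨maximalIdeal R, inferInstance, le_maximalIdeal hP.ne_top, ha, Nat.zero_le _⟩
  have hle := Module.supportDim_le_supportDim_quotSMulTop_succ (M := R ⧸ P) ha
  rw [Module.supportDim_quotient_eq_ringKrullDim, hP.ringKrullDim_quotient_eq_quotDim, h] at hle
  have hn : (n : WithBot ℕ∞) ≤ Order.krullDim (Module.support R (QuotSMulTop a (R ⧸ P))) := by
    push_cast at hle
    exact ENat.WithBot.add_le_add_one_right_iff.1 hle
  obtain ⟨s, hs⟩ := Order.le_krullDim_iff.1 hn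
  have hmem := (Module.support_quotSMulTop (M := R ⧸ P) a).subset s.head.2
  rw [Module.support_eq_zeroLocus, Ideal.annihilator_quotient] at hmem
  refine ⟨s.head.1.asIdeal, s.head.1.2, hmem.1, by simpa using hmem.2, ?_⟩
  have hlen : (s.length : ℕ∞) ≤ Order.coheight s.head.1 :=
    Order.length_le_coheight (p := s.map Subtype.val (Subtype.strictMono_coe _)) le_rfl
  rw [PrimeSpectrum.coheight_eq_quotDim, hs, Nat.cast_le] at hlen
  lia

theorem Ideal.IsPrime.exists_ge_quotDim_le_add_length (hP : P.IsPrime) (l : List R)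
    (hl : ∀ a ∈ l, a ∈ maximalIdeal R) :
    ∃ P' : Ideal R, P'.IsPrime ∧ P ≤ P' ∧ (∀ a ∈ l, a ∈ P') ∧
      P.quotDim ≤ P'.quotDim + l.length := by
  induction l generalizing P with
  | nil => exact ⟨P, hP, le_rfl, by simp, le_rfl⟩
  | cons a l ih =>
    obtain ⟨P₁, hP₁, hle, haP₁, h₁⟩ := hP.exists_ge_quotDim_le_succ (hl a (by simp))
    obtain ⟨P₂, hP₂, hle₂, hlP₂, h₂⟩ := ih hP₁ fun b hb => hl b (by simp [hb])
    refine ⟨P₂, hP₂, hle.trans hle₂, ?_, by rw [List.length_cons]; lia⟩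
    simpa [hle₂ haP₁] using hlP₂

theorem eq_maximalIdeal_of_isFiniteLength {M : Type*} [AddCommGroup M] [Module R M]
    (h : IsFiniteLength R M) (p : PrimeSpectrum R) (hp : p ∈ Module.support R M) :
    p.asIdeal = maximalIdeal R := by
  obtain ⟨m, hm⟩ := Module.mem_support_iff'.1 hp
  obtain ⟨Q, hQ, -, hQp⟩ := exists_mem_associatedPrimes_le p.2 m hm
  obtain ⟨x, hx⟩ := exists_smul_eq_zero_of_mem_associatedPrimes hQ
  have hker : Q = LinearMap.ker (LinearMap.toSpanSingleton R M x) := by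
    ext s
    simp [hx]
  have := (isFiniteLength_iff_isNoetherian_isArtinian.1 h).2
  have hart : IsArtinian R (R ⧸ Q) := by
    rw [hker]
    exact isArtinian_of_injective _
      (LinearMap.toSpanSingleton R M x).quotKerEquivRange.injective
  have hart' : IsArtinianRing (R ⧸ Q) := isArtinian_of_tower R hart
  have := hQ.1
  have hmax : Q.IsMaximal :=
    Ideal.Quotient.maximal_of_isField _ (IsArtinianRing.isField_of_isDomain _)
  rw [← hmax.eq_of_le p.2.ne_top hQp, IsLocalRing.eq_maximalIdeal hmax]

variable {M : Type*} [AddCommGroup M] [Module R M] [Module.Finite R M] {l l' : List R}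

theorem IsRegularSeqAt.quotDim_add_length_le (hP : P.IsPrime) (hlP : ∀ a ∈ l, a ∈ P)
    (hl : IsRegularSeqAt P l M) (hQ : Q ∈ associatedPrimes R M) (hQP : Q ≤ P) :
    P.quotDim + l.length ≤ Q.quotDim := by
  induction l generalizing M Q with
  | nil =>
    rcases hQP.eq_or_lt with rfl | h
    · simp
    · simpa using (hQ.1.quotDim_lt hP h).le
  | cons a l ih =>
    have haP := hlP a (by simp)
    obtain ⟨Q', hQ', hle, hQ'P⟩ := exists_mem_associatedPrimes_quotSMulTop_s3 hP haP hl.1 hQ hQP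
    have hlt : Q < Q' := hle.lt_of_not_ge fun h =>
      (isRegularElemAt_iff hP).1 hl.1 Q hQ hQP (h (mem_of_mem_associatedPrimes_quotSMulTop hQ'))
    have h₁ := ih (fun b hb => hlP b (by simp [hb])) hl.2 hQ' hQ'P
    have h₂ := hQ.1.quotDim_lt hQ'.1 hlt
    rw [List.length_cons]
    lia

/-- A sequence that cuts down dimensions at `P` as much as possible is regular at `P` as soon as
the depth of `M` at `P` is at least its length. -/
theorem isRegularSeqAt_of_exists_of_quotDim_le (hP : P.IsPrime) (hlP : ∀ a ∈ l, a ∈ P)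
    (h : ∃ l' : List R, l'.length = l.length ∧ (∀ b ∈ l', b ∈ P) ∧ IsRegularSeqAt P l' M)
    (hdim : ∀ k ≤ l.length, ∀ q ∈ Module.support R M, q.asIdeal ≤ P →
      (∀ b ∈ l.take k, b ∈ q.asIdeal) → q.asIdeal.quotDim + k ≤ P.quotDim + l.length) :
    IsRegularSeqAt P l M := by
  induction l generalizing M with
  | nil => trivial
  | cons a l ih =>
    have haP := hlP a (by simp)
    have ha : IsRegularElemAt P a M := (isRegularElemAt_iff hP).2 fun Q hQ hQP haQ => by
      obtain ⟨l', hlen, hl'P, hl'⟩ := h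
      have h₁ := hl'.quotDim_add_length_le hP hl'P hQ hQP
      have h₂ := hdim 1 (by simp) _ (mem_support_of_mem_associatedPrimes hQ) hQP (by simpa)
      rw [hlen] at h₁
      change Q.quotDim + 1 ≤ _ at h₂
      lia
    refine ⟨ha, ih (fun b hb => hlP b (by simp [hb]))
      (exists_isRegularSeqAt_quotSMulTop hP l.length haP ha h) fun k hk q hq hqP hqk => ?_⟩
    rw [Module.support_quotSMulTop] at hq
    have := hdim (k + 1) (by simpa) q hq.1 hqP (by simpa using ⟨by simpa using hq.2, hqk⟩)
    rw [List.length_cons] at this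
    lia

theorem isFiniteLength_of_forall_support
    (h : ∀ p ∈ Module.support R M, p.asIdeal = maximalIdeal R) : IsFiniteLength R M := by
  have hcomap : ∀ I : Ideal (R ⧸ Module.annihilator R M), I.IsPrime →
      I.comap (Ideal.Quotient.mk (Module.annihilator R M)) = maximalIdeal R := fun I hI =>
    h ⟨_, hI.comap _⟩ <| by
      rw [Module.support_eq_zeroLocus]
      intro s hs
      simp [Ideal.Quotient.eq_zero_iff_mem.2 hs]
  have : Ring.KrullDimLE 0 (R ⧸ Module.annihilator R M) := .mk₀ fun I hI => by
    obtain ⟨J, hJ, -⟩ := I.exists_le_maximal hI.ne_top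
    rwa [Ideal.comap_injective_of_surjective _ Ideal.Quotient.mk_surjective
      ((hcomap I hI).trans (hcomap J hJ.isPrime).symm)]
  have : IsArtinianRing (R ⧸ Module.annihilator R M) :=
    isArtinianRing_iff_krullDimLE_zero.2 this
  let _ : Module (R ⧸ Module.annihilator R M) M := Module.quotientAnnihilator
  have : IsScalarTower R (R ⧸ Module.annihilator R M) M :=
    Module.IsTorsionBySet.isScalarTower (Module.isTorsionBySet_annihilator R M)
  have : Module.Finite (R ⧸ Module.annihilator R M) M := .of_restrictScalars_finite R _ _
  have : IsArtinian R M := isArtinian_of_surjective_algebraMap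
    (R := R ⧸ Module.annihilator R M) Ideal.Quotient.mk_surjective
  exact isFiniteLength_iff_isNoetherian_isArtinian.2 ⟨inferInstance, this⟩

theorem quotDim_le_length_of_isFiniteLength
    (h : IsFiniteLength R (M ⧸ (Ideal.ofList (l ++ l') • ⊤ : Submodule R M)))
    (hl' : ∀ a ∈ l', a ∈ maximalIdeal R) {p : PrimeSpectrum R} (hp : p ∈ Module.support R M)
    (hlp : ∀ a ∈ l, a ∈ p.asIdeal) : p.asIdeal.quotDim ≤ l'.length := by
  obtain ⟨P', hP', hle, hl'P', hdim⟩ := p.2.exists_ge_quotDim_le_add_length l' hl'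
  have hmax := eq_maximalIdeal_of_isFiniteLength h ⟨P', hP'⟩ (mem_support_quotient_ofList_iff.2
    ⟨Module.mem_support_mono hle hp, fun a ha => ?_⟩)
  · dsimp only at hmax
    rwa [hmax, quotDim_maximalIdeal, zero_add] at hdim
  · rcases List.mem_append.1 ha with ha | ha
    exacts [hle (hlp a ha), hl'P' a ha]

section Sequence

variable {d r i : ℕ} {x y : ℕ → R}

theorem quotDim_add_le_of_isFiniteLength (hm : ∀ j < d, x j ∈ maximalIdeal R)
    (hx : IsFiniteLength R (M ⧸ (Ideal.ofList ((List.range d).map x) • ⊤ : Submodule R M)))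
    (hi : i ≤ d) {p : PrimeSpectrum R} (hp : p ∈ Module.support R M)
    (hxp : ∀ j < i, x j ∈ p.asIdeal) : p.asIdeal.quotDim + i ≤ d := by
  obtain ⟨k, rfl⟩ := Nat.exists_eq_add_of_le hi
  rw [List.range_add, List.map_append] at hx
  have := quotDim_le_length_of_isFiniteLength hx (by simpa using fun j hj => hm _ (by lia)) hp
    (by simpa using hxp)
  rw [List.length_map, List.length_map, List.length_range] at this
  lia

/-- The initial part of length `r` of a reducing system of parameters is a regular sequence at
those primes which contain it and have dimension at least `d - r`. -/
theorem isRegularSeqAt_of_reducing (hm : ∀ j < d, y j ∈ maximalIdeal R)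
    (hy : IsFiniteLength R (M ⧸ (Ideal.ofList ((List.range d).map y) • ⊤ : Submodule R M)))
    (hred : ∀ j < d - 1, ∀ Q ∈ associatedPrimes R
      (M ⧸ (Ideal.ofList ((List.range j).map y) • ⊤ : Submodule R M)),
      Q.quotDim = d - (j + 1) → y j ∉ Q)
    (hr : r < d) (hP : P.IsPrime) (hyP : ∀ j < r, y j ∈ P) (hdim : d ≤ P.quotDim + r) :
    IsRegularSeqAt P ((List.range r).map y) M := by
  induction r generalizing P with
  | zero => trivial
  | succ r ih =>
    have hyr : ∀ Q ∈ associatedPrimes R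
        (M ⧸ (Ideal.ofList ((List.range r).map y) • ⊤ : Submodule R M)), Q ≤ P →
        (∀ j < r, y j ∈ Q) ∧ y r ∉ Q := by
      intro Q hQ hQP
      have hQ' := mem_support_quotient_ofList_iff.1 (mem_support_of_mem_associatedPrimes hQ)
      have hyQ : ∀ j < r, y j ∈ Q := by simpa using hQ'.2
      refine ⟨hyQ, fun hrQ => hred r (by lia) Q hQ ?_ hrQ⟩
      have h₁ := quotDim_add_le_of_isFiniteLength hm hy hr.le hQ'.1
        (fun j hj => (Nat.lt_succ_iff_lt_or_eq.1 hj).elim (hyQ j) fun h => h ▸ hrQ)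
      have h₂ : P.quotDim ≤ Q.quotDim := by
        rcases hQP.eq_or_lt with rfl | h
        exacts [le_rfl, (hQ.1.quotDim_lt hP h).le]
      dsimp only at h₁
      lia
    rw [List.range_succ, List.map_append]
    refine isRegularSeqAt_append_singleton_iff.2
      ⟨isRegularSeqAt_of_forall_associatedPrimes hP ?_ fun Q hQ hQP => ?_,
        (isRegularElemAt_iff hP).2 fun Q hQ hQP => (hyr Q hQ hQP).2⟩
    · simpa using fun j hj => hyP j (Nat.lt_succ_of_lt hj)
    · have hlt := hQ.1.quotDim_lt hP
        (hQP.lt_of_not_ge fun h => (hyr Q hQ hQP).2 (h (hyP r r.lt_succ_self)))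
      exact ih (by lia) hQ.1 (hyr Q hQ hQP).1 (by lia)

theorem notMem_of_reducing_of_support_le (hxm : ∀ j < d, x j ∈ maximalIdeal R)
    (hx : IsFiniteLength R (M ⧸ (Ideal.ofList ((List.range d).map x) • ⊤ : Submodule R M)))
    (hym : ∀ j < d, y j ∈ maximalIdeal R)
    (hy : IsFiniteLength R (M ⧸ (Ideal.ofList ((List.range d).map y) • ⊤ : Submodule R M)))
    (hred : ∀ j < d - 1, ∀ Q ∈ associatedPrimes R
      (M ⧸ (Ideal.ofList ((List.range j).map y) • ⊤ : Submodule R M)),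
      Q.quotDim = d - (j + 1) → y j ∉ Q)
    (hr : r < d) (hsub : ∀ p ∈ Module.support R M,
      (∀ j < r, x j ∈ p.asIdeal) → ∀ j < r, y j ∈ p.asIdeal)
    (hi : i < r) (hP : P ∈ associatedPrimes R
      (M ⧸ (Ideal.ofList ((List.range i).map x) • ⊤ : Submodule R M)))
    (hdim : P.quotDim = d - (i + 1)) : x i ∉ P := by
  intro hxP
  obtain ⟨k, rfl⟩ := Nat.exists_eq_add_of_le (Nat.succ_le_of_lt hi)
  have hPM := mem_support_quotient_ofList_iff.1 (mem_support_of_mem_associatedPrimes hP)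
  obtain ⟨P', hP', hle, hxP', hdim'⟩ := hP.1.exists_ge_quotDim_le_add_length
    ((List.range k).map fun j => x (i + 1 + j)) (by simpa using fun j hj => hxm _ (by lia))
  rw [List.length_map, List.length_range] at hdim'
  have hP'M : (⟨P', hP'⟩ : PrimeSpectrum R) ∈ Module.support R M :=
    Module.mem_support_mono hle hPM.1
  have hmem : ∀ j < i + 1 + k, x j ∈ P' := by
    intro j hj
    rcases lt_trichotomy j i with h | rfl | h
    · exact hle (hPM.2 _ (List.mem_map_of_mem (List.mem_range.2 h)))
    · exact hle hxP
    · obtain ⟨j, rfl⟩ := Nat.exists_eq_add_of_le (Nat.succ_le_of_lt h)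
      exact hxP' _ (List.mem_map_of_mem (f := fun j => x (i + 1 + j)) (List.mem_range.2 (by lia)))
  have hreg : IsRegularSeqAt P' ((List.range (i + 1 + k)).map x) M := by
    have hyP' := hsub _ hP'M hmem
    refine isRegularSeqAt_of_exists_of_quotDim_le hP' (by simpa using hmem)
      ⟨(List.range (i + 1 + k)).map y, by simp, by simpa using hyP',
        isRegularSeqAt_of_reducing hym hy hred hr hP' hyP' (by lia)⟩ fun n hn q hq _ hxq => ?_
    rw [List.length_map, List.length_range] at hn ⊢
    have := quotDim_add_le_of_isFiniteLength hxm hx (hn.trans hr.le) hq (fun j hj => hxq _ (by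
      rw [← List.map_take, List.take_range, min_eq_left hn]
      exact List.mem_map_of_mem (List.mem_range.2 hj)))
    lia
  rw [List.range_add, List.map_append] at hreg
  have hreg' := hreg.of_append_left
  rw [List.range_succ, List.map_append] at hreg'
  exact (isRegularElemAt_iff hP').1 (isRegularSeqAt_append_singleton_iff.1 hreg').2 P hP hle hxP

theorem exists_extension_notMem_associatedPrimes (hm : ∀ j < d, y j ∈ maximalIdeal R)
    (hy : IsFiniteLength R (M ⧸ (Ideal.ofList ((List.range d).map y) • ⊤ : Submodule R M)))
    (hr : r ≤ d) :
    ∃ x : ℕ → R, (∀ j < r, x j = y j) ∧ (∀ j < d, x j ∈ maximalIdeal R) ∧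
      IsFiniteLength R (M ⧸ (Ideal.ofList ((List.range d).map x) • ⊤ : Submodule R M)) ∧
      ∀ j < d, r ≤ j → ∀ Q ∈ associatedPrimes R
        (M ⧸ (Ideal.ofList ((List.range j).map x) • ⊤ : Submodule R M)),
        Q ≠ maximalIdeal R → x j ∉ Q := by
  suffices H : ∀ n, r ≤ n → n ≤ d →
      ∃ x : ℕ → R, (∀ j < r, x j = y j) ∧ (∀ j < n, x j ∈ maximalIdeal R) ∧
        (∀ p ∈ Module.support R M, (∀ j < n, x j ∈ p.asIdeal) → p.asIdeal.quotDim + n ≤ d) ∧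
        ∀ j < n, r ≤ j → ∀ Q ∈ associatedPrimes R
          (M ⧸ (Ideal.ofList ((List.range j).map x) • ⊤ : Submodule R M)),
          Q ≠ maximalIdeal R → x j ∉ Q by
    obtain ⟨x, hxy, hxm, hdim, hx⟩ := H d hr le_rfl
    refine ⟨x, hxy, hxm, isFiniteLength_of_forall_support fun p hp => ?_, hx⟩
    rw [mem_support_quotient_ofList_iff] at hp
    have := hdim p hp.1 (by simpa using hp.2)
    by_contra hne
    have := p.2.quotDim_lt inferInstance ((le_maximalIdeal p.2.ne_top).lt_of_ne hne)
    lia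
  intro n hrn
  induction n, hrn using Nat.le_induction with
  | base =>
    exact fun _ => ⟨y, fun _ _ => rfl, fun j hj => hm j (by lia),
      fun p hp hyp => quotDim_add_le_of_isFiniteLength hm hy hr hp hyp, fun j hj hj' => by lia⟩
  | succ n hrn ih =>
    intro hn
    obtain ⟨x, hxy, hxm, hdim, hx⟩ := ih (by lia)
    obtain ⟨z, hz, hzQ⟩ := exists_mem_forall_notMem_of_finite (P := maximalIdeal R)
      (associatedPrimes.finite R
        (M ⧸ (Ideal.ofList ((List.range n).map x) • ⊤ : Submodule R M))) fun Q hQ => hQ.1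
    have hlt : ∀ j < n, Function.update x n z j = x j := fun j hj =>
      Function.update_of_ne hj.ne _ _
    have hlist : ∀ j ≤ n, (List.range j).map (Function.update x n z) = (List.range j).map x :=
      fun j hj => List.map_congr_left fun k hk => hlt k (by simp at hk; lia)
    refine ⟨Function.update x n z, fun j hj => ?_, fun j hj => ?_, fun p hp hxp => ?_,
      fun j hj hrj => ?_⟩
    · rw [hlt j (by lia), hxy j hj]
    · rcases Nat.lt_succ_iff_lt_or_eq.1 hj with h | rfl
      · rw [hlt j h]
        exact hxm j h
      · rwa [Function.update_self]
    · have hzp : z ∈ p.asIdeal := by simpa using hxp n n.lt_succ_self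
      have hxp' : ∀ j < n, x j ∈ p.asIdeal := fun j hj => hlt j hj ▸ hxp j (by lia)
      obtain ⟨m, hm⟩ := Module.mem_support_iff'.1 (mem_support_quotient_ofList_iff.2
        ⟨hp, (by simpa using hxp' : ∀ a ∈ (List.range n).map x, a ∈ p.asIdeal)⟩)
      obtain ⟨Q, hQ, -, hQp⟩ := exists_mem_associatedPrimes_le p.2 m hm
      have hQM := mem_support_quotient_ofList_iff.1 (mem_support_of_mem_associatedPrimes hQ)
      by_cases hne : Q = maximalIdeal R
      · rw [le_antisymm (le_maximalIdeal p.2.ne_top) (hne ▸ hQp), quotDim_maximalIdeal]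
        lia
      · have h₁ := hdim _ hQM.1 (by simpa using hQM.2)
        have h₂ := hQ.1.quotDim_lt p.2 (hQp.lt_of_not_ge fun h =>
          hzQ Q hQ (le_maximalIdeal hQ.1.ne_top) hne (h hzp))
        dsimp only at h₁
        lia
    · rw [hlist j (by lia)]
      rcases Nat.lt_succ_iff_lt_or_eq.1 hj with h | rfl
      · rw [hlt j h]
        exact hx j h hrj
      · rw [Function.update_self]
        exact fun Q hQ => hzQ Q hQ (le_maximalIdeal hQ.1.ne_top)

end Sequence

end QuotDim

section SystemOfParameters

variable {R M : Type*} [CommRing R] {d i : ℕ}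

theorem exists_eq_fin_restrict (x : Fin d → R) : ∃ z : ℕ → R, x = fun j : Fin d => z j :=
  ⟨fun j => if h : j < d then x ⟨j, h⟩ else 0, by ext j; simp⟩

theorem span_image_fin_eq_ofList (x : ℕ → R) (hi : i ≤ d) :
    Ideal.span ((fun j : Fin d => x j) '' {j : Fin d | (j : ℕ) < i}) =
      Ideal.ofList ((List.range i).map x) := by
  congr 1
  ext a
  simp only [Set.mem_image, Set.mem_ofPred_eq, List.mem_map, List.mem_range]
  exact ⟨fun ⟨j, hj, h⟩ => ⟨j, hj, h⟩, fun ⟨j, hj, h⟩ => ⟨⟨j, hj.trans_le hi⟩, hj, h⟩⟩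

variable [IsLocalRing R] [AddCommGroup M] [Module R M]

theorem isSoP_fin_restrict_iff (x : ℕ → R) :
    IsSoP R M (fun j : Fin d => x j) ↔ (∀ j < d, x j ∈ maximalIdeal R) ∧
      moduleDim R M = (d : ℕ) ∧
      IsFiniteLength R (M ⧸ (Ideal.ofList ((List.range d).map x) • ⊤ : Submodule R M)) := by
  have h : Set.range (fun j : Fin d => x j) =
      (fun j : Fin d => x j) '' {j : Fin d | (j : ℕ) < d} := by ext; simp
  rw [IsSoP, ← span_image_fin_eq_ofList x le_rfl, Fin.forall_iff, h]

theorem isReducingSoP_fin_restrict_iff [IsNoetherianRing R] (x : ℕ → R) :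
    IsReducingSoP R M (fun j : Fin d => x j) ↔ IsSoP R M (fun j : Fin d => x j) ∧
      ∀ j < d - 1, ∀ Q ∈ associatedPrimes R
        (M ⧸ (Ideal.ofList ((List.range j).map x) • ⊤ : Submodule R M)),
        Q.quotDim = d - (j + 1) → x j ∉ Q := by
  refine and_congr_right fun _ => ⟨fun h j hj Q hQ hdim => ?_, fun h j hj Q hQ hdim => ?_⟩
  · refine h ⟨j, by lia⟩ hj Q ?_ ?_
    · rwa [span_image_fin_eq_ofList x (by lia)]
    · rw [hQ.1.ringKrullDim_quotient_eq_quotDim, hdim]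
      rfl
  · rw [span_image_fin_eq_ofList x j.2.le] at hQ
    refine h j hj Q hQ ?_
    rw [hQ.1.ringKrullDim_quotient_eq_quotDim] at hdim
    exact Nat.cast_injective (R := WithBot ℕ∞) hdim

end SystemOfParameters

theorem stmt3 (R M : Type*) [CommRing R] [IsLocalRing R] [IsNoetherianRing R]
    [AddCommGroup M] [Module R M] [Module.Finite R M] [Nontrivial M]
    {d r : ℕ} (hd : moduleDim R M = (d : ℕ)) (hr : r < d)
    (x y : Fin r → R) (hx : IsPartSoP R M x) (hy : IsPartReducingSoP R M y)
    (hsub : ∀ P : PrimeSpectrum R, P ∈ Module.support R M →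
      (∀ i, x i ∈ P.asIdeal) → ∀ i, y i ∈ P.asIdeal) :
    IsPartReducingSoP R M x := by
  obtain ⟨d₁, hrd₁, u, hu, hux⟩ := hx
  obtain ⟨d₂, hrd₂, v, hv, hvy⟩ := hy
  obtain rfl : d₁ = d := by exact_mod_cast hu.2.1.symm.trans hd
  obtain rfl : d₂ = d₁ := by exact_mod_cast hv.1.2.1.symm.trans hd
  obtain ⟨u, rfl⟩ := exists_eq_fin_restrict u
  obtain ⟨v, rfl⟩ := exists_eq_fin_restrict v
  obtain ⟨hum, -, hul⟩ := (isSoP_fin_restrict_iff u).1 hu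
  obtain ⟨hvs, hvr⟩ := (isReducingSoP_fin_restrict_iff v).1 hv
  obtain ⟨hvm, -, hvl⟩ := (isSoP_fin_restrict_iff v).1 hvs
  obtain ⟨w, hwu, hwm, hwl, hw⟩ := exists_extension_notMem_associatedPrimes hum hul hr.le
  refine ⟨d₂, hr.le, fun j => w j, (isReducingSoP_fin_restrict_iff w).2
    ⟨(isSoP_fin_restrict_iff w).2 ⟨hwm, hd, hwl⟩, fun j hj Q hQ hdim => ?_⟩,
    fun i => (hwu i i.2).trans (hux i)⟩
  rcases lt_or_ge j r with hjr | hjr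
  · refine notMem_of_reducing_of_support_le hwm hwl hvm hvl hvr hr
      (fun p hp hwp i hi => ?_) hjr hQ hdim
    have := hsub p hp (fun i => by
      rw [← (hwu i i.2).trans (hux i)]
      exact hwp i i.2) ⟨i, hi⟩
    rwa [← hvy] at this
  · refine hw j (by lia) hjr Q hQ ?_
    rintro rfl
    rw [quotDim_maximalIdeal] at hdim
    lia
end
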